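/- Let θ be a well-founded tree on ℕ. Then every infinite-dimensional closed subspace of the parameterized Tsirelson space φ(θ) contains a further infinite-dimensional subspace isomorphic to a subspace of Tsirelson space T; in particular, φ(θ) contains no minimal subspace and no isomorphic copy of c₀. -/

import Mathlib

def TreeComparable (s t : List ℕ) : Prop := s <+: t ∨ t <+: s

def IsTree (θ : Set (List ℕ)) : Prop := ∀ s ∈ θ, ∀ t : List ℕ, t <+: s → t ∈ θ

def CompIncomp (A B : Set (List ℕ)) : Prop := ∀ s ∈ A, ∀ t ∈ B, ¬ TreeComparable s t

def CompatibleEnum (σ : ℕ ≃ List ℕ) : Prop := ∀ s t : List ℕ, s <+: t → σ.symm s ≤ σ.symm t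

/-- Sup norm of a finitely supported vector. -/
noncomputable def supVal (x : List ℕ →₀ ℝ) : ℝ := ⨆ s : List ℕ, |x s|

/-- Admissible families for the parameterized Tsirelson norm: `k` pairwise completely
incomparable nonempty finite subsets of `θ`, successive for the enumeration `σ`, with
`k ≤ E₁`. -/
def TsAdmissible (θ : Set (List ℕ)) (σ : ℕ ≃ List ℕ) (k : ℕ)
    (E : Fin k → Finset (List ℕ)) : Prop :=
  (∀ i, (E i).Nonempty ∧ ↑(E i) ⊆ θ) ∧
  (∀ i j : Fin k, i < j → ∀ s ∈ E i, ∀ t ∈ E j, σ.symm s < σ.symm t) ∧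
  (∀ i, ∀ s ∈ E i, k ≤ σ.symm s) ∧
  (∀ i j : Fin k, i ≠ j → CompIncomp ↑(E i) ↑(E j))

/-- Admissible families for the unrestricted Tsirelson norm (no complete-incomparability
requirement). -/
def TAdmissible (θ : Set (List ℕ)) (σ : ℕ ≃ List ℕ) (k : ℕ)
    (E : Fin k → Finset (List ℕ)) : Prop :=
  (∀ i, (E i).Nonempty ∧ ↑(E i) ⊆ θ) ∧
  (∀ i j : Fin k, i < j → ∀ s ∈ E i, ∀ t ∈ E j, σ.symm s < σ.symm t) ∧
  (∀ i, ∀ s ∈ E i, k ≤ σ.symm s)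

/-- The inductively defined parameterized Tsirelson norms `‖·‖_{θ,m}`. -/
noncomputable def tsNorm (θ : Set (List ℕ)) (σ : ℕ ≃ List ℕ) : ℕ → (List ℕ →₀ ℝ) → ℝ
  | 0, x => supVal x
  | m + 1, x => max (supVal x)
      (2⁻¹ * sSup { r : ℝ | ∃ (k : ℕ) (E : Fin k → Finset (List ℕ)),
        TsAdmissible θ σ k E ∧ r = ∑ i, tsNorm θ σ m (x.filter (· ∈ E i)) })

/-- The parameterized Tsirelson norm `‖x‖_θ = limₘ ‖x‖_{θ,m}`. -/
noncomputable def tsNormLim (θ : Set (List ℕ)) (σ : ℕ ≃ List ℕ) (x : List ℕ →₀ ℝ) : ℝ :=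
  ⨆ m : ℕ, tsNorm θ σ m x

/-- The inductively defined unrestricted Tsirelson norms. -/
noncomputable def tNorm (θ : Set (List ℕ)) (σ : ℕ ≃ List ℕ) : ℕ → (List ℕ →₀ ℝ) → ℝ
  | 0, x => supVal x
  | m + 1, x => max (supVal x)
      (2⁻¹ * sSup { r : ℝ | ∃ (k : ℕ) (E : Fin k → Finset (List ℕ)),
        TAdmissible θ σ k E ∧ r = ∑ i, tNorm θ σ m (x.filter (· ∈ E i)) })

noncomputable def tNormLim (θ : Set (List ℕ)) (σ : ℕ ≃ List ℕ) (x : List ℕ →₀ ℝ) : ℝ :=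
  ⨆ m : ℕ, tNorm θ σ m x

def HasBranch (θ : Set (List ℕ)) : Prop := ∃ β : ℕ → ℕ, ∀ n, (List.range n).map β ∈ θ

/-- Admissible families for the Figiel–Johnson Tsirelson norm on `c₀₀(ℕ)`. -/
def TsirAdmissible (k : ℕ) (E : Fin k → Finset ℕ) : Prop :=
  (∀ i, (E i).Nonempty) ∧ (∀ i j : Fin k, i < j → ∀ a ∈ E i, ∀ b ∈ E j, a < b) ∧
  ∀ i, ∀ a ∈ E i, k ≤ a

/-- The inductively defined Figiel–Johnson Tsirelson norms on `c₀₀(ℕ)`. -/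
noncomputable def tsirNorm : ℕ → (ℕ →₀ ℝ) → ℝ
  | 0, x => ⨆ n : ℕ, |x n|
  | m + 1, x => max (⨆ n : ℕ, |x n|)
      (2⁻¹ * sSup { r : ℝ | ∃ (k : ℕ) (E : Fin k → Finset ℕ),
        TsirAdmissible k E ∧ r = ∑ i, tsirNorm m (x.filter (· ∈ E i)) })

/-- The Figiel–Johnson Tsirelson norm. -/
noncomputable def tsirNormLim (x : ℕ →₀ ℝ) : ℝ := ⨆ m : ℕ, tsirNorm m x

/-- A normed space is minimal if it is infinite dimensional and embeds isomorphically into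
each of its infinite-dimensional closed subspaces. -/
def IsMinimalSpace (E : Type*) [NormedAddCommGroup E] [NormedSpace ℝ E] : Prop :=
  ¬ FiniteDimensional ℝ E ∧ ∀ F : Submodule ℝ E, IsClosed (F : Set E) →
    ¬ FiniteDimensional ℝ F →
    ∃ T : E →L[ℝ] F, ∃ c : ℝ, 0 < c ∧ ∀ x : E, c * ‖x‖ ≤ ‖T x‖

/-- `X` contains an isomorphic copy of `c₀`. -/
def ContainsC0 (X : Type*) [NormedAddCommGroup X] [NormedSpace ℝ X] : Prop :=
  ∃ (w : ℕ → X) (c C : ℝ), 0 < c ∧ ∀ (n : ℕ) (a : ℕ → ℝ),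
    c * (⨆ k ∈ Finset.range n, |a k|) ≤ ‖∑ k ∈ Finset.range n, a k • w k‖ ∧
    ‖∑ k ∈ Finset.range n, a k • w k‖ ≤ C * (⨆ k ∈ Finset.range n, |a k|)


namespace PTS
open Finset

/-- Restriction of a finitely supported vector to a set of coordinates. -/
noncomputable def res (A : Set ℕ) : (ℕ →₀ ℝ) →ₗ[ℝ] (ℕ →₀ ℝ) := by
  classical
  exact
  { toFun := fun x => x.filter (· ∈ A)
    map_add' := fun x y => Finsupp.filter_add
    map_smul' := fun c x => Finsupp.filter_smul }

open Classical in
theorem res_apply (A : Set ℕ) (x : ℕ →₀ ℝ) (q : ℕ) : res A x q = if q ∈ A then x q else 0 := by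
  simp only [res, LinearMap.coe_mk, AddHom.coe_mk, Finsupp.filter_apply]

theorem res_mem {A : Set ℕ} (x : ℕ →₀ ℝ) {q : ℕ} (h : q ∈ A) : res A x q = x q := by
  rw [res_apply, if_pos h]

theorem res_not_mem {A : Set ℕ} (x : ℕ →₀ ℝ) {q : ℕ} (h : q ∉ A) : res A x q = 0 := by
  rw [res_apply, if_neg h]

theorem filter_eq_res (E : Finset ℕ) (x : ℕ →₀ ℝ) : x.filter (· ∈ E) = res (↑E) x := by
  ext q
  rw [res_apply, Finsupp.filter_apply]
  simp

theorem res_res (A B : Set ℕ) (x : ℕ →₀ ℝ) : res A (res B x) = res (A ∩ B) x := by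
  ext q
  simp only [res_apply, Set.mem_inter_iff]
  by_cases hA : q ∈ A <;> by_cases hB : q ∈ B <;> simp [hA, hB]

theorem res_abs_le (A : Set ℕ) (x : ℕ →₀ ℝ) (q : ℕ) : |res A x q| ≤ |x q| := by
  rw [res_apply]; split_ifs <;> simp

theorem res_eq_self {A : Set ℕ} {x : ℕ →₀ ℝ} (h : ∀ q, x q ≠ 0 → q ∈ A) : res A x = x := by
  ext q
  rw [res_apply]
  split_ifs with hq
  · rfl
  · by_contra hne; exact hq (h q (Ne.symm hne))

theorem res_eq_zero {A : Set ℕ} {x : ℕ →₀ ℝ} (h : ∀ q, x q ≠ 0 → q ∉ A) : res A x = 0 := by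
  ext q
  rw [res_apply]
  split_ifs with hq
  · by_contra hne; exact h q hne hq
  · rfl

theorem res_congr {A B : Set ℕ} {x : ℕ →₀ ℝ} (h : ∀ q, x q ≠ 0 → (q ∈ A ↔ q ∈ B)) :
    res A x = res B x := by
  classical
  ext q
  rw [res_apply, res_apply]
  by_cases hx : x q = 0
  · simp [hx]
  · simp [h q hx]

/-- The sup norm. -/
noncomputable def sN (x : ℕ →₀ ℝ) : ℝ := ⨆ n : ℕ, |x n|

theorem sN_bdd (x : ℕ →₀ ℝ) : BddAbove (Set.range fun n : ℕ => |x n|) := by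
  refine ⟨∑ n ∈ x.support, |x n|, ?_⟩
  rintro _ ⟨n, rfl⟩
  by_cases h : x n = 0
  · simp only [h, abs_zero]; exact Finset.sum_nonneg fun _ _ => abs_nonneg _
  · exact Finset.single_le_sum (f := fun n => |x n|) (fun _ _ => abs_nonneg _)
      (Finsupp.mem_support_iff.2 h)

theorem abs_le_sN (x : ℕ →₀ ℝ) (n : ℕ) : |x n| ≤ sN x := le_ciSup (sN_bdd x) n

theorem sN_le {x : ℕ →₀ ℝ} {B : ℝ} (h : ∀ n, |x n| ≤ B) : sN x ≤ B := ciSup_le h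

theorem sN_nonneg (x : ℕ →₀ ℝ) : 0 ≤ sN x := (abs_nonneg _).trans (abs_le_sN x 0)

/-- The sup norm is attained. -/
theorem sN_attained (x : ℕ →₀ ℝ) (hx : x ≠ 0) : ∃ j, x j ≠ 0 ∧ sN x = |x j| := by
  have hne : x.support.Nonempty := Finsupp.support_nonempty_iff.2 hx
  obtain ⟨j, hj, hmax⟩ := Finset.exists_max_image x.support (fun n => |x n|) hne
  refine ⟨j, Finsupp.mem_support_iff.1 hj, le_antisymm (sN_le fun n => ?_) (abs_le_sN x j)⟩
  by_cases h : x n = 0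
  · simp [h]
  · exact hmax n (Finsupp.mem_support_iff.2 h)

/-- Generic admissible families. -/
def gAdm (R : ℕ → ℕ → Prop) (Θ : Set ℕ) (k : ℕ) (E : Fin k → Finset ℕ) : Prop :=
  (∀ i, (E i).Nonempty ∧ ↑(E i) ⊆ Θ) ∧ (∀ i j : Fin k, i < j → ∀ a ∈ E i, ∀ b ∈ E j, a < b) ∧
  (∀ i, ∀ a ∈ E i, k ≤ a) ∧ (∀ i j : Fin k, i ≠ j → ∀ a ∈ E i, ∀ b ∈ E j, R a b)

/-- Generic Tsirelson-type norms. -/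
noncomputable def gN (R : ℕ → ℕ → Prop) (Θ : Set ℕ) : ℕ → (ℕ →₀ ℝ) → ℝ
  | 0, x => sN x
  | m + 1, x => max (sN x)
      (2⁻¹ * sSup { r : ℝ | ∃ (k : ℕ) (E : Fin k → Finset ℕ),
        gAdm R Θ k E ∧ r = ∑ i, gN R Θ m (res (↑(E i)) x) })

/-- Limit norm. -/
noncomputable def gL (R : ℕ → ℕ → Prop) (Θ : Set ℕ) (x : ℕ →₀ ℝ) : ℝ := ⨆ m : ℕ, gN R Θ m x

variable {R : ℕ → ℕ → Prop} {Θ : Set ℕ}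

/-- The `ℓ₁` norm. -/
noncomputable def l1 (x : ℕ →₀ ℝ) : ℝ := ∑ n ∈ x.support, |x n|

theorem l1_eq_of_subset (x : ℕ →₀ ℝ) {S : Finset ℕ} (h : x.support ⊆ S) :
    l1 x = ∑ n ∈ S, |x n| := by
  refine Finset.sum_subset h fun n _ hn => ?_
  simp [Finsupp.notMem_support_iff.1 hn]

theorem l1_nonneg (x : ℕ →₀ ℝ) : 0 ≤ l1 x := Finset.sum_nonneg fun _ _ => abs_nonneg _

theorem sN_le_l1 (x : ℕ →₀ ℝ) : sN x ≤ l1 x := by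
  refine sN_le fun n => ?_
  by_cases h : x n = 0
  · simp only [h, abs_zero]; exact l1_nonneg x
  · exact Finset.single_le_sum (f := fun n => |x n|) (fun _ _ => abs_nonneg _)
      (Finsupp.mem_support_iff.2 h)

theorem gAdm.disj {k : ℕ} {E : Fin k → Finset ℕ} (h : gAdm R Θ k E) {i j : Fin k} (hij : i ≠ j)
    {q : ℕ} (hi : q ∈ E i) (hj : q ∈ E j) : False := by
  rcases lt_or_gt_of_ne hij with h' | h'
  · exact lt_irrefl _ (h.2.1 i j h' q hi q hj)
  · exact lt_irrefl _ (h.2.1 j i h' q hj q hi)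

theorem res_support_subset (A : Set ℕ) (x : ℕ →₀ ℝ) : (res A x).support ⊆ x.support := by
  intro q hq
  rw [Finsupp.mem_support_iff] at hq ⊢
  intro h0
  apply hq
  rw [res_apply, h0]; simp

theorem sum_l1_le {k : ℕ} {E : Fin k → Finset ℕ} (h : gAdm R Θ k E) (x : ℕ →₀ ℝ) :
    ∑ i, l1 (res (↑(E i)) x) ≤ l1 x := by
  have : ∀ i, l1 (res (↑(E i)) x) = ∑ n ∈ x.support, |res (↑(E i)) x n| := fun i =>
    l1_eq_of_subset _ (res_support_subset _ _)
  simp only [this]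
  rw [Finset.sum_comm]
  refine Finset.sum_le_sum fun n _ => ?_
  by_cases hn : ∃ i, n ∈ E i
  · obtain ⟨i, hi⟩ := hn
    rw [Finset.sum_eq_single i]
    · exact res_abs_le _ _ _
    · intro j _ hji
      rw [res_not_mem, abs_zero]
      intro hj
      exact h.disj hji (by simpa using hj) hi
    · simp
  · push Not at hn
    refine (Finset.sum_eq_zero fun i _ => ?_).trans_le (abs_nonneg _)
    rw [res_not_mem, abs_zero]; simpa using hn i

theorem gN_le_l1 (m : ℕ) (x : ℕ →₀ ℝ) : gN R Θ m x ≤ l1 x := by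
  induction m generalizing x with
  | zero => exact sN_le_l1 x
  | succ m ih =>
    refine max_le (sN_le_l1 x) ?_
    have : sSup { r : ℝ | ∃ (k : ℕ) (E : Fin k → Finset ℕ),
        gAdm R Θ k E ∧ r = ∑ i, gN R Θ m (res (↑(E i)) x) } ≤ l1 x := by
      refine Real.sSup_le ?_ (l1_nonneg x)
      rintro r ⟨k, E, hE, rfl⟩
      exact (Finset.sum_le_sum fun i _ => ih _).trans (sum_l1_le hE x)
    have := l1_nonneg x
    linarith

theorem gN_bdd (m : ℕ) (x : ℕ →₀ ℝ) : BddAbove { r : ℝ | ∃ (k : ℕ) (E : Fin k → Finset ℕ),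
        gAdm R Θ k E ∧ r = ∑ i, gN R Θ m (res (↑(E i)) x) } := by
  refine ⟨l1 x, ?_⟩
  rintro r ⟨k, E, hE, rfl⟩
  exact (Finset.sum_le_sum fun i _ => gN_le_l1 _ _).trans (sum_l1_le hE x)

theorem sN_le_gN (m : ℕ) (x : ℕ →₀ ℝ) : sN x ≤ gN R Θ m x := by
  cases m with
  | zero => exact le_rfl
  | succ m => exact le_max_left _ _

theorem gN_nonneg (m : ℕ) (x : ℕ →₀ ℝ) : 0 ≤ gN R Θ m x := (sN_nonneg x).trans (sN_le_gN m x)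

theorem gN_succ_le {m : ℕ} {x : ℕ →₀ ℝ} {B : ℝ} (h0 : ∀ q, |x q| ≤ B)
    (h : ∀ (k : ℕ) (E : Fin k → Finset ℕ), gAdm R Θ k E →
      2⁻¹ * ∑ i, gN R Θ m (res (↑(E i)) x) ≤ B) : gN R Θ (m + 1) x ≤ B := by
  have hB : 0 ≤ B := (abs_nonneg _).trans (h0 0)
  refine max_le (sN_le h0) ?_
  have : sSup { r : ℝ | ∃ (k : ℕ) (E : Fin k → Finset ℕ),
        gAdm R Θ k E ∧ r = ∑ i, gN R Θ m (res (↑(E i)) x) } ≤ 2 * B := by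
    refine Real.sSup_le ?_ (by linarith)
    rintro r ⟨k, E, hE, rfl⟩
    have := h k E hE
    linarith
  linarith

theorem le_gN_succ (m : ℕ) (x : ℕ →₀ ℝ) {k : ℕ} {E : Fin k → Finset ℕ} (hE : gAdm R Θ k E) :
    2⁻¹ * ∑ i, gN R Θ m (res (↑(E i)) x) ≤ gN R Θ (m + 1) x := by
  refine le_trans ?_ (le_max_right _ _)
  refine mul_le_mul_of_nonneg_left (le_csSup (gN_bdd m x) ⟨k, E, hE, rfl⟩) (by norm_num)

theorem gN_mono_abs (m : ℕ) {x y : ℕ →₀ ℝ} (h : ∀ q, |x q| ≤ |y q|) :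
    gN R Θ m x ≤ gN R Θ m y := by
  induction m generalizing x y with
  | zero => exact sN_le fun q => (h q).trans (abs_le_sN y q)
  | succ m ih =>
    refine gN_succ_le (fun q => (h q).trans ((abs_le_sN y q).trans (sN_le_gN _ _))) ?_
    intro k E hE
    refine le_trans ?_ (le_gN_succ m y hE)
    gcongr with i
    refine ih fun q => ?_
    rw [res_apply, res_apply]
    split_ifs
    · exact h q
    · simp

theorem gN_add_le (m : ℕ) (x y : ℕ →₀ ℝ) : gN R Θ m (x + y) ≤ gN R Θ m x + gN R Θ m y := by
  induction m generalizing x y with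
  | zero =>
    exact sN_le fun q => (abs_add_le _ _).trans (add_le_add (abs_le_sN x q) (abs_le_sN y q))
  | succ m ih =>
    refine gN_succ_le (fun q => (abs_add_le _ _).trans (add_le_add
      ((abs_le_sN x q).trans (sN_le_gN _ _)) ((abs_le_sN y q).trans (sN_le_gN _ _)))) ?_
    intro k E hE
    have h1 := le_gN_succ (R := R) (Θ := Θ) m x hE
    have h2 := le_gN_succ (R := R) (Θ := Θ) m y hE
    have h3 : ∑ i, gN R Θ m (res (↑(E i)) (x + y)) ≤
        ∑ i, (gN R Θ m (res (↑(E i)) x) + gN R Θ m (res (↑(E i)) y)) := by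
      refine Finset.sum_le_sum fun i _ => ?_
      rw [map_add]; exact ih _ _
    rw [Finset.sum_add_distrib] at h3
    linarith

theorem gN_smul_le (m : ℕ) (c : ℝ) (x : ℕ →₀ ℝ) : gN R Θ m (c • x) ≤ |c| * gN R Θ m x := by
  induction m generalizing x with
  | zero =>
    refine sN_le fun q => ?_
    rw [Finsupp.smul_apply, smul_eq_mul, abs_mul]
    exact mul_le_mul_of_nonneg_left (abs_le_sN x q) (abs_nonneg _)
  | succ m ih =>
    refine gN_succ_le (fun q => ?_) ?_
    · rw [Finsupp.smul_apply, smul_eq_mul, abs_mul]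
      exact mul_le_mul_of_nonneg_left ((abs_le_sN x q).trans (sN_le_gN _ _)) (abs_nonneg _)
    intro k E hE
    have h1 := le_gN_succ (R := R) (Θ := Θ) m x hE
    have h3 : ∑ i, gN R Θ m (res (↑(E i)) (c • x)) ≤
        ∑ i, |c| * gN R Θ m (res (↑(E i)) x) := by
      refine Finset.sum_le_sum fun i _ => ?_
      rw [map_smul]; exact ih _
    rw [← Finset.mul_sum] at h3
    have := mul_le_mul_of_nonneg_left h1 (abs_nonneg c)
    linarith

theorem gN_le_succ (m : ℕ) (x : ℕ →₀ ℝ) : gN R Θ m x ≤ gN R Θ (m + 1) x := by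
  induction m generalizing x with
  | zero => exact sN_le_gN 1 x
  | succ m ih =>
    refine gN_succ_le (fun q => (abs_le_sN x q).trans (sN_le_gN _ _)) ?_
    intro k E hE
    refine le_trans ?_ (le_gN_succ (m + 1) x hE)
    gcongr with i
    exact ih _

theorem gN_monotone (x : ℕ →₀ ℝ) : Monotone fun m => gN R Θ m x :=
  monotone_nat_of_le_succ fun m => gN_le_succ m x

theorem gL_bdd (x : ℕ →₀ ℝ) : BddAbove (Set.range fun m => gN R Θ m x) :=
  ⟨l1 x, by rintro _ ⟨m, rfl⟩; exact gN_le_l1 m x⟩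

theorem gN_le_gL (m : ℕ) (x : ℕ →₀ ℝ) : gN R Θ m x ≤ gL R Θ x := le_ciSup (gL_bdd x) m

theorem gL_le {x : ℕ →₀ ℝ} {B : ℝ} (h : ∀ m, gN R Θ m x ≤ B) : gL R Θ x ≤ B := ciSup_le h

theorem gL_le_l1 (x : ℕ →₀ ℝ) : gL R Θ x ≤ l1 x := gL_le fun m => gN_le_l1 m x

theorem gL_nonneg (x : ℕ →₀ ℝ) : 0 ≤ gL R Θ x := (gN_nonneg 0 x).trans (gN_le_gL 0 x)

theorem abs_le_gL (x : ℕ →₀ ℝ) (q : ℕ) : |x q| ≤ gL R Θ x :=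
  (abs_le_sN x q).trans (gN_le_gL 0 x)

theorem gL_mono_abs {x y : ℕ →₀ ℝ} (h : ∀ q, |x q| ≤ |y q|) : gL R Θ x ≤ gL R Θ y :=
  gL_le fun m => (gN_mono_abs m h).trans (gN_le_gL m y)

theorem gL_add_le (x y : ℕ →₀ ℝ) : gL R Θ (x + y) ≤ gL R Θ x + gL R Θ y :=
  gL_le fun m => (gN_add_le m x y).trans (add_le_add (gN_le_gL m x) (gN_le_gL m y))

theorem gL_smul_le (c : ℝ) (x : ℕ →₀ ℝ) : gL R Θ (c • x) ≤ |c| * gL R Θ x :=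
  gL_le fun m => (gN_smul_le m c x).trans
    (mul_le_mul_of_nonneg_left (gN_le_gL m x) (abs_nonneg _))

theorem gL_smul (c : ℝ) (x : ℕ →₀ ℝ) : gL R Θ (c • x) = |c| * gL R Θ x := by
  refine le_antisymm (gL_smul_le c x) ?_
  by_cases hc : c = 0
  · subst hc; simp [gL_nonneg]
  · have := gL_smul_le (R := R) (Θ := Θ) c⁻¹ (c • x)
    rw [smul_smul, inv_mul_cancel₀ hc, one_smul, abs_inv] at this
    have hc' : 0 < |c| := abs_pos.2 hc
    calc |c| * gL R Θ x ≤ |c| * (|c|⁻¹ * gL R Θ (c • x)) :=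
          mul_le_mul_of_nonneg_left this hc'.le
      _ = gL R Θ (c • x) := by field_simp

theorem gL_zero : gL R Θ 0 = 0 := by
  have := gL_smul (R := R) (Θ := Θ) 0 0
  simpa using this

theorem gN_zero (m : ℕ) : gN R Θ m 0 = 0 :=
  le_antisymm ((gN_le_gL m 0).trans gL_zero.le) (gN_nonneg m 0)

theorem gL_sum_le {ι : Type*} (J : Finset ι) (x : ι → ℕ →₀ ℝ) :
    gL R Θ (∑ l ∈ J, x l) ≤ ∑ l ∈ J, gL R Θ (x l) := by
  classical
  induction J using Finset.induction_on with
  | empty => simp [gL_zero]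
  | insert a J ha ih =>
    rw [Finset.sum_insert ha, Finset.sum_insert ha]
    exact (gL_add_le _ _).trans (by linarith)

theorem gN_sum_le {ι : Type*} (m : ℕ) (J : Finset ι) (x : ι → ℕ →₀ ℝ) :
    gN R Θ m (∑ l ∈ J, x l) ≤ ∑ l ∈ J, gN R Θ m (x l) := by
  classical
  induction J using Finset.induction_on with
  | empty => simp [gN_zero]
  | insert a J ha ih =>
    rw [Finset.sum_insert ha, Finset.sum_insert ha]
    exact (gN_add_le _ _ _).trans (by linarith)

theorem gL_sub_comm (x y : ℕ →₀ ℝ) : gL R Θ (x - y) = gL R Θ (y - x) :=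
  le_antisymm (gL_mono_abs fun q => by simp [abs_sub_comm])
    (gL_mono_abs fun q => by simp [abs_sub_comm])

theorem gL_eq_of_abs {x y : ℕ →₀ ℝ} (h : ∀ q, |x q| = |y q|) : gL R Θ x = gL R Θ y :=
  le_antisymm (gL_mono_abs fun q => (h q).le) (gL_mono_abs fun q => (h q).ge)

theorem gL_res_le (A : Set ℕ) (x : ℕ →₀ ℝ) : gL R Θ (res A x) ≤ gL R Θ x :=
  gL_mono_abs (res_abs_le A x)

theorem gN_res_le (m : ℕ) (A : Set ℕ) (x : ℕ →₀ ℝ) : gN R Θ m (res A x) ≤ gN R Θ m x :=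
  gN_mono_abs m (res_abs_le A x)

theorem gL_single (q : ℕ) (c : ℝ) : gL R Θ (Finsupp.single q c) = |c| := by
  refine le_antisymm ?_ ?_
  · refine (gL_le_l1 _).trans ?_
    rw [l1_eq_of_subset _ Finsupp.support_single_subset]
    simp
  · have := abs_le_gL (R := R) (Θ := Θ) (Finsupp.single q c) q
    simpa using this

theorem gL_tendsto (x : ℕ →₀ ℝ) :
    Filter.Tendsto (fun m => gN R Θ m x) Filter.atTop (nhds (gL R Θ x)) :=
  tendsto_atTop_ciSup (gN_monotone x) (gL_bdd x)

theorem le_gL_of_adm (x : ℕ →₀ ℝ) {k : ℕ} {E : Fin k → Finset ℕ} (hE : gAdm R Θ k E) :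
    2⁻¹ * ∑ i, gL R Θ (res (↑(E i)) x) ≤ gL R Θ x := by
  have : Filter.Tendsto (fun m => 2⁻¹ * ∑ i, gN R Θ m (res (↑(E i)) x)) Filter.atTop
      (nhds (2⁻¹ * ∑ i, gL R Θ (res (↑(E i)) x))) :=
    (tendsto_finsetSum _ fun i _ => gL_tendsto _).const_mul _
  exact le_of_tendsto' this fun m => (le_gN_succ m x hE).trans (gN_le_gL _ x)

/-- Flexible form of the lower estimate: unsorted families with possibly empty sets. -/
theorem le_gL_of_flex {ι : Type*} (J : Finset ι) (E : ι → Finset ℕ) (x : ℕ →₀ ℝ)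
    (hΘ : ∀ l ∈ J, ∀ a ∈ E l, a ∈ Θ) (hcard : ∀ l ∈ J, ∀ a ∈ E l, J.card ≤ a)
    (hR : ∀ l ∈ J, ∀ l' ∈ J, l ≠ l' → ∀ a ∈ E l, ∀ b ∈ E l', R a b)
    (hord : ∀ l ∈ J, ∀ l' ∈ J, l ≠ l' →
      (∀ a ∈ E l, ∀ b ∈ E l', a < b) ∨ (∀ a ∈ E l, ∀ b ∈ E l', b < a)) :
    2⁻¹ * ∑ l ∈ J, gL R Θ (res (↑(E l)) x) ≤ gL R Θ x := by
  classical
  rcases J.eq_empty_or_nonempty with hJe | hJne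
  · simp [hJe, gL_nonneg]
  have : Nonempty ι := ⟨hJne.choose⟩
  set J' := J.filter (fun l => (E l).Nonempty) with hJ'
  have hsum : ∑ l ∈ J, gL R Θ (res (↑(E l)) x) = ∑ l ∈ J', gL R Θ (res (↑(E l)) x) := by
    symm
    refine Finset.sum_subset (Finset.filter_subset _ _) fun l hl hl' => ?_
    have : E l = ∅ := by
      by_contra hne
      exact hl' (Finset.mem_filter.2 ⟨hl, Finset.nonempty_iff_ne_empty.2 hne⟩)
    rw [this, res_eq_zero, gL_zero]
    simp
  rw [hsum]
  set key : ι → ℕ := fun l => sInf (↑(E l) : Set ℕ) with hkey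
  have hkm : ∀ l ∈ J', key l ∈ E l := fun l hl => by
    have := Nat.sInf_mem (s := (↑(E l) : Set ℕ)) (by exact_mod_cast (Finset.mem_filter.1 hl).2)
    exact_mod_cast this
  have hmem : ∀ l ∈ J', l ∈ J := fun l hl => (Finset.mem_filter.1 hl).1
  have hinj : Set.InjOn key ↑J' := by
    intro l hl l' hl' h
    by_contra hne
    rcases hord l (hmem l hl) l' (hmem l' hl') hne with h1 | h1
    · exact absurd h (h1 _ (hkm l hl) _ (hkm l' hl')).ne
    · exact absurd h (h1 _ (hkm l hl) _ (hkm l' hl')).ne'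
  set S := J'.image key with hS
  have hScard : S.card = J'.card := Finset.card_image_of_injOn hinj
  have hle : J'.card ≤ J.card := Finset.card_filter_le _ _
  choose! inv hinv using fun (s : ℕ) (hs : s ∈ S) => Finset.mem_image.1 hs
  let e := S.orderEmbOfFin rfl
  have heS : ∀ i, e i ∈ S := fun i => Finset.orderEmbOfFin_mem S rfl i
  have hne : ∀ i j, i ≠ j → inv (e i) ≠ inv (e j) := by
    intro i j hij h
    apply hij
    apply e.injective
    rw [← (hinv _ (heS i)).2, ← (hinv _ (heS j)).2, h]
  have hadm : gAdm R Θ S.card (fun i => E (inv (e i))) := by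
    refine ⟨fun i => ⟨⟨_, hkm _ (hinv _ (heS i)).1⟩, fun a ha => hΘ _ (hmem _ (hinv _ (heS i)).1) a
      (by exact_mod_cast ha)⟩, ?_, ?_, ?_⟩
    · intro i j hij
      rcases hord _ (hmem _ (hinv _ (heS i)).1) _ (hmem _ (hinv _ (heS j)).1)
        (hne i j hij.ne) with h1 | h1
      · exact h1
      · have h2 := h1 _ (hkm _ (hinv _ (heS i)).1) _ (hkm _ (hinv _ (heS j)).1)
        rw [(hinv _ (heS i)).2, (hinv _ (heS j)).2] at h2
        exact absurd (e.strictMono hij) (not_lt.2 h2.le)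
    · intro i a ha
      rw [hScard]
      exact hle.trans (hcard _ (hmem _ (hinv _ (heS i)).1) a ha)
    · intro i j hij
      exact hR _ (hmem _ (hinv _ (heS i)).1) _ (hmem _ (hinv _ (heS j)).1) (hne i j hij)
  have h1 := le_gL_of_adm x hadm
  refine le_trans (le_of_eq ?_) h1
  congr 1
  have h2 : ∑ i : Fin S.card, gL R Θ (res (↑(E (inv (e i)))) x) =
      ∑ s ∈ S, gL R Θ (res (↑(E (inv s))) x) := by
    refine Finset.sum_bij (fun i _ => e i) (fun i _ => heS i) (fun i _ j _ h => e.injective h)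
      (fun s hs => ?_) (fun _ _ => rfl)
    have : s ∈ Set.range (S.orderEmbOfFin rfl) := by
      rw [Finset.range_orderEmbOfFin]; exact_mod_cast hs
    obtain ⟨i, hi⟩ := this
    exact ⟨i, Finset.mem_univ _, hi⟩
  rw [h2, hS, Finset.sum_image hinj]
  refine Finset.sum_congr rfl fun l hl => ?_
  have hl2 := hinv (key l) (Finset.mem_image_of_mem _ hl)
  rw [hinj hl2.1 hl hl2.2]

/-- Approximate description of the norm. -/
theorem gN_succ_approx (m : ℕ) (x : ℕ →₀ ℝ) {ε : ℝ} (hε : 0 < ε) :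
    gN R Θ (m + 1) x = sN x ∨ ∃ (k : ℕ) (E : Fin k → Finset ℕ), gAdm R Θ k E ∧
      gN R Θ (m + 1) x ≤ 2⁻¹ * ∑ i, gN R Θ m (res (↑(E i)) x) + ε := by
  by_cases h : gN R Θ (m + 1) x = sN x
  · exact Or.inl h
  right
  by_contra hcon
  push Not at hcon
  have h1 : sN x < gN R Θ (m + 1) x := lt_of_le_of_ne (sN_le_gN _ _) (Ne.symm h)
  have h2 : gN R Θ (m + 1) x ≤ max (sN x) (gN R Θ (m + 1) x - ε) := by
    conv_lhs => rw [gN]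
    have h3 : sSup { r : ℝ | ∃ (k : ℕ) (E : Fin k → Finset ℕ),
        gAdm R Θ k E ∧ r = ∑ i, gN R Θ m (res (↑(E i)) x) } ≤ 2 * (gN R Θ (m + 1) x - ε) := by
      apply csSup_le
      · refine ⟨0, 0, fun i => i.elim0, ⟨fun i => i.elim0, fun i => i.elim0, fun i => i.elim0,
          fun i => i.elim0⟩, by simp⟩
      · rintro r ⟨k, E, hE, rfl⟩
        have := hcon k E hE
        linarith
    exact max_le_max le_rfl (by linarith)
  rcases le_max_iff.1 h2 with h3 | h3 <;> linarith

end PTS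

namespace PTS
open Finset

/-- Tsirelson level norms. -/
noncomputable abbrev tN (m : ℕ) (x : ℕ →₀ ℝ) : ℝ := gN (fun _ _ => True) Set.univ m x
/-- Tsirelson norm. -/
noncomputable abbrev tL (x : ℕ →₀ ℝ) : ℝ := gL (fun _ _ => True) Set.univ x

theorem le_tL_of_flex {ι : Type*} (J : Finset ι) (E : ι → Finset ℕ) (x : ℕ →₀ ℝ)
    (hcard : ∀ l ∈ J, ∀ a ∈ E l, J.card ≤ a)
    (hord : ∀ l ∈ J, ∀ l' ∈ J, l ≠ l' →
      (∀ a ∈ E l, ∀ b ∈ E l', a < b) ∨ (∀ a ∈ E l, ∀ b ∈ E l', b < a)) :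
    2⁻¹ * ∑ l ∈ J, tL (res (↑(E l)) x) ≤ tL x :=
  le_gL_of_flex J E x (fun _ _ _ _ => Set.mem_univ _) hcard (fun _ _ _ _ _ _ _ _ _ => trivial) hord

theorem res_singleton (q : ℕ) (x : ℕ →₀ ℝ) : res {q} x = Finsupp.single q (x q) := by
  classical
  ext n
  rw [res_apply, Finsupp.single_apply]
  by_cases h : n = q
  · subst h; simp
  · have : q ≠ n := fun h' => h h'.symm
    simp [h, this]

theorem tN_decomp (m : ℕ) (x : ℕ →₀ ℝ) (hx : x ≠ 0) {ε : ℝ} (hε : 0 < ε) :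
    ∃ (j : ℕ) (E : ℕ → Set ℕ), x j ≠ 0 ∧ (∀ i i', i ≠ i' → Disjoint (E i) (E i')) ∧
      (∀ i, ∀ q ∈ E i, j < q) ∧
      tN (m + 1) x ≤ |x j| + 2⁻¹ * ∑ i ∈ range j, tN m (res (E i) x) + ε := by
  classical
  obtain ⟨j0, hj0, hs0⟩ := sN_attained x hx
  have triv : tN (m + 1) x ≤ |x j0| + ε → ∃ (j : ℕ) (E : ℕ → Set ℕ), x j ≠ 0 ∧
      (∀ i i', i ≠ i' → Disjoint (E i) (E i')) ∧ (∀ i, ∀ q ∈ E i, j < q) ∧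
      tN (m + 1) x ≤ |x j| + 2⁻¹ * ∑ i ∈ range j, tN m (res (E i) x) + ε := by
    intro h
    refine ⟨j0, fun _ => ∅, hj0, fun _ _ _ => by simp, by simp, ?_⟩
    have : 0 ≤ ∑ i ∈ range j0, tN m (res ∅ x) := Finset.sum_nonneg fun _ _ => gN_nonneg _ _
    linarith
  rcases gN_succ_approx (R := fun _ _ => True) (Θ := Set.univ) m x hε with h | ⟨k, E, hE, h⟩
  · apply triv
    rw [tN, h, hs0]; linarith
  by_cases hhit : ∃ q, x q ≠ 0 ∧ ∃ i, q ∈ E i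
  swap
  · apply triv
    have : ∑ i, tN m (res (↑(E i)) x) = 0 := Finset.sum_eq_zero fun i _ => by
      rw [res_eq_zero, tN, gN_zero]
      intro q hq hqE
      exact hhit ⟨q, hq, i, by simpa using hqE⟩
    have h' : tN (m + 1) x ≤ 2⁻¹ * ∑ i, tN m (res (↑(E i)) x) + ε := h
    rw [this] at h'
    have := abs_nonneg (x j0)
    linarith
  · set j := Nat.find hhit with hj
    obtain ⟨hxj, i0, hi0⟩ := Nat.find_spec hhit
    have hmin : ∀ q, x q ≠ 0 → ∀ i, q ∈ E i → j ≤ q := fun q hq i hi => Nat.find_min' hhit ⟨hq, i, hi⟩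
    have hkj : k ≤ j := hE.2.2.1 i0 _ hi0
    refine ⟨j, fun i => if hi : i < k then {q | q ∈ E ⟨i, hi⟩ ∧ j < q} else ∅, hxj, ?_, ?_, ?_⟩
    · intro i i' hii
      rw [Set.disjoint_left]
      intro q hq hq'
      by_cases hi : i < k <;> by_cases hi' : i' < k <;> simp [hi, hi'] at hq hq'
      exact hE.disj (i := ⟨i, hi⟩) (j := ⟨i', hi'⟩) (by simpa using hii) hq.1 hq'.1
    · intro i q hq
      by_cases hi : i < k <;> simp [hi] at hq
      exact hq.2
    · refine h.trans ?_
      have hle : ∑ i, tN m (res (↑(E i)) x) ≤ |x j| +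
          ∑ i : Fin k, tN m (res {q | q ∈ E i ∧ j < q} x) := by
        have h1 : ∀ i : Fin k, tN m (res (↑(E i)) x) ≤
            (if i = i0 then |x j| else 0) + tN m (res {q | q ∈ E i ∧ j < q} x) := by
          intro i
          split_ifs with hi
          · have : res (↑(E i)) x = res {j} x + res {q | q ∈ E i ∧ j < q} x := by
              ext q
              rw [Finsupp.add_apply]
              by_cases hxq : x q = 0
              · simp [res_apply, hxq]
              by_cases hq : q ∈ E i
              · rw [res_mem x (by simpa using hq)]
                rcases (hmin q hxq i hq).eq_or_lt with h1 | h1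
                · rw [res_mem x (by simp [h1]), res_not_mem x (by simp [← h1]), add_zero]
                · rw [res_not_mem x (by simp; exact h1.ne'), res_mem (A := {q | q ∈ E i ∧ j < q}) x ⟨hq, h1⟩, zero_add]
              · rw [res_not_mem x (by simpa using hq), res_not_mem x, res_not_mem x, add_zero]
                · exact fun h => hq h.1
                · intro h1
                  simp only [Set.mem_singleton_iff] at h1
                  exact hq (h1 ▸ hi ▸ hi0)
            rw [this]
            refine (gN_add_le _ _ _).trans (add_le_add ?_ le_rfl)
            rw [res_singleton]
            exact (gN_le_gL _ _).trans (gL_single _ _).le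
          · rw [zero_add]
            refine le_of_eq ?_
            congr 1
            apply res_congr
            intro q hq
            simp only [Finset.mem_coe, Set.mem_ofPred_eq]
            refine ⟨fun h1 => ⟨h1, ?_⟩, fun h1 => h1.1⟩
            refine lt_of_le_of_ne (hmin q hq i h1) ?_
            intro h2
            exact hE.disj hi h1 (h2 ▸ hi0)
        refine (Finset.sum_le_sum fun i _ => h1 i).trans ?_
        rw [Finset.sum_add_distrib]
        simp
      have hle2 : ∑ i : Fin k, tN m (res {q | q ∈ E i ∧ j < q} x) ≤
          ∑ i ∈ range j, tN m (res (if hi : i < k then {q | q ∈ E ⟨i, hi⟩ ∧ j < q} else ∅) x) := by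
        have h2 := Finset.sum_range (n := k)
          (fun i => tN m (res (if hi : i < k then {q | q ∈ E ⟨i, hi⟩ ∧ j < q} else ∅) x))
        simp only [Fin.is_lt, dif_pos, Fin.eta] at h2
        rw [← h2]
        exact Finset.sum_le_sum_of_subset_of_nonneg (Finset.range_mono hkj)
          fun _ _ _ => gN_nonneg _ _
      have := abs_nonneg (x j)
      change 2⁻¹ * ∑ i, tN m (res (↑(E i)) x) + ε ≤ _
      linarith

/-- The stage after `j` relative to `J`. -/
def St (J : Finset ℕ) (j : ℕ) : Set ℕ := {q | j < q ∧ ∀ j' ∈ J, j < j' → q < j'}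

theorem tN_stage (m : ℕ) (J : Finset ℕ) (w : ℕ →₀ ℝ) (hw : ∀ q, w q ≠ 0 → ∃ j ∈ J, j < q) :
    tN m w ≤ ∑ j ∈ J, |w j| + ∑ j ∈ J, tN m (res (St J j) w) := by
  classical
  have heq : w = ∑ j ∈ J, res {j} w + ∑ j ∈ J, res (St J j) w := by
    ext q
    rw [Finsupp.add_apply, Finsupp.finsetSum_apply, Finsupp.finsetSum_apply]
    by_cases hq : w q = 0
    · rw [hq, Finset.sum_eq_zero, Finset.sum_eq_zero, add_zero]
      · intro j _; rw [res_apply, hq]; simp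
      · intro j _; rw [res_apply, hq]; simp
    by_cases hqJ : q ∈ J
    · rw [Finset.sum_eq_single_of_mem q hqJ, res_mem w (by simp), Finset.sum_eq_zero, add_zero]
      · intro j _
        rw [res_not_mem]
        rintro ⟨h1, h2⟩
        exact lt_irrefl _ (h2 q hqJ h1)
      · intro j _ hjq
        rw [res_not_mem]; simpa using hjq.symm
    · obtain ⟨j0, hj0, hlt⟩ := hw q hq
      have hne : (J.filter (· < q)).Nonempty := ⟨j0, Finset.mem_filter.2 ⟨hj0, hlt⟩⟩
      have hmx := Finset.mem_filter.1 (Finset.max'_mem _ hne)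
      set jm := (J.filter (· < q)).max' hne
      have hjm : q ∈ St J jm := ⟨hmx.2, fun j' hj' hlt' => by
        by_contra hcon
        have hj'q : j' < q := lt_of_le_of_ne (not_lt.1 hcon) (fun h => hqJ (h ▸ hj'))
        exact absurd (Finset.le_max' _ j' (Finset.mem_filter.2 ⟨hj', hj'q⟩)) (not_le.2 hlt')⟩
      rw [Finset.sum_eq_zero, Finset.sum_eq_single_of_mem jm hmx.1, res_mem w hjm, zero_add]
      · intro j hj hjne
        rw [res_not_mem]
        intro hjq
        rcases lt_or_gt_of_ne hjne with h1 | h1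
        · exact absurd (hjq.2 jm hmx.1 h1) (not_lt.2 hmx.2.le)
        · exact absurd (hjm.2 j hj h1) (not_lt.2 hjq.1.le)
      · intro j hj
        rw [res_not_mem]
        simp only [Set.mem_singleton_iff]
        exact fun h => hqJ (h ▸ hj)
  calc tN m w = tN m (∑ j ∈ J, res {j} w + ∑ j ∈ J, res (St J j) w) := by rw [← heq]
    _ ≤ _ := (gN_add_le _ _ _).trans (add_le_add ((gN_sum_le _ _ _).trans
        (Finset.sum_le_sum fun j _ => by
          rw [res_singleton]; exact (gN_le_gL _ _).trans (gL_single _ _).le)) (gN_sum_le _ _ _))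

theorem tL_stage (J : Finset ℕ) (y : ℕ →₀ ℝ) (hJ : ∀ j ∈ J, 2 * J.card ≤ j) :
    2⁻¹ * ∑ j ∈ J, (|y j| + tL (res (St J j) y)) ≤ tL y := by
  classical
  let E : ℕ × Bool → Finset ℕ := fun z => if z.2 then y.support.filter (· ∈ St J z.1) else {z.1}
  have hE0 : ∀ z : ℕ × Bool, ∀ a ∈ E z, (z.2 = false ∧ a = z.1) ∨ (z.2 = true ∧ a ∈ St J z.1) := by
    rintro ⟨j, b⟩ a ha
    cases b
    · left; simpa [E] using ha
    · right; simp [E] at ha; exact ⟨rfl, ha.2⟩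
  have hE1 : ∀ z : ℕ × Bool, ∀ a ∈ E z, z.1 ≤ a := by
    intro z a ha
    rcases hE0 z a ha with h | h
    · exact h.2.ge
    · exact h.2.1.le
  have hE2 : ∀ z : ℕ × Bool, ∀ a ∈ E z, ∀ j' ∈ J, z.1 < j' → a < j' := by
    intro z a ha j' hj' hlt
    rcases hE0 z a ha with h | h
    · exact h.2 ▸ hlt
    · exact h.2.2 j' hj' hlt
  have := le_tL_of_flex (J ×ˢ (Finset.univ : Finset Bool)) E y ?_ ?_
  · refine le_trans (le_of_eq ?_) this
    congr 1
    rw [Finset.sum_product]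
    refine Finset.sum_congr rfl fun j hj => ?_
    simp only [Fintype.univ_bool, Finset.mem_singleton, Bool.true_eq_false, not_false_eq_true,
      Finset.sum_insert, Finset.sum_singleton, E, if_true, Bool.false_eq_true, if_false]
    rw [add_comm]
    congr 1
    · congr 1
      apply res_congr
      intro q hq
      simp [hq]
    · rw [Finset.coe_singleton, res_singleton, tL, gL_single]
  · intro z hz a ha
    rw [Finset.mem_product] at hz
    refine le_trans ?_ (hE1 z a ha)
    rw [Finset.card_product]
    simp only [Finset.card_univ, Fintype.card_bool]
    have := hJ z.1 hz.1
    omega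
  · intro z hz z' hz' hne
    rw [Finset.mem_product] at hz hz'
    rcases lt_trichotomy z.1 z'.1 with h | h | h
    · left
      intro a ha b hb
      exact (hE2 z a ha _ hz'.1 h).trans_le (hE1 z' b hb)
    · have h2 : z.2 ≠ z'.2 := fun h2 => hne (Prod.ext h h2)
      cases hz2 : z.2
      · left
        intro a ha b hb
        rcases hE0 z a ha with h3 | h3
        · rcases hE0 z' b hb with h4 | h4
          · exact absurd (h3.1.trans h4.1.symm) h2
          · rw [h3.2, h]; exact h4.2.1
        · simp [hz2] at h3
      · right
        intro a ha b hb
        rcases hE0 z a ha with h3 | h3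
        · simp [hz2] at h3
        · rcases hE0 z' b hb with h4 | h4
          · rw [h4.2, ← h]; exact h3.2.1
          · exact absurd (h3.1.trans h4.1.symm) h2
    · right
      intro a ha b hb
      exact (hE2 z' b hb _ hz.1 h).trans_le (hE1 z a ha)

/-- Tail `1`-concavity of the Tsirelson norm on sparse sets of coordinates. -/
theorem tN_concave (P : Set ℕ) (hP : ∀ a ∈ P, ∀ b ∈ P, a < b → a * a ≤ b) (m : ℕ) :
    ∀ (ι : Type) (Λ : Finset ι) (x : ι → ℕ →₀ ℝ) (y : ℕ →₀ ℝ),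
      (∀ l ∈ Λ, ∀ q, x l q ≠ 0 → q ∈ P ∧ 2 * Λ.card ≤ q) →
      (∀ q, ∑ l ∈ Λ, |x l q| ≤ |y q|) → 2⁻¹ * ∑ l ∈ Λ, tN m (x l) ≤ tL y := by
  classical
  induction m with
  | zero =>
    intro ι Λ x y hx hy
    set Λ' := Λ.filter (fun l => x l ≠ 0) with hΛ'
    have hsum : ∑ l ∈ Λ, tN 0 (x l) = ∑ l ∈ Λ', tN 0 (x l) := by
      symm
      refine Finset.sum_subset (Finset.filter_subset _ _) fun l hl hl' => ?_
      have : x l = 0 := by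
        by_contra h; exact hl' (Finset.mem_filter.2 ⟨hl, h⟩)
      rw [this]; exact gN_zero 0
    choose! j hj1 hj2 using fun (l : ι) (h : x l ≠ 0) => sN_attained (x l) h
    set J := Λ'.image j
    have hJ : ∀ q ∈ J, 2 * J.card ≤ q := by
      intro q hq
      obtain ⟨l, hl, rfl⟩ := Finset.mem_image.1 hq
      have hl' := Finset.mem_filter.1 hl
      have h1 := (hx l hl'.1 _ (hj1 l hl'.2)).2
      have h2 : J.card ≤ Λ'.card := Finset.card_image_le
      have h3 : Λ'.card ≤ Λ.card := Finset.card_filter_le _ _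
      omega
    refine le_trans ?_ (tL_stage J y hJ)
    rw [hsum]
    gcongr
    calc ∑ l ∈ Λ', tN 0 (x l) ≤ ∑ l ∈ Λ', ∑ q ∈ J, |x l q| := by
          refine Finset.sum_le_sum fun l hl => ?_
          rw [show tN 0 (x l) = sN (x l) from rfl, hj2 l (Finset.mem_filter.1 hl).2]
          exact Finset.single_le_sum (f := fun q => |x l q|) (fun _ _ => abs_nonneg _)
            (Finset.mem_image_of_mem j hl)
      _ = ∑ q ∈ J, ∑ l ∈ Λ', |x l q| := Finset.sum_comm
      _ ≤ ∑ q ∈ J, |y q| := Finset.sum_le_sum fun q _ => le_trans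
          (Finset.sum_le_sum_of_subset_of_nonneg (Finset.filter_subset _ _)
            fun _ _ _ => abs_nonneg _) (hy q)
      _ ≤ _ := Finset.sum_le_sum fun q _ => le_add_of_nonneg_right (gL_nonneg _)
  | succ m ih =>
    intro ι Λ x y hx hy
    set Λ' := Λ.filter (fun l => x l ≠ 0) with hΛ'
    have hsum : ∑ l ∈ Λ, tN (m + 1) (x l) = ∑ l ∈ Λ', tN (m + 1) (x l) := by
      symm
      refine Finset.sum_subset (Finset.filter_subset _ _) fun l hl hl' => ?_
      have : x l = 0 := by
        by_contra h; exact hl' (Finset.mem_filter.2 ⟨hl, h⟩)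
      rw [this]; exact gN_zero _
    have hΛmem : ∀ l ∈ Λ', l ∈ Λ ∧ x l ≠ 0 := fun l hl => Finset.mem_filter.1 hl
    refine le_of_forall_pos_le_add fun ε' hε' => ?_
    set ε : ℝ := ε' / (Λ.card + 1) with hεdef
    have hε : 0 < ε := by positivity
    choose! j E hj1 hE1 hE2 hj2 using fun (l : ι) (h : x l ≠ 0) => tN_decomp m (x l) h hε
    set J := Λ'.image j with hJdef
    have hcard : J.card ≤ Λ.card := Finset.card_image_le.trans (Finset.card_filter_le _ _)
    have hjJ : ∀ l ∈ Λ', j l ∈ J := fun l hl => Finset.mem_image_of_mem j hl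
    have hJP : ∀ q ∈ J, q ∈ P ∧ 2 * Λ.card ≤ q := by
      intro q hq
      obtain ⟨l, hl, rfl⟩ := Finset.mem_image.1 hq
      exact hx l (hΛmem l hl).1 _ (hj1 l (hΛmem l hl).2)
    have hJ : ∀ q ∈ J, 2 * J.card ≤ q := fun q hq => by
      have := (hJP q hq).2; omega
    -- individual estimate
    have hind : ∀ l ∈ Λ', tN (m + 1) (x l) ≤ ∑ q ∈ J, |x l q| +
        ∑ q ∈ J, 2⁻¹ * ∑ i ∈ range (j l), tN m (res (St J q) (res (E l i) (x l))) + ε := by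
      intro l hl
      have hxl := (hΛmem l hl).2
      have h1 : ∀ i, tN m (res (E l i) (x l)) ≤ ∑ q ∈ J, |res (E l i) (x l) q| +
          ∑ q ∈ J, tN m (res (St J q) (res (E l i) (x l))) := by
        intro i
        refine tN_stage m J _ fun q hq => ⟨j l, hjJ l hl, ?_⟩
        apply hE2 l hxl i q
        by_contra hcon
        exact hq (res_not_mem _ hcon)
      have h2 : ∑ i ∈ range (j l), tN m (res (E l i) (x l)) ≤
          ∑ q ∈ J, ∑ i ∈ range (j l), |res (E l i) (x l) q| +
          ∑ q ∈ J, ∑ i ∈ range (j l), tN m (res (St J q) (res (E l i) (x l))) := by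
        refine (Finset.sum_le_sum fun i _ => h1 i).trans ?_
        rw [Finset.sum_add_distrib]
        exact le_of_eq (congrArg₂ _ Finset.sum_comm Finset.sum_comm)
      have h3 : |x l (j l)| + 2⁻¹ * ∑ q ∈ J, ∑ i ∈ range (j l), |res (E l i) (x l) q| ≤
          ∑ q ∈ J, |x l q| := by
        have h4 : ∀ q ∈ J, (if q = j l then |x l (j l)| else 0) +
            2⁻¹ * ∑ i ∈ range (j l), |res (E l i) (x l) q| ≤ |x l q| := by
          intro q _
          split_ifs with hq
          · rw [Finset.sum_eq_zero, mul_zero, add_zero, hq]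
            intro i _
            rw [res_not_mem, abs_zero]
            intro hmem
            exact absurd (hE2 l hxl i q hmem) (by omega)
          · have h5 : ∑ i ∈ range (j l), |res (E l i) (x l) q| ≤ |x l q| := by
              by_cases hex : ∃ i ∈ range (j l), q ∈ E l i
              · obtain ⟨i, hi, hqi⟩ := hex
                rw [Finset.sum_eq_single_of_mem i hi]
                · exact res_abs_le _ _ _
                · intro i' _ hii
                  rw [res_not_mem, abs_zero]
                  intro hqi'
                  exact Set.disjoint_left.1 (hE1 l hxl i' i hii) hqi' hqi
              · push Not at hex
                refine (Finset.sum_eq_zero fun i hi => ?_).trans_le (abs_nonneg _)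
                rw [res_not_mem _ (hex i hi), abs_zero]
            have := abs_nonneg (x l q)
            linarith
        have h5 := Finset.sum_le_sum h4
        rw [Finset.sum_add_distrib, Finset.sum_ite_eq' J (j l), if_pos (hjJ l hl),
          ← Finset.mul_sum] at h5
        exact h5
      have h6 := hj2 l hxl
      rw [← Finset.mul_sum]
      linarith
    have hstage : ∀ q ∈ J, 2⁻¹ * ∑ l ∈ Λ', ∑ i ∈ range (j l),
        tN m (res (St J q) (res (E l i) (x l))) ≤ tL (res (St J q) y) := by
      intro q hq
      have hqq := hJP q hq
      have key := ih (ι × ℕ) ((Λ'.filter (fun l => j l ≤ q)) ×ˢ range q)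
        (fun z => res (St J q) (res (E z.1 z.2) (x z.1))) (res (St J q) y) ?_ ?_
      · refine le_trans ?_ key
        refine mul_le_mul_of_nonneg_left ?_ (by norm_num)
        rw [Finset.sum_product]
        rw [Finset.sum_filter (s := Λ') (p := fun l => j l ≤ q)]
        refine Finset.sum_le_sum (fun l hl => ?_)
        split_ifs with hlq
        · exact Finset.sum_le_sum_of_subset_of_nonneg (Finset.range_mono hlq)
            fun _ _ _ => gN_nonneg _ _
        · refine (Finset.sum_eq_zero fun i _ => ?_).le
          rw [res_eq_zero, tN, gN_zero]
          intro r hr hrS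
          have hrE : r ∈ E l i := by
            by_contra hcon; exact hr (res_not_mem _ hcon)
          have h1 := hE2 l (hΛmem l hl).2 i r hrE
          exact absurd (hrS.2 _ (hjJ l hl) (not_le.1 hlq)) (by omega)
      · intro z hz r hr
        rw [Finset.mem_product, Finset.mem_filter] at hz
        have hrS : r ∈ St J q := by
          by_contra hcon; exact hr (res_not_mem _ hcon)
        rw [res_mem _ hrS] at hr
        have hxr : x z.1 r ≠ 0 := by
          intro h0; apply hr; rw [res_apply, h0]; simp
        have hzl := hΛmem z.1 hz.1.1
        have h1 := hx z.1 hzl.1 r hxr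
        refine ⟨h1.1, ?_⟩
        have h2 := hP q hqq.1 r h1.1 hrS.1
        rw [Finset.card_product, Finset.card_range]
        have h3 : (Λ'.filter (fun l => j l ≤ q)).card ≤ Λ.card :=
          (Finset.card_filter_le _ _).trans (Finset.card_filter_le _ _)
        calc 2 * ((Λ'.filter (fun l => j l ≤ q)).card * q) ≤ 2 * (Λ.card * q) := by gcongr
          _ = (2 * Λ.card) * q := by ring
          _ ≤ q * q := by gcongr; exact hqq.2
          _ ≤ r := h2
      · intro r
        by_cases hrS : r ∈ St J q
        · rw [res_mem _ hrS]
          refine le_trans ?_ (hy r)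
          rw [Finset.sum_product]
          have hsub : Λ'.filter (fun l => j l ≤ q) ⊆ Λ :=
            (Finset.filter_subset _ _).trans (Finset.filter_subset _ _)
          refine le_trans (Finset.sum_le_sum fun l hl => ?_)
            (Finset.sum_le_sum_of_subset_of_nonneg hsub fun _ _ _ => abs_nonneg _)
          have hxl := (hΛmem l (Finset.mem_filter.1 hl).1).2
          simp only [res_mem _ hrS]
          by_cases hex : ∃ i ∈ range q, r ∈ E l i
          · obtain ⟨i, hi, hqi⟩ := hex
            rw [Finset.sum_eq_single_of_mem i hi]
            · exact res_abs_le _ _ _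
            · intro i' _ hii
              rw [res_not_mem, abs_zero]
              intro hqi'
              exact Set.disjoint_left.1 (hE1 l hxl i' i hii) hqi' hqi
          · push Not at hex
            refine (Finset.sum_eq_zero fun i hi => ?_).trans_le (abs_nonneg _)
            rw [res_not_mem _ (hex i hi), abs_zero]
        · refine (Finset.sum_eq_zero fun z _ => ?_).trans_le (abs_nonneg _)
          rw [res_not_mem _ hrS, abs_zero]
    have htot := tL_stage J y hJ
    have h1 := Finset.sum_le_sum hind
    rw [Finset.sum_add_distrib, Finset.sum_add_distrib] at h1
    have h2 : ∑ l ∈ Λ', ∑ q ∈ J, |x l q| ≤ ∑ q ∈ J, |y q| := by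
      rw [Finset.sum_comm]
      exact Finset.sum_le_sum fun q _ => le_trans
          (Finset.sum_le_sum_of_subset_of_nonneg (Finset.filter_subset _ _)
            fun _ _ _ => abs_nonneg _) (hy q)
    have h3 : ∑ l ∈ Λ', ∑ q ∈ J, 2⁻¹ * ∑ i ∈ range (j l),
        tN m (res (St J q) (res (E l i) (x l))) ≤ ∑ q ∈ J, tL (res (St J q) y) := by
      rw [Finset.sum_comm]
      refine Finset.sum_le_sum fun q hq => ?_
      rw [← Finset.mul_sum]
      exact hstage q hq
    have h4 : ∑ l ∈ Λ', ε ≤ ε' := by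
      rw [Finset.sum_const, nsmul_eq_mul]
      have h5 : (Λ'.card : ℝ) ≤ Λ.card + 1 := by
        have : Λ'.card ≤ Λ.card := Finset.card_filter_le _ _
        have : (Λ'.card : ℝ) ≤ Λ.card := by exact_mod_cast this
        linarith
      calc (Λ'.card : ℝ) * ε ≤ (Λ.card + 1) * ε := by gcongr
        _ = ε' := by rw [hεdef]; field_simp
    rw [hsum]
    rw [Finset.sum_add_distrib] at htot
    linarith

theorem tL_concave {P : Set ℕ} (hP : ∀ a ∈ P, ∀ b ∈ P, a < b → a * a ≤ b)
    {ι : Type} (Λ : Finset ι) (x : ι → ℕ →₀ ℝ) (y : ℕ →₀ ℝ)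
    (hx : ∀ l ∈ Λ, ∀ q, x l q ≠ 0 → q ∈ P ∧ 2 * Λ.card ≤ q)
    (hy : ∀ q, ∑ l ∈ Λ, |x l q| ≤ |y q|) : 2⁻¹ * ∑ l ∈ Λ, tL (x l) ≤ tL y := by
  have : Filter.Tendsto (fun m => 2⁻¹ * ∑ l ∈ Λ, tN m (x l)) Filter.atTop
      (nhds (2⁻¹ * ∑ l ∈ Λ, tL (x l))) :=
    (tendsto_finsetSum _ fun i _ => gL_tendsto _).const_mul _
  exact le_of_tendsto' this fun m => tN_concave P hP m ι Λ x y hx hy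

end PTS

namespace PTS
open Finset

/-- The vector `∑ a_j e_{p_j}`. -/
noncomputable def vec (p : ℕ → ℕ) (J : Finset ℕ) (a : ℕ → ℝ) : ℕ →₀ ℝ :=
  ∑ j ∈ J, Finsupp.single (p j) (a j)

theorem vec_apply {p : ℕ → ℕ} (hp : Function.Injective p) {J : Finset ℕ} {a : ℕ → ℝ} {j : ℕ}
    (hj : j ∈ J) : vec p J a (p j) = a j := by
  classical
  rw [vec, Finsupp.finsetSum_apply, Finset.sum_eq_single_of_mem j hj]
  · simp
  · intro i _ hij
    rw [Finsupp.single_apply, if_neg]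
    exact fun h => hij (hp h)

theorem vec_apply_not {p : ℕ → ℕ} {J : Finset ℕ} {a : ℕ → ℝ} {q : ℕ}
    (hj : ∀ j ∈ J, p j ≠ q) : vec p J a q = 0 := by
  classical
  rw [vec, Finsupp.finsetSum_apply, Finset.sum_eq_zero]
  intro i hi
  rw [Finsupp.single_apply, if_neg (hj i hi)]

theorem vec_ne {p : ℕ → ℕ} {J : Finset ℕ} {a : ℕ → ℝ} {q : ℕ}
    (h : vec p J a q ≠ 0) : ∃ j ∈ J, p j = q := by
  by_contra hcon
  push Not at hcon
  exact h (vec_apply_not hcon)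

theorem res_vec (p : ℕ → ℕ) (J : Finset ℕ) (a : ℕ → ℝ) (A : Set ℕ)
    [DecidablePred fun j => p j ∈ A] :
    res A (vec p J a) = vec p (J.filter (fun j => p j ∈ A)) a := by
  rw [vec, vec, map_sum, Finset.sum_filter]
  refine Finset.sum_congr rfl fun j _ => ?_
  split_ifs with h
  · apply res_eq_self
    intro q hq
    rw [Finsupp.single_apply] at hq
    split_ifs at hq with h1
    · exact h1 ▸ h
    · exact absurd rfl hq
  · apply res_eq_zero
    intro q hq
    rw [Finsupp.single_apply] at hq
    split_ifs at hq with h1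
    · exact h1 ▸ h
    · exact absurd rfl hq

theorem vec_abs_mono {p : ℕ → ℕ} (hp : Function.Injective p) {J J' : Finset ℕ} (h : J ⊆ J')
    {a b : ℕ → ℝ} (hab : ∀ j ∈ J, |a j| ≤ |b j|) (q : ℕ) :
    |vec p J a q| ≤ |vec p J' b q| := by
  by_cases hq : ∃ j ∈ J, p j = q
  · obtain ⟨j, hj, rfl⟩ := hq
    rw [vec_apply hp hj, vec_apply hp (h hj)]
    exact hab j hj
  · push Not at hq
    rw [vec_apply_not hq, abs_zero]
    exact abs_nonneg _

theorem tL_vec_mono {p : ℕ → ℕ} (hp : Function.Injective p) {J J' : Finset ℕ} (h : J ⊆ J')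
    {a b : ℕ → ℝ} (hab : ∀ j ∈ J, |a j| ≤ |b j|) : tL (vec p J a) ≤ tL (vec p J' b) :=
  gL_mono_abs (vec_abs_mono hp h hab)

theorem abs_le_tL_vec {p : ℕ → ℕ} (hp : Function.Injective p) {J : Finset ℕ}
    {a : ℕ → ℝ} {j : ℕ} (hj : j ∈ J) : |a j| ≤ tL (vec p J a) := by
  have := abs_le_gL (R := fun _ _ => True) (Θ := Set.univ) (vec p J a) (p j)
  rwa [vec_apply hp hj] at this

theorem block_apply {z : ℕ → ℕ →₀ ℝ}
    (hord : ∀ i j, i < j → ∀ a b, z i a ≠ 0 → z j b ≠ 0 → a < b)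
    {J : Finset ℕ} {a : ℕ → ℝ} {j q : ℕ} (hj : j ∈ J) (hq : z j q ≠ 0) :
    (∑ i ∈ J, a i • z i) q = a j * z j q := by
  rw [Finsupp.finsetSum_apply, Finset.sum_eq_single_of_mem j hj]
  · simp
  · intro i _ hij
    have : z i q = 0 := by
      by_contra hcon
      rcases lt_or_gt_of_ne hij with h | h
      · exact absurd (hord i j h q q hcon hq) (lt_irrefl _)
      · exact absurd (hord j i h q q hq hcon) (lt_irrefl _)
    simp [this]

theorem block_ne {z : ℕ → ℕ →₀ ℝ}
    {J : Finset ℕ} {a : ℕ → ℝ} {q : ℕ} (hq : (∑ i ∈ J, a i • z i) q ≠ 0) :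
    ∃ j ∈ J, z j q ≠ 0 := by
  by_contra hcon
  push Not at hcon
  apply hq
  rw [Finsupp.finsetSum_apply]
  refine Finset.sum_eq_zero fun i hi => ?_
  simp [hcon i hi]

theorem block_abs_mono {z : ℕ → ℕ →₀ ℝ}
    (hord : ∀ i j, i < j → ∀ a b, z i a ≠ 0 → z j b ≠ 0 → a < b)
    {J J' : Finset ℕ} (hJ : J ⊆ J') {a : ℕ → ℝ} (q : ℕ) :
    |(∑ i ∈ J, a i • z i) q| ≤ |(∑ i ∈ J', a i • z i) q| := by
  by_cases h : (∑ i ∈ J, a i • z i) q = 0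
  · rw [h, abs_zero]; exact abs_nonneg _
  · obtain ⟨j, hj, hq⟩ := block_ne h
    rw [block_apply hord hj hq, block_apply hord (hJ hj) hq]

variable {R : ℕ → ℕ → Prop} {Θ : Set ℕ}

theorem lower_est (z : ℕ → ℕ →₀ ℝ) (p : ℕ → ℕ) (hp : StrictMono p) {c : ℝ} (hc : 0 < c)
    (hz : ∀ j, c ≤ gL R Θ (z j)) (hΘ : ∀ j q, z j q ≠ 0 → q ∈ Θ)
    (hord : ∀ i j, i < j → ∀ a b, z i a ≠ 0 → z j b ≠ 0 → a < b)
    (hR : ∀ i j, i ≠ j → ∀ a b, z i a ≠ 0 → z j b ≠ 0 → R a b)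
    (hpz : ∀ j q, z j q ≠ 0 → p j ≤ q) (m : ℕ) :
    ∀ (J : Finset ℕ) (a : ℕ → ℝ), c * tN m (vec p J a) ≤ gL R Θ (∑ j ∈ J, a j • z j) := by
  classical
  have hsup : ∀ (J : Finset ℕ) (a : ℕ → ℝ) (q : ℕ),
      |vec p J a q| ≤ gL R Θ (∑ j ∈ J, a j • z j) / c := by
    intro J a q
    rw [le_div_iff₀ hc]
    by_cases hq : ∃ j ∈ J, p j = q
    · obtain ⟨j, hj, rfl⟩ := hq
      rw [vec_apply hp.injective hj]
      calc |a j| * c ≤ |a j| * gL R Θ (z j) := by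
            exact mul_le_mul_of_nonneg_left (hz j) (abs_nonneg _)
        _ = gL R Θ (a j • z j) := (gL_smul _ _).symm
        _ ≤ _ := by
            have := fun q => block_abs_mono (a := a) hord (Finset.singleton_subset_iff.2 hj) q
            simp only [Finset.sum_singleton] at this
            exact gL_mono_abs this
    · push Not at hq
      rw [vec_apply_not hq, abs_zero, zero_mul]
      exact gL_nonneg _
  induction m with
  | zero =>
    intro J a
    rw [mul_comm, ← le_div_iff₀ hc]
    exact sN_le (hsup J a)
  | succ m ih =>
    intro J a
    rw [mul_comm, ← le_div_iff₀ hc]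
    refine gN_succ_le (hsup J a) ?_
    intro k F hF
    rw [le_div_iff₀ hc]
    set Ji : Fin k → Finset ℕ := fun i => J.filter (fun j => p j ∈ (↑(F i) : Set ℕ)) with hJi
    have key := le_gL_of_flex (R := R) (Θ := Θ) (Finset.univ : Finset (Fin k))
      (fun i => (Ji i).biUnion fun j => (z j).support) (∑ j ∈ J, a j • z j) ?_ ?_ ?_ ?_
    · refine le_trans ?_ key
      rw [mul_assoc, Finset.sum_mul]
      refine mul_le_mul_of_nonneg_left (Finset.sum_le_sum fun i _ => ?_) (by norm_num)
      rw [res_vec, mul_comm]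
      refine (ih _ a).trans (gL_mono_abs fun q => ?_)
      by_cases h : (∑ i ∈ Ji i, a i • z i) q = 0
      · refine le_trans (le_of_eq ?_) (abs_nonneg _)
        rw [abs_eq_zero]; exact h
      · obtain ⟨j, hj, hq⟩ := block_ne h
        refine (block_abs_mono (a := a) hord (Finset.filter_subset _ J) q).trans ?_
        rw [res_mem]
        simp only [Finset.coe_biUnion, Set.mem_iUnion]
        exact ⟨j, hj, by simpa using hq⟩
    · intro l _ q hq
      simp only [Finset.mem_biUnion, Finsupp.mem_support_iff] at hq
      obtain ⟨j, hj, hq⟩ := hq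
      exact hΘ j q hq
    · intro l _ q hq
      simp only [Finset.mem_biUnion, Finsupp.mem_support_iff] at hq
      obtain ⟨j, hj, hq⟩ := hq
      rw [Finset.card_fin]
      exact (hF.2.2.1 l (p j) (by simpa using (Finset.mem_filter.1 hj).2)).trans (hpz j q hq)
    · intro l _ l' _ hll q hq q' hq'
      simp only [Finset.mem_biUnion, Finsupp.mem_support_iff] at hq hq'
      obtain ⟨j, hj, hq⟩ := hq
      obtain ⟨j', hj', hq'⟩ := hq'
      refine hR j j' ?_ q q' hq hq'
      rintro rfl
      exact hF.disj hll (by simpa using (Finset.mem_filter.1 hj).2)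
        (by simpa using (Finset.mem_filter.1 hj').2)
    · have main : ∀ l l' : Fin k, l < l' → ∀ q ∈ (Ji l).biUnion fun j => (z j).support,
          ∀ q' ∈ (Ji l').biUnion fun j => (z j).support, q < q' := by
        intro l l' hll q hq q' hq'
        simp only [Finset.mem_biUnion, Finsupp.mem_support_iff] at hq hq'
        obtain ⟨j, hj, hq⟩ := hq
        obtain ⟨j', hj', hq'⟩ := hq'
        refine hord j j' ?_ q q' hq hq'
        have := hF.2.1 l l' hll (p j) (by simpa using (Finset.mem_filter.1 hj).2) (p j')
          (by simpa using (Finset.mem_filter.1 hj').2)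
        exact hp.lt_iff_lt.1 this
      intro l _ l' _ hll
      rcases lt_or_gt_of_ne hll with h | h
      · exact Or.inl (main l l' h)
      · exact Or.inr fun q hq q' hq' => main l' l h q' hq' q hq

theorem lower_est_lim (z : ℕ → ℕ →₀ ℝ) (p : ℕ → ℕ) (hp : StrictMono p) {c : ℝ} (hc : 0 < c)
    (hz : ∀ j, c ≤ gL R Θ (z j)) (hΘ : ∀ j q, z j q ≠ 0 → q ∈ Θ)
    (hord : ∀ i j, i < j → ∀ a b, z i a ≠ 0 → z j b ≠ 0 → a < b)
    (hR : ∀ i j, i ≠ j → ∀ a b, z i a ≠ 0 → z j b ≠ 0 → R a b)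
    (hpz : ∀ j q, z j q ≠ 0 → p j ≤ q) (J : Finset ℕ) (a : ℕ → ℝ) :
    c * tL (vec p J a) ≤ gL R Θ (∑ j ∈ J, a j • z j) :=
  le_of_tendsto' ((gL_tendsto _).const_mul c)
    fun m => lower_est z p hp hc hz hΘ hord hR hpz m J a

theorem upper_est (p r : ℕ → ℕ) (hp : StrictMono p) (hpr3 : ∀ i j, i < j → 3 * r i ≤ p j)
    (a : ℕ → ℝ) (m : ℕ) :
    ∀ (y : ℕ → ℕ →₀ ℝ), (∀ j, gL R Θ (y j) ≤ 1) → (∀ j q, y j q ≠ 0 → p j ≤ q ∧ q ≤ r j) →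
      (∀ i j, i < j → ∀ a b, y i a ≠ 0 → y j b ≠ 0 → a < b) →
      ∀ J : Finset ℕ, J.Nonempty → ∃ j ∈ J, gN R Θ m (∑ j ∈ J, a j • y j) ≤
        2 * (|a j| + tL (vec p (J.filter (j < ·)) a)) := by
  classical
  have hsup : ∀ (y : ℕ → ℕ →₀ ℝ), (∀ j, gL R Θ (y j) ≤ 1) →
      (∀ i j, i < j → ∀ a b, y i a ≠ 0 → y j b ≠ 0 → a < b) →
      ∀ J : Finset ℕ, ∀ q B, (∀ j ∈ J, 2 * (|a j| + tL (vec p (J.filter (j < ·)) a)) ≤ B) →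
      0 ≤ B → |(∑ j ∈ J, a j • y j) q| ≤ B := by
    intro y hy hord J q B hB hB0
    by_cases h : (∑ i ∈ J, a i • y i) q = 0
    · rw [h, abs_zero]; exact hB0
    · obtain ⟨j, hj, hq⟩ := block_ne h
      refine le_trans ?_ (hB j hj)
      rw [block_apply hord hj hq, abs_mul]
      have h1 : |y j q| ≤ 1 := (abs_le_gL _ _).trans (hy j)
      have h2 := gL_nonneg (R := fun _ _ => True) (Θ := Set.univ) (vec p (J.filter (j < ·)) a)
      have h3 := mul_le_mul_of_nonneg_left h1 (abs_nonneg (a j))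
      have h4 := abs_nonneg (a j)
      linarith
  induction m with
  | zero =>
    intro y hy hsupp hord J hJ
    obtain ⟨j0, hj0, hmax⟩ := Finset.exists_max_image J
      (fun j => 2 * (|a j| + tL (vec p (J.filter (j < ·)) a))) hJ
    refine ⟨j0, hj0, sN_le fun q => hsup y hy hord J q _ hmax ?_⟩
    have := gL_nonneg (R := fun _ _ => True) (Θ := Set.univ) (vec p (J.filter (j0 < ·)) a)
    positivity
  | succ m ih =>
    intro y hy hsupp hord J hJ
    obtain ⟨j0, hj0, hmax⟩ := Finset.exists_max_image J
      (fun j => 2 * (|a j| + tL (vec p (J.filter (j < ·)) a))) hJ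
    have hB0 : 0 ≤ 2 * (|a j0| + tL (vec p (J.filter (j0 < ·)) a)) := by
      have := gL_nonneg (R := fun _ _ => True) (Θ := Set.univ) (vec p (J.filter (j0 < ·)) a)
      positivity
    refine ⟨j0, hj0, gN_succ_le (fun q => hsup y hy hord J q _ hmax hB0) ?_⟩
    intro k E hE
    set J1 : Fin k → Finset ℕ := fun i => J.filter (fun j => ∃ q ∈ E i, y j q ≠ 0) with hJ1
    have hJ1m : ∀ i j, j ∈ J1 i ↔ j ∈ J ∧ ∃ q ∈ E i, y j q ≠ 0 := fun i j => Finset.mem_filter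
    by_cases hne : ∀ i, J1 i = ∅
    · rw [Finset.sum_eq_zero, mul_zero]
      · exact hB0
      · intro i _
        rw [res_eq_zero, gN_zero]
        intro q hq hqE
        obtain ⟨j, hj, hq'⟩ := block_ne hq
        have : j ∈ J1 i := (hJ1m i j).2 ⟨hj, q, hqE, hq'⟩
        rw [hne i] at this
        simp at this
    push Not at hne
    obtain ⟨i0, hi0⟩ := hne
    -- the first index hit
    have hUne : (Finset.univ.biUnion J1).Nonempty := by
      obtain ⟨j, hj⟩ := hi0
      exact ⟨j, Finset.mem_biUnion.2 ⟨i0, Finset.mem_univ _, hj⟩⟩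
    obtain ⟨js, hjs, hjsmin⟩ := Finset.exists_min_image (Finset.univ.biUnion J1) id hUne
    have hjsmin' : ∀ i, ∀ j ∈ J1 i, js ≤ j := fun i j hj =>
      hjsmin j (Finset.mem_biUnion.2 ⟨i, Finset.mem_univ _, hj⟩)
    obtain ⟨is, -, hjsi⟩ := Finset.mem_biUnion.1 hjs
    have hjsJ : js ∈ J := ((hJ1m _ _).1 hjsi).1
    refine le_trans ?_ (hmax js hjsJ)
    have hkr : k ≤ r js := by
      obtain ⟨q, hq, hyq⟩ := ((hJ1m _ _).1 hjsi).2
      exact (hE.2.2.1 is q hq).trans (hsupp js q hyq).2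
    -- set of first hits
    set I : Finset ℕ := Finset.univ.biUnion (fun i => (J1 i).filter (fun j => ∀ j' ∈ J1 i, j ≤ j'))
      with hI
    have hIm : ∀ j, j ∈ I ↔ ∃ i, j ∈ J1 i ∧ ∀ j' ∈ J1 i, j ≤ j' := by
      intro j
      simp [hI]
    have hIcard : I.card ≤ k := by
      refine Finset.card_biUnion_le.trans ?_
      have : ∀ i ∈ (Finset.univ : Finset (Fin k)),
          ((J1 i).filter (fun j => ∀ j' ∈ J1 i, j ≤ j')).card ≤ 1 := by
        intro i _
        rw [Finset.card_le_one]
        intro x hx x' hx'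
        rw [Finset.mem_filter] at hx hx'
        exact le_antisymm (hx.2 _ hx'.1) (hx'.2 _ hx.1)
      refine (Finset.sum_le_sum this).trans ?_
      simp
    have hjsI : js ∈ I := (hIm js).2 ⟨is, hjsi, hjsmin' is⟩
    have hIJ : I ⊆ J := by
      intro j hj
      obtain ⟨i, hi, -⟩ := (hIm j).1 hj
      exact ((hJ1m _ _).1 hi).1
    set J2 : Fin k → Finset ℕ := fun i => J1 i \ I with hJ2
    have hJ2J : ∀ i, J2 i ⊆ J := fun i j hj =>
      ((hJ1m i j).1 (Finset.mem_sdiff.1 hj).1).1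
    -- order facts
    have hle : ∀ i i', i < i' → ∀ b ∈ J1 i, ∀ b' ∈ J1 i', b ≤ b' := by
      intro i i' hii b hb b' hb'
      by_contra hcon
      push Not at hcon
      obtain ⟨q, hq, hyq⟩ := ((hJ1m _ _).1 hb).2
      obtain ⟨q', hq', hyq'⟩ := ((hJ1m _ _).1 hb').2
      have h1 := hE.2.1 i i' hii q hq q' hq'
      have h2 := hord b' b hcon q' q hyq' hyq
      omega
    have hlt : ∀ i i', i < i' → ∀ b ∈ J2 i, ∀ b' ∈ J2 i', b < b' := by
      intro i i' hii b hb b' hb'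
      rw [Finset.mem_sdiff] at hb hb'
      refine lt_of_le_of_ne (hle i i' hii b hb.1 b' hb'.1) ?_
      rintro rfl
      exact hb.2 ((hIm b).2 ⟨i', hb'.1, fun c hc => hle i i' hii b hb.1 c hc⟩)
    -- main decomposition
    have hdec : ∀ i, res (↑(E i)) (∑ j ∈ J, a j • y j) =
        ∑ j ∈ I, a j • res (↑(E i)) (y j) + ∑ j ∈ J2 i, a j • res (↑(E i)) (y j) := by
      intro i
      rw [map_sum]
      simp only [map_smul]
      have hd : Disjoint I (J2 i) := Finset.disjoint_sdiff
      rw [← Finset.sum_union hd]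
      symm
      apply Finset.sum_subset (Finset.union_subset hIJ (hJ2J i))
      intro j hj hj'
      rw [res_eq_zero, smul_zero]
      intro q hq hqE
      apply hj'
      have : j ∈ J1 i := (hJ1m i j).2 ⟨hj, q, hqE, hq⟩
      rw [Finset.mem_union]
      by_cases hjI : j ∈ I
      · exact Or.inl hjI
      · exact Or.inr (Finset.mem_sdiff.2 ⟨this, hjI⟩)
    set T : Finset (Fin k) := Finset.univ.filter (fun i => (J2 i).Nonempty) with hT
    have hIH : ∀ i, ∃ j, (i ∈ T → j ∈ J2 i) ∧
        gN R Θ m (∑ j ∈ J2 i, a j • res (↑(E i)) (y j)) ≤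
        if i ∈ T then 2 * (|a j| + tL (vec p ((J2 i).filter (j < ·)) a)) else 0 := by
      intro i
      by_cases hi : (J2 i).Nonempty
      · have hiT : i ∈ T := Finset.mem_filter.2 ⟨Finset.mem_univ _, hi⟩
        have hne' : ∀ j q, res (↑(E i)) (y j) q ≠ 0 → y j q ≠ 0 := by
          intro j q h h0
          apply h
          rw [res_apply, h0]; simp
        obtain ⟨j, hj, h⟩ := ih (fun j => res (↑(E i)) (y j))
          (fun j => (gL_res_le _ _).trans (hy j)) (fun j q h => hsupp j q (hne' j q h))
          (fun b b' hbb q q' h h' => hord b b' hbb q q' (hne' _ _ h) (hne' _ _ h')) (J2 i) hi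
        exact ⟨j, fun _ => hj, by rw [if_pos hiT]; exact h⟩
      · have hiT : i ∉ T := fun h => hi (Finset.mem_filter.1 h).2
        refine ⟨0, fun h => absurd h hiT, ?_⟩
        rw [if_neg hiT, Finset.not_nonempty_iff_eq_empty.1 hi, Finset.sum_empty, gN_zero]
    choose ji hji hjb using hIH
    have hsum1 : ∑ i, gN R Θ m (∑ j ∈ I, a j • res (↑(E i)) (y j)) ≤ ∑ j ∈ I, 2 * |a j| := by
      calc ∑ i, gN R Θ m (∑ j ∈ I, a j • res (↑(E i)) (y j))
          ≤ ∑ i, ∑ j ∈ I, |a j| * gL R Θ (res (↑(E i)) (y j)) := by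
            refine Finset.sum_le_sum fun i _ => (gN_sum_le _ _ _).trans ?_
            refine Finset.sum_le_sum fun j _ => (gN_smul_le _ _ _).trans ?_
            exact mul_le_mul_of_nonneg_left (gN_le_gL _ _) (abs_nonneg _)
        _ = ∑ j ∈ I, |a j| * ∑ i, gL R Θ (res (↑(E i)) (y j)) := by
            rw [Finset.sum_comm]
            simp only [Finset.mul_sum]
        _ ≤ ∑ j ∈ I, 2 * |a j| := by
            refine Finset.sum_le_sum fun j _ => ?_
            have h1 := le_gL_of_adm (R := R) (Θ := Θ) (y j) hE
            have h2 := hy j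
            have h3 : ∑ i, gL R Θ (res (↑(E i)) (y j)) ≤ 2 := by linarith
            have := mul_le_mul_of_nonneg_left h3 (abs_nonneg (a j))
            linarith
    -- the family
    let G : ℕ ⊕ (Fin k × Bool) → Finset ℕ := fun l => match l with
      | Sum.inl j => {j}
      | Sum.inr (i, false) => {ji i}
      | Sum.inr (i, true) => (J2 i).filter (ji i < ·)
    set Λ : Finset (ℕ ⊕ (Fin k × Bool)) := (I.erase js).disjSum (T ×ˢ Finset.univ) with hΛ
    have hGJ2 : ∀ i b, i ∈ T → G (Sum.inr (i, b)) ⊆ J2 i := by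
      intro i b hi
      cases b
      · intro j hj
        simp only [G, Finset.mem_singleton] at hj
        rw [hj]; exact hji i hi
      · exact Finset.filter_subset _ _
    have hGgt : ∀ l ∈ Λ, ∀ j ∈ G l, j ∈ J ∧ js < j := by
      rintro (j | ⟨i, b⟩) hl j' hj'
      · rw [hΛ, Finset.inl_mem_disjSum] at hl
        simp only [G, Finset.mem_singleton] at hj'
        subst hj'
        rw [Finset.mem_erase] at hl
        obtain ⟨i, hi, -⟩ := (hIm _).1 hl.2
        exact ⟨hIJ hl.2, lt_of_le_of_ne (hjsmin' i _ hi) (Ne.symm hl.1)⟩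
      · rw [hΛ, Finset.inr_mem_disjSum, Finset.mem_product] at hl
        have := hGJ2 i b hl.1 hj'
        refine ⟨hJ2J i this, ?_⟩
        have h2 := Finset.mem_sdiff.1 this
        refine lt_of_le_of_ne (hjsmin' i _ h2.1) ?_
        rintro rfl
        exact h2.2 hjsI
    have hGord : ∀ l ∈ Λ, ∀ l' ∈ Λ, l ≠ l' →
      (∀ b ∈ G l, ∀ b' ∈ G l', b < b') ∨ (∀ b ∈ G l, ∀ b' ∈ G l', b' < b) := by
      have hmixed : ∀ j ∈ I, ∀ i b, i ∈ T →
          (∀ b' ∈ G (Sum.inr (i, b)), j < b') ∨ (∀ b' ∈ G (Sum.inr (i, b)), b' < j) := by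
        intro j hj i b hi
        by_contra hcon
        push Not at hcon
        obtain ⟨⟨x, hx, hxj⟩, ⟨x', hx', hxj'⟩⟩ := hcon
        have hx1 := Finset.mem_sdiff.1 (hGJ2 i b hi hx)
        have hx1' := Finset.mem_sdiff.1 (hGJ2 i b hi hx')
        have hxlt : x < j := lt_of_le_of_ne hxj (by rintro rfl; exact hx1.2 hj)
        have hxlt' : j < x' := lt_of_le_of_ne hxj' (by rintro rfl; exact hx1'.2 hj)
        obtain ⟨i', hi', hmin'⟩ := (hIm j).1 hj
        rcases lt_trichotomy i i' with h | h | h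
        · have := hle i i' h x' hx1'.1 j hi'
          omega
        · subst h
          have := hmin' x hx1.1
          omega
        · have := hle i' i h j hi' x hx1.1
          omega
      rintro (j | ⟨i, b⟩) hl (j' | ⟨i', b'⟩) hl' hll
      · simp only [G, Finset.mem_singleton, forall_eq]
        have : j ≠ j' := fun h => hll (by rw [h])
        omega
      · rw [hΛ, Finset.inl_mem_disjSum] at hl
        rw [hΛ, Finset.inr_mem_disjSum, Finset.mem_product] at hl'
        rcases hmixed j (Finset.mem_of_mem_erase hl) i' b' hl'.1 with h | h
        · left; intro x hx
          simp only [G, Finset.mem_singleton] at hx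
          rw [hx]; exact h
        · right; intro x hx
          simp only [G, Finset.mem_singleton] at hx
          rw [hx]; exact h
      · rw [hΛ, Finset.inl_mem_disjSum] at hl'
        rw [hΛ, Finset.inr_mem_disjSum, Finset.mem_product] at hl
        rcases hmixed j' (Finset.mem_of_mem_erase hl') i b hl.1 with h | h
        · right; intro y hy x hx
          simp only [G, Finset.mem_singleton] at hx
          rw [hx]; exact h y hy
        · left; intro y hy x hx
          simp only [G, Finset.mem_singleton] at hx
          rw [hx]; exact h y hy
      · rw [hΛ, Finset.inr_mem_disjSum, Finset.mem_product] at hl hl'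
        rcases lt_trichotomy i i' with h | h | h
        · left; intro x hx x' hx'
          exact hlt i i' h x (hGJ2 i b hl.1 hx) x' (hGJ2 i' b' hl'.1 hx')
        · subst h
          cases b <;> cases b'
          · exact absurd rfl hll
          · left; intro x hx x' hx'
            simp only [G, Finset.mem_singleton, Finset.mem_filter] at hx hx'
            rw [hx]; exact hx'.2
          · right; intro x hx x' hx'
            simp only [G, Finset.mem_singleton, Finset.mem_filter] at hx hx'
            rw [hx']; exact hx.2
          · exact absurd rfl hll
        · right; intro x hx x' hx'
          exact hlt i' i h x' (hGJ2 i' b' hl'.1 hx') x (hGJ2 i b hl.1 hx)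
    have hΛcard : Λ.card ≤ 3 * k := by
      rw [hΛ, Finset.card_disjSum, Finset.card_product]
      have h1 : (I.erase js).card ≤ k := (Finset.card_erase_le).trans hIcard
      have h2 : T.card ≤ k := (Finset.card_le_univ T).trans (by simp)
      simp
      omega
    have key := le_tL_of_flex Λ (fun l => (G l).image p) (vec p (J.filter (js < ·)) a) ?_ ?_
    rotate_left
    · intro l hl q hq
      obtain ⟨j, hj, rfl⟩ := Finset.mem_image.1 hq
      have := hpr3 js j (hGgt l hl j hj).2
      omega
    · intro l hl l' hl' hll
      rcases hGord l hl l' hl' hll with h | h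
      · left; intro q hq q' hq'
        obtain ⟨j, hj, rfl⟩ := Finset.mem_image.1 hq
        obtain ⟨j', hj', rfl⟩ := Finset.mem_image.1 hq'
        exact hp (h j hj j' hj')
      · right; intro q hq q' hq'
        obtain ⟨j, hj, rfl⟩ := Finset.mem_image.1 hq
        obtain ⟨j', hj', rfl⟩ := Finset.mem_image.1 hq'
        exact hp (h j hj j' hj')
    have hpiece : ∀ l ∈ Λ, tL (vec p (G l) a) ≤
        tL (res (↑((G l).image p)) (vec p (J.filter (js < ·)) a)) := by
      intro l hl
      rw [res_vec]
      refine tL_vec_mono hp.injective ?_ fun _ _ => le_rfl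
      intro j hj
      have := hGgt l hl j hj
      simp only [Finset.mem_filter]
      exact ⟨this, by simpa using ⟨j, hj, rfl⟩⟩
    have key2 : 2⁻¹ * ∑ l ∈ Λ, tL (vec p (G l) a) ≤ tL (vec p (J.filter (js < ·)) a) :=
      le_trans (mul_le_mul_of_nonneg_left (Finset.sum_le_sum hpiece) (by norm_num)) key
    have hsing : ∀ j, tL (vec p {j} a) = |a j| := by
      intro j
      rw [vec, Finset.sum_singleton]
      exact gL_single _ _
    have hexp : ∑ l ∈ Λ, tL (vec p (G l) a) = ∑ j ∈ I.erase js, |a j| +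
        ∑ i ∈ T, (|a (ji i)| + tL (vec p ((J2 i).filter (ji i < ·)) a)) := by
      rw [hΛ, Finset.sum_disjSum, Finset.sum_product]
      congr 1
      · exact Finset.sum_congr rfl fun j _ => hsing j
      · refine Finset.sum_congr rfl fun i _ => ?_
        rw [Fintype.sum_bool, add_comm]
        congr 1
        exact hsing _
    have hfin : ∑ i, gN R Θ m (res (↑(E i)) (∑ j ∈ J, a j • y j)) ≤ ∑ j ∈ I, 2 * |a j| +
        ∑ i ∈ T, 2 * (|a (ji i)| + tL (vec p ((J2 i).filter (ji i < ·)) a)) := by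
      have : ∀ i ∈ (Finset.univ : Finset (Fin k)), gN R Θ m (res (↑(E i)) (∑ j ∈ J, a j • y j)) ≤
          gN R Θ m (∑ j ∈ I, a j • res (↑(E i)) (y j)) +
          if i ∈ T then 2 * (|a (ji i)| + tL (vec p ((J2 i).filter (ji i < ·)) a)) else 0 := by
        intro i _
        rw [hdec i]
        exact (gN_add_le _ _ _).trans (add_le_add le_rfl (hjb i))
      refine (Finset.sum_le_sum this).trans ?_
      rw [Finset.sum_add_distrib]
      refine add_le_add hsum1 (le_of_eq ?_)
      rw [← Finset.sum_filter]
      congr 1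
      ext i; simp
    rw [← Finset.mul_sum, ← Finset.mul_sum, ← Finset.add_sum_erase _ _ hjsI] at hfin
    rw [hexp] at key2
    have := abs_nonneg (a js)
    linarith

theorem upper_est_lim (p r : ℕ → ℕ) (hp : StrictMono p) (hpr3 : ∀ i j, i < j → 3 * r i ≤ p j)
    (a : ℕ → ℝ) (y : ℕ → ℕ →₀ ℝ) (hy : ∀ j, gL R Θ (y j) ≤ 1)
    (hsupp : ∀ j q, y j q ≠ 0 → p j ≤ q ∧ q ≤ r j)
    (hord : ∀ i j, i < j → ∀ a b, y i a ≠ 0 → y j b ≠ 0 → a < b) (J : Finset ℕ) :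
    gL R Θ (∑ j ∈ J, a j • y j) ≤ 4 * tL (vec p J a) := by
  refine gL_le fun m => ?_
  rcases J.eq_empty_or_nonempty with rfl | hJ
  · rw [Finset.sum_empty, gN_zero]
    have := gL_nonneg (R := fun _ _ => True) (Θ := Set.univ) (vec p ∅ a)
    positivity
  · obtain ⟨j, hj, h⟩ := upper_est p r hp hpr3 a m y hy hsupp hord J hJ
    have h1 := abs_le_tL_vec (a := a) hp.injective hj
    have h2 := tL_vec_mono (a := a) hp.injective (Finset.filter_subset (j < ·) J) fun _ _ => le_rfl
    linarith

end PTS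

namespace PTS
open Finset

theorem tL_shift {p p' : ℕ → ℕ} (hp : StrictMono p) (hp' : StrictMono p') (h : ∀ j, p j ≤ p' j)
    (J : Finset ℕ) (a : ℕ → ℝ) : tL (vec p J a) ≤ tL (vec p' J a) := by
  classical
  have hne : ∀ j q, Finsupp.single (p' j) (1 : ℝ) q ≠ 0 → p' j = q := by
    intro j q hq
    rw [Finsupp.single_apply] at hq
    by_contra hcon
    exact hq (if_neg hcon)
  have := lower_est_lim (R := fun _ _ => True) (Θ := Set.univ)
    (fun j => Finsupp.single (p' j) (1 : ℝ)) p hp one_pos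
    (fun j => by rw [gL_single]; simp) (fun _ _ _ => Set.mem_univ _)
    (fun i j hij a b ha hb => by rw [← hne i a ha, ← hne j b hb]; exact hp' hij)
    (fun _ _ _ _ _ _ _ => trivial) (fun j q hq => by rw [← hne j q hq]; exact h j) J a
  simp only [one_mul, Finsupp.smul_single, smul_eq_mul, mul_one] at this
  exact this

/-- Sum of the coordinates. -/
noncomputable def S1 : (ℕ →₀ ℝ) →ₗ[ℝ] ℝ := Finsupp.linearCombination ℝ (fun _ => (1 : ℝ))

theorem noL1_step (A : Set ℕ) (t : ℝ)
    (H : ∀ n : ℕ, ∃ x : ℕ →₀ ℝ, (∀ q, 0 ≤ x q) ∧ (∀ q, x q ≠ 0 → q ∈ A ∧ n < q) ∧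
      S1 x = 1 ∧ tL x ≤ t) (n : ℕ) : ∃ x : ℕ →₀ ℝ, (∀ q, 0 ≤ x q) ∧
      (∀ q, x q ≠ 0 → q ∈ A ∧ n < q) ∧ S1 x = 1 ∧ tL x ≤ 7 / 8 * t := by
  classical
  choose X hX0 hXA hXS hXt using H
  have ht : 0 ≤ t := (gL_nonneg _).trans (hXt 0)
  let N : ℕ → ℕ := fun i => Nat.rec n (fun _ b => max b ((X b).support.sup id)) i
  have hNs : ∀ i, N (i + 1) = max (N i) ((X (N i)).support.sup id) := fun i => rfl
  have hNmono : Monotone N := monotone_nat_of_le_succ fun i => by rw [hNs]; exact le_max_left _ _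
  set x : ℕ → ℕ →₀ ℝ := fun i => X (N i) with hx
  have hxs : ∀ i q, x i q ≠ 0 → N i < q ∧ q ≤ N (i + 1) := by
    intro i q hq
    refine ⟨(hXA _ q hq).2, ?_⟩
    rw [hNs]
    refine le_max_of_le_right ?_
    exact Finset.le_sup (f := id) (Finsupp.mem_support_iff.2 hq)
  have hord : ∀ i j, i < j → ∀ a b, x i a ≠ 0 → x j b ≠ 0 → a < b := by
    intro i j hij a b ha hb
    have h1 := hxs i a ha
    have h2 := hxs j b hb
    have h3 := hNmono (show i + 1 ≤ j from hij)
    omega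
  set k : ℕ := 4 * N 1 + 4 with hk
  have hk0 : (0 : ℝ) < k := by rw [hk]; positivity
  set y : ℕ →₀ ℝ := (1 / 2 : ℝ) • x 0 + (1 / (2 * k) : ℝ) • ∑ i ∈ range k, x (i + 1) with hy
  have hyq : ∀ q, y q = 1 / 2 * x 0 q + 1 / (2 * k) * ∑ i ∈ range k, x (i + 1) q := by
    intro q
    simp [hy]
  have hxabs : ∀ i q, |x i q| ≤ t := fun i q => (abs_le_gL _ _).trans (hXt _)
  have hxt : ∀ i, tL (x i) ≤ t := fun i => hXt _
  refine ⟨y, ?_, ?_, ?_, ?_⟩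
  · intro q
    rw [hyq]
    have h1 := hX0 (N 0) q
    have h2 : 0 ≤ ∑ i ∈ range k, x (i + 1) q := Finset.sum_nonneg fun i _ => hX0 _ q
    positivity
  · intro q hq
    by_cases h0 : x 0 q = 0
    · rw [hyq, h0, mul_zero, zero_add] at hq
      have : ∃ i ∈ range k, x (i + 1) q ≠ 0 := by
        by_contra hcon
        push Not at hcon
        exact hq (by rw [Finset.sum_eq_zero hcon, mul_zero])
      obtain ⟨i, -, hi⟩ := this
      have h1 := hXA _ q hi
      exact ⟨h1.1, lt_of_le_of_lt (hNmono (Nat.zero_le (i + 1))) h1.2⟩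
    · exact hXA _ q h0
  · rw [hy, map_add, map_smul, map_smul, map_sum]
    have : ∀ i, S1 (x i) = 1 := fun i => hXS _
    simp only [this, smul_eq_mul, Finset.sum_const, Finset.card_range, nsmul_eq_mul, mul_one]
    field_simp
    norm_num
  refine gL_le fun m => (gN_le_succ m y).trans (gN_succ_le ?_ ?_)
  · intro q
    rw [hyq]
    by_cases h0 : x 0 q = 0
    · rw [h0, mul_zero, zero_add, abs_mul]
      have h1 : |∑ i ∈ range k, x (i + 1) q| ≤ k * t := by
        refine (Finset.abs_sum_le_sum_abs _ _).trans
          ((Finset.sum_le_sum fun i _ => hxabs (i + 1) q).trans ?_)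
        simp
      rw [abs_of_pos (by positivity : (0 : ℝ) < 1 / (2 * k))]
      calc 1 / (2 * (k : ℝ)) * |∑ i ∈ range k, x (i + 1) q| ≤ 1 / (2 * k) * (k * t) := by gcongr
        _ = t / 2 := by field_simp
        _ ≤ 7 / 8 * t := by linarith
    · rw [Finset.sum_eq_zero, mul_zero, add_zero, abs_mul, abs_of_pos (by norm_num : (0:ℝ) < 1 / 2)]
      · have := hxabs 0 q
        linarith
      · intro i _
        by_contra hcon
        exact absurd (hord 0 (i + 1) (by omega) q q h0 hcon) (lt_irrefl _)
  · intro r E hE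
    have hsum2 : ∀ i, ∑ l, tN m (res (↑(E l)) (x i)) ≤ 2 * t := by
      intro i
      have h1 := le_gN_succ m (x i) hE
      have h2 : tN (m + 1) (x i) ≤ t := (gN_le_gL _ _).trans (hxt i)
      have h3 : 2⁻¹ * ∑ l, tN m (res (↑(E l)) (x i)) ≤ t := h1.trans h2
      linarith
    have hsplit : ∑ l, tN m (res (↑(E l)) y) ≤ 1 / 2 * ∑ l, tN m (res (↑(E l)) (x 0)) +
        1 / (2 * k) * ∑ i ∈ range k, ∑ l, tN m (res (↑(E l)) (x (i + 1))) := by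
      rw [Finset.sum_comm (s := range k), Finset.mul_sum, Finset.mul_sum, ← Finset.sum_add_distrib]
      refine Finset.sum_le_sum fun l _ => ?_
      rw [hy, map_add, map_smul, map_smul, map_sum]
      refine (gN_add_le _ _ _).trans (add_le_add ?_ ?_)
      · refine (gN_smul_le _ _ _).trans (le_of_eq ?_)
        rw [abs_of_pos (by norm_num : (0:ℝ) < 1 / 2)]
      · refine (gN_smul_le _ _ _).trans ?_
        rw [abs_of_pos (by positivity : (0 : ℝ) < 1 / (2 * k))]
        exact mul_le_mul_of_nonneg_left (gN_sum_le _ _ _) (by positivity)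
    by_cases hhit : ∃ l, ∃ q ∈ E l, x 0 q ≠ 0
    · obtain ⟨l0, q0, hq0, hxq0⟩ := hhit
      have hr : r ≤ N 1 := (hE.2.2.1 l0 q0 hq0).trans (hxs 0 q0 hxq0).2
      -- bad indices
      set bad : Finset ℕ := (range k).filter (fun i => ∃ l l', l < l' ∧
        (∃ q ∈ E l, x (i + 1) q ≠ 0) ∧ (∃ q ∈ E l', x (i + 1) q ≠ 0)) with hbad
      have hbc : bad.card ≤ r := by
        have hch : ∀ i, ∃ l' : Fin r, i ∈ bad → ∃ l, l < l' ∧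
          (∃ q ∈ E l, x (i + 1) q ≠ 0) ∧ (∃ q ∈ E l', x (i + 1) q ≠ 0) := by
          intro i
          by_cases hi : i ∈ bad
          · obtain ⟨l, l', h⟩ := (Finset.mem_filter.1 hi).2
            exact ⟨l', fun _ => ⟨l, h⟩⟩
          · exact ⟨l0, fun h => absurd h hi⟩
        choose g hg using hch
        have hkey : ∀ i ∈ bad, ∀ i' ∈ bad, i < i' → g i ≠ g i' := by
          intro i hi i' hi' hii hgg
          obtain ⟨-, -, -, q, hq, hxq⟩ := hg i hi
          obtain ⟨l, hl, ⟨q', hq', hxq'⟩, -⟩ := hg i' hi'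
          rw [hgg] at hq
          have h1 := hE.2.1 l (g i') hl q' hq' q hq
          have h2 := hord (i + 1) (i' + 1) (by omega) q q' hxq hxq'
          omega
        have : bad.card ≤ (Finset.univ : Finset (Fin r)).card := by
          refine Finset.card_le_card_of_injOn g (fun _ _ => Finset.mem_coe.2 (Finset.mem_univ _)) ?_
          intro i hi i' hi' hgg
          by_contra hcon
          rcases lt_or_gt_of_ne hcon with h | h
          · exact hkey i hi i' hi' h hgg
          · exact hkey i' hi' i hi h hgg.symm
        simpa using this
      have hone : ∀ i ∈ range k, ∑ l, tN m (res (↑(E l)) (x (i + 1))) ≤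
          t + if i ∈ bad then t else 0 := by
        intro i hi
        split_ifs with hb
        · have := hsum2 (i + 1)
          linarith
        · rw [add_zero]
          by_cases hex : ∃ l, ∃ q ∈ E l, x (i + 1) q ≠ 0
          · obtain ⟨l, hl⟩ := hex
            rw [Finset.sum_eq_single_of_mem l (Finset.mem_univ _)]
            · exact (gN_res_le _ _ _).trans ((gN_le_gL _ _).trans (hxt (i + 1)))
            · intro l' _ hll
              rw [res_eq_zero, tN, gN_zero]
              intro q hq hqE
              apply hb
              rw [hbad, Finset.mem_filter]
              refine ⟨hi, ?_⟩
              rcases lt_or_gt_of_ne hll with h | h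
              · exact ⟨l', l, h, ⟨q, hqE, hq⟩, hl⟩
              · exact ⟨l, l', h, hl, ⟨q, hqE, hq⟩⟩
          · push Not at hex
            rw [Finset.sum_eq_zero]
            · exact ht
            · intro l _
              rw [res_eq_zero, tN, gN_zero]
              intro q hq hqE
              exact hq (hex l q hqE)
      have htot := Finset.sum_le_sum hone
      rw [Finset.sum_add_distrib, Finset.sum_const, Finset.card_range, nsmul_eq_mul,
        ← Finset.sum_filter, Finset.sum_const, nsmul_eq_mul] at htot
      have hc2 : (((range k).filter (· ∈ bad)).card : ℝ) ≤ k / 4 := by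
        have h1 : ((range k).filter (· ∈ bad)).card ≤ bad.card :=
          Finset.card_le_card fun i hi => (Finset.mem_filter.1 hi).2
        have h2 : 4 * ((range k).filter (· ∈ bad)).card ≤ k := by omega
        have h3 : (4 * ((range k).filter (· ∈ bad)).card : ℝ) ≤ k := by exact_mod_cast h2
        linarith
      have hc3 : (((range k).filter (· ∈ bad)).card : ℝ) * t ≤ k / 4 * t :=
        mul_le_mul_of_nonneg_right hc2 ht
      have h4 : 1 / (2 * (k : ℝ)) * ∑ i ∈ range k, ∑ l, tN m (res (↑(E l)) (x (i + 1))) ≤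
          1 / (2 * k) * (k * t + k / 4 * t) := by
        refine mul_le_mul_of_nonneg_left (by linarith) (by positivity)
      have h5 : 1 / (2 * (k : ℝ)) * (k * t + k / 4 * t) = 5 / 8 * t := by
        field_simp; ring
      have h6 := hsum2 0
      linarith
    · push Not at hhit
      have h0 : ∑ l, tN m (res (↑(E l)) (x 0)) = 0 := by
        refine Finset.sum_eq_zero fun l _ => ?_
        rw [res_eq_zero, tN, gN_zero]
        intro q hq hqE
        exact hq (hhit l q hqE)
      have htot := Finset.sum_le_sum (s := range k) fun i _ => hsum2 (i + 1)
      rw [Finset.sum_const, Finset.card_range, nsmul_eq_mul] at htot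
      have h4 : 1 / (2 * (k : ℝ)) * ∑ i ∈ range k, ∑ l, tN m (res (↑(E l)) (x (i + 1))) ≤
          1 / (2 * k) * (k * (2 * t)) :=
        mul_le_mul_of_nonneg_left htot (by positivity)
      have h5 : 1 / (2 * (k : ℝ)) * (k * (2 * t)) = t := by field_simp
      linarith

theorem noL1 {p : ℕ → ℕ} (hp : StrictMono p) {ε : ℝ} (hε : 0 < ε) :
    ∃ (J : Finset ℕ) (a : ℕ → ℝ), (∀ j, 0 ≤ a j) ∧ ∑ j ∈ J, a j = 1 ∧ tL (vec p J a) ≤ ε := by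
  classical
  have H : ∀ i n : ℕ, ∃ x : ℕ →₀ ℝ, (∀ q, 0 ≤ x q) ∧ (∀ q, x q ≠ 0 → q ∈ Set.range p ∧ n < q) ∧
      S1 x = 1 ∧ tL x ≤ (7 / 8 : ℝ) ^ i := by
    intro i
    induction i with
    | zero =>
      intro n
      refine ⟨Finsupp.single (p (n + 1)) 1, ?_, ?_, ?_, ?_⟩
      · intro q
        rw [Finsupp.single_apply]; split_ifs <;> norm_num
      · intro q hq
        rw [Finsupp.single_apply] at hq
        split_ifs at hq with h
        · exact ⟨⟨_, h⟩, by have := hp.le_apply (x := n + 1); omega⟩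
        · exact absurd rfl hq
      · simp [S1]
      · rw [tL, gL_single]; simp
    | succ i ih =>
      intro n
      obtain ⟨x, h1, h2, h3, h4⟩ := noL1_step _ _ ih n
      exact ⟨x, h1, h2, h3, h4.trans (le_of_eq (by rw [pow_succ]; ring))⟩
  obtain ⟨i, hi⟩ := exists_pow_lt_of_lt_one hε (by norm_num : (7 / 8 : ℝ) < 1)
  obtain ⟨x, h1, h2, h3, h4⟩ := H i 0
  have hxe : vec p (x.support.preimage p hp.injective.injOn) (fun j => x (p j)) = x := by
    ext q
    by_cases hq : x q = 0
    · rw [hq]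
      by_contra hcon
      obtain ⟨j, hj, rfl⟩ := vec_ne hcon
      simp [hq] at hj
    · obtain ⟨⟨j, rfl⟩, -⟩ := h2 q hq
      rw [vec_apply hp.injective]
      simpa using hq
  refine ⟨x.support.preimage p hp.injective.injOn, fun j => x (p j), fun j => h1 _, ?_, ?_⟩
  · rw [← h3]
    conv_rhs => rw [← hxe]
    rw [vec, map_sum]
    simp [S1]
  · rw [hxe]
    exact h4.trans hi.le

end PTS

namespace PTS
open Finset

/-- Coordinatewise absolute value. -/
noncomputable def absF (x : ℕ →₀ ℝ) : ℕ →₀ ℝ := x.mapRange (fun t => |t|) abs_zero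

theorem absF_apply (x : ℕ →₀ ℝ) (q : ℕ) : absF x q = |x q| := by simp [absF]

theorem tL_absF (x : ℕ →₀ ℝ) : tL (absF x) = tL x :=
  gL_eq_of_abs fun q => by rw [absF_apply, abs_abs]

theorem tL_le_sum_of_abs {ι : Type*} (Λ : Finset ι) (h : ι → ℕ →₀ ℝ) (y : ℕ →₀ ℝ)
    (hy : ∀ q, |y q| ≤ ∑ l ∈ Λ, |h l q|) : tL y ≤ ∑ l ∈ Λ, tL (h l) := by
  have h1 : tL y ≤ tL (∑ l ∈ Λ, absF (h l)) := by
    refine gL_mono_abs fun q => (hy q).trans ?_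
    rw [Finsupp.finsetSum_apply]
    refine le_trans (le_of_eq ?_) (le_abs_self _)
    exact Finset.sum_congr rfl fun l _ => (absF_apply _ _).symm
  refine h1.trans ((gL_sum_le _ _).trans (le_of_eq ?_))
  exact Finset.sum_congr rfl fun l _ => tL_absF _

/-- Sign attached to a set. -/
noncomputable def sg (A : Finset ℕ) (i : ℕ) : ℝ := if i ∈ A then 1 else -1

theorem abs_sg (A : Finset ℕ) (i : ℕ) : |sg A i| = 1 := by
  unfold sg; split_ifs <;> simp

theorem sg_insert_ne {A : Finset ℕ} {i j : ℕ} (h : i ≠ j) : sg (insert j A) i = sg A i := by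
  simp [sg, h]

theorem sg_sum_insert {J t : Finset ℕ} {b : ℕ} (hb : b ∉ J) (ht : t ⊆ J) (w : ℕ → ℝ) :
    (∑ i ∈ insert b J, sg t i * w i = -w b + ∑ i ∈ J, sg t i * w i) ∧
    (∑ i ∈ insert b J, sg (insert b t) i * w i = w b + ∑ i ∈ J, sg t i * w i) := by
  constructor
  · rw [Finset.sum_insert hb]
    have : sg t b = -1 := if_neg fun h => hb (ht h)
    rw [this]; ring
  · rw [Finset.sum_insert hb]
    have : sg (insert b t) b = 1 := if_pos (Finset.mem_insert_self _ _)
    rw [this, one_mul]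
    congr 1
    refine Finset.sum_congr rfl fun i hi => ?_
    rw [sg_insert_ne]
    rintro rfl
    exact hb hi

theorem sg_sq (J : Finset ℕ) (w : ℕ → ℝ) :
    ∑ A ∈ J.powerset, (∑ i ∈ J, sg A i * w i) ^ 2 = 2 ^ J.card * ∑ i ∈ J, w i ^ 2 := by
  induction J using Finset.induction_on with
  | empty => simp
  | insert b J hb ih =>
    rw [Finset.sum_powerset_insert hb, ← Finset.sum_add_distrib]
    have : ∀ t ∈ J.powerset, (∑ i ∈ insert b J, sg t i * w i) ^ 2 +
        (∑ i ∈ insert b J, sg (insert b t) i * w i) ^ 2 =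
        2 * w b ^ 2 + 2 * (∑ i ∈ J, sg t i * w i) ^ 2 := by
      intro t ht
      obtain ⟨h1, h2⟩ := sg_sum_insert hb (Finset.mem_powerset.1 ht) w
      rw [h1, h2]; ring
    rw [Finset.sum_congr rfl this, Finset.sum_add_distrib, ← Finset.mul_sum, ← Finset.mul_sum, ih,
      Finset.sum_insert hb, Finset.card_insert_of_notMem hb]
    simp only [Finset.sum_const, Finset.card_powerset, nsmul_eq_mul]
    push_cast
    ring

theorem sg_abs_le (J : Finset ℕ) (w : ℕ → ℝ) {b : ℝ} {m : ℕ} (hb : 0 ≤ b) (hm : J.card = m ^ 2)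
    (hw : ∀ i ∈ J, |w i| ≤ b) :
    ∑ A ∈ J.powerset, |∑ i ∈ J, sg A i * w i| ≤ 2 ^ J.card * (m * b) := by
  have h1 := sq_sum_le_card_mul_sum_sq (s := J.powerset) (f := fun A => |∑ i ∈ J, sg A i * w i|)
  simp only [sq_abs] at h1
  rw [sg_sq, Finset.card_powerset] at h1
  have h2 : ∑ i ∈ J, w i ^ 2 ≤ (m * b) ^ 2 := by
    have : ∀ i ∈ J, w i ^ 2 ≤ b ^ 2 := fun i hi => by
      rw [← sq_abs]; exact pow_le_pow_left₀ (abs_nonneg _) (hw i hi) 2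
    refine (Finset.sum_le_sum this).trans ?_
    rw [Finset.sum_const, hm, nsmul_eq_mul]
    push_cast
    exact le_of_eq (by ring)
  refine abs_le_of_sq_le_sq' ?_ (by positivity) |>.2
  refine h1.trans ?_
  push_cast
  calc (2 : ℝ) ^ J.card * (2 ^ J.card * ∑ i ∈ J, w i ^ 2)
      ≤ 2 ^ J.card * (2 ^ J.card * (m * b) ^ 2) := by gcongr
    _ = _ := by ring

theorem sg_abs_ge (J : Finset ℕ) (w : ℕ → ℝ) {s : ℕ} (hs : s ∈ J) :
    2 ^ J.card * |w s| ≤ ∑ A ∈ J.powerset, |∑ i ∈ J, sg A i * w i| := by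
  obtain ⟨J', hJ', rfl⟩ : ∃ J', s ∉ J' ∧ J = insert s J' :=
    ⟨J.erase s, Finset.notMem_erase _ _, (Finset.insert_erase hs).symm⟩
  rw [Finset.sum_powerset_insert hJ', ← Finset.sum_add_distrib]
  have : ∀ t ∈ J'.powerset, 2 * |w s| ≤ |∑ i ∈ insert s J', sg t i * w i| +
      |∑ i ∈ insert s J', sg (insert s t) i * w i| := by
    intro t ht
    obtain ⟨h1, h2⟩ := sg_sum_insert hJ' (Finset.mem_powerset.1 ht) w
    rw [h1, h2]
    set h := ∑ i ∈ J', sg t i * w i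
    have := abs_sub (w s + h) (-w s + h)
    have e : w s + h - (-w s + h) = 2 * w s := by ring
    rw [e, abs_mul, abs_two] at this
    linarith
  refine le_trans (le_of_eq ?_) (Finset.sum_le_sum this)
  rw [Finset.sum_const, Finset.card_powerset, Finset.card_insert_of_notMem hJ', nsmul_eq_mul]
  push_cast
  ring

/-- Second case of the core argument. -/
theorem core_case2 {P : Set ℕ} (hP : ∀ a ∈ P, ∀ b ∈ P, a < b → a * a ≤ b) {N : ℕ} (hN : 1 ≤ N)
    (z : ℕ → ℕ →₀ ℝ) (s m M : ℕ) (hm : m = 16 * N ^ 2 * M * (s + 1)) (hM : 1 ≤ M)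
    (Jw : Finset ℕ) (hJ : Jw.card = m ^ 2)
    (h2 : ∀ A : Finset ℕ, ((m : ℝ) ^ 2) / (2 * N) ≤ tL (∑ i ∈ Jw, sg A i • z i))
    (h3 : ∀ i ∈ Jw, ∀ q, z i q ≠ 0 → q ∈ P ∧ 2 * 2 ^ (m ^ 2) ≤ q)
    (g : ℕ →₀ ℝ) (hg0 : ∀ q, 0 ≤ g q) (hg : tL g ≤ s * N) :
    ∃ i ∈ Jw, 1 / (8 * N) ≤ tL (res {q | M * g q < |z i q|} (z i)) := by
  classical
  by_contra hcon
  push Not at hcon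
  have hN0 : (0 : ℝ) < N := by exact_mod_cast hN
  have hM0 : (0 : ℝ) < M := by exact_mod_cast hM
  set w : ℕ → ℕ →₀ ℝ := fun i => res {q | M * g q < |z i q|}ᶜ (z i) with hw
  have hwq : ∀ i q, |w i q| ≤ M * g q := by
    intro i q
    by_cases h : M * g q < |z i q|
    · rw [hw]
      simp only
      rw [res_not_mem _ (by simpa using h), abs_zero]
      exact mul_nonneg hM0.le (hg0 q)
    · exact (res_abs_le _ _ _).trans (not_lt.1 h)
  have hzw : ∀ i, z i = res {q | M * g q < |z i q|} (z i) + w i := by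
    intro i
    ext q
    rw [Finsupp.add_apply, hw]
    by_cases h : M * g q < |z i q|
    · rw [res_mem _ (by simpa using h), res_not_mem _ (by simpa using h), add_zero]
    · rw [res_not_mem _ (by simpa using h), res_mem _ (by simpa using h), zero_add]
  set h : Finset ℕ → ℕ →₀ ℝ := fun A => ∑ i ∈ Jw, sg A i • w i with hh
  have hhq : ∀ A q, h A q = ∑ i ∈ Jw, sg A i * w i q := by
    intro A q
    simp [hh, Finsupp.finsetSum_apply]
  have step1 : ∀ A, (m : ℝ) ^ 2 / (2 * N) - m ^ 2 * (1 / (8 * N)) ≤ tL (h A) := by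
    intro A
    have e : ∑ i ∈ Jw, sg A i • z i =
        ∑ i ∈ Jw, sg A i • res {q | M * g q < |z i q|} (z i) + h A := by
      rw [hh, ← Finset.sum_add_distrib]
      refine Finset.sum_congr rfl fun i _ => ?_
      rw [← smul_add, ← hzw i]
    have h4 := h2 A
    rw [e] at h4
    have h5 := h4.trans (gL_add_le _ _)
    have h6 : tL (∑ i ∈ Jw, sg A i • res {q | M * g q < |z i q|} (z i)) ≤ m ^ 2 * (1 / (8 * N)) := by
      refine (gL_sum_le _ _).trans ?_
      have : ∀ i ∈ Jw, gL (fun _ _ => True) Set.univ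
          (sg A i • res {q | M * g q < |z i q|} (z i)) ≤ 1 / (8 * N) := by
        intro i hi
        rw [gL_smul, abs_sg, one_mul]
        exact (hcon i hi).le
      refine (Finset.sum_le_sum this).trans ?_
      rw [Finset.sum_const, hJ, nsmul_eq_mul]
      push_cast
      exact le_rfl
    linarith
  have step2 := tL_concave hP Jw.powerset h ((2 ^ Jw.card * (m * M : ℝ)) • g) ?_ ?_
  · have h7 := Finset.sum_le_sum (s := Jw.powerset) fun A _ => step1 A
    rw [Finset.sum_const, Finset.card_powerset, nsmul_eq_mul] at h7
    push_cast at h7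
    have h8 : tL ((2 ^ Jw.card * (m * M : ℝ)) • g) ≤ 2 ^ Jw.card * (m * M : ℝ) * (s * N) := by
      rw [tL, gL_smul, abs_of_nonneg (by positivity)]
      exact mul_le_mul_of_nonneg_left hg (by positivity)
    have h9 : (2 : ℝ) ^ Jw.card * ((m : ℝ) ^ 2 / (2 * N) - m ^ 2 * (1 / (8 * N))) ≤
        2 ^ Jw.card * (2 * (m * M * (s * N))) := by
      have := step2.trans h8
      nlinarith
    have h10 := le_of_mul_le_mul_left h9 (by positivity)
    have hmR : (m : ℝ) = 16 * N ^ 2 * M * (s + 1) := by rw [hm]; push_cast; ring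
    have hm0 : (0 : ℝ) < m := by rw [hmR]; positivity
    have h11 : (m : ℝ) ^ 2 / (2 * N) - m ^ 2 * (1 / (8 * N)) = m * (3 * m / (8 * N)) := by
      field_simp; ring
    rw [h11, show (2 * (m * M * (s * N)) : ℝ) = m * (2 * M * (s * N)) by ring] at h10
    have h12 := le_of_mul_le_mul_left h10 hm0
    rw [div_le_iff₀ (by positivity), hmR] at h12
    have h13 : (0 : ℝ) < N ^ 2 * M := by positivity
    have h14 : (0 : ℝ) ≤ s := Nat.cast_nonneg s
    nlinarith [mul_nonneg h13.le h14]
  · intro A _ q hq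
    rw [hhq] at hq
    have : ∃ i ∈ Jw, w i q ≠ 0 := by
      by_contra hc
      push Not at hc
      exact hq (Finset.sum_eq_zero fun i hi => by rw [hc i hi, mul_zero])
    obtain ⟨i, hi, hwi⟩ := this
    have hz : z i q ≠ 0 := by
      intro h0
      apply hwi
      rw [hw]
      simp only
      rw [res_apply, h0]; simp
    have := h3 i hi q hz
    rw [Finset.card_powerset, hJ]
    exact this
  · intro q
    rw [Finsupp.smul_apply, smul_eq_mul]
    refine le_trans ?_ (le_abs_self _)
    simp only [hhq]
    refine (sg_abs_le Jw (fun i => w i q) (mul_nonneg hM0.le (hg0 q)) hJ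
      fun i _ => hwq i q).trans (le_of_eq ?_)
    ring

end PTS

namespace PTS
open Finset

theorem geom_half (δ : ℝ) (hδ : 0 ≤ δ) (L : ℕ) :
    ∑ t ∈ range L, δ / 2 ^ (t + 2) ≤ δ / 2 := by
  have : ∑ t ∈ range L, δ / 2 ^ (t + 2) = δ / 2 - δ / 2 ^ (L + 1) := by
    induction L with
    | zero => simp
    | succ L ih =>
      rw [Finset.sum_range_succ, ih]
      field_simp
      ring
  rw [this]
  have : 0 ≤ δ / 2 ^ (L + 1) := by positivity
  linarith

theorem core_analytic {P : Set ℕ} (hP : ∀ a ∈ P, ∀ b ∈ P, a < b → a * a ≤ b) {N : ℕ} (hN : 1 ≤ N)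
    (p' : ℕ → ℕ) (hp' : StrictMono p') : ∃ M Q : ℕ, ∀ z : ℕ → ℕ →₀ ℝ,
    (∀ I : Finset ℕ, I ⊆ range M → ∀ α : ℕ → ℝ,
      tL (∑ i ∈ I, α i • z i) ≤ N * tL (vec p' I α)) →
    (∀ k, 2 * k ≤ M → ∀ A, (k : ℝ) / (2 * N) ≤ tL (∑ i ∈ Finset.Ico k (2 * k), sg A i • z i)) →
    (∀ i < M, ∀ q, z i q ≠ 0 → q ∈ P ∧ Q ≤ q) → False := by
  classical
  have hN0 : (0 : ℝ) < N := by exact_mod_cast hN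
  set Mf : ℕ → ℕ := fun s => 2 ^ (s + 5) * N ^ 2 with hMf
  set mf : ℕ → ℕ := fun s => 16 * N ^ 2 * Mf s * (s + 1) with hmf
  set kf : ℕ → ℕ := fun s => mf s ^ 2 with hkf
  have hMf1 : ∀ s, 1 ≤ Mf s := fun s => Nat.succ_le_of_lt (by positivity)
  have hm2 : ∀ s, 2 * mf s ≤ mf (s + 1) := by
    intro s
    have : Mf (s + 1) = 2 * Mf s := by simp only [hMf]; ring
    simp only [hmf]
    rw [this]
    calc 2 * (16 * N ^ 2 * Mf s * (s + 1)) = 16 * N ^ 2 * (2 * Mf s) * (s + 1) := by ring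
      _ ≤ 16 * N ^ 2 * (2 * Mf s) * (s + 1 + 1) := Nat.mul_le_mul_left _ (by omega)
  have hm1 : ∀ s, 1 ≤ mf s := by
    intro s
    have := hMf1 s
    exact Nat.succ_le_of_lt (by simp only [hmf]; positivity)
  have hk2 : ∀ s, 2 * kf s ≤ kf (s + 1) := by
    intro s
    have := hm2 s
    simp only [hkf]
    nlinarith [hm1 s]
  have hk1 : ∀ s, 1 ≤ kf s := fun s => Nat.one_le_pow _ _ (hm1 s)
  have hkmono : StrictMono kf := strictMono_nat_of_lt_succ fun s => by
    have := hk2 s; have := hk1 s; omega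
  obtain ⟨J, a, ha0, ha1, haε⟩ := noL1 (p := fun s => p' (2 * kf s))
    (fun s t h => hp' (by have := hkmono h; omega)) (ε := 1 / (64 * N ^ 2)) (by positivity)
  set L : ℕ := J.sup id + 1 with hL
  have hJL : ∀ s ∈ J, s < L := fun s hs => Nat.lt_succ_of_le (Finset.le_sup (f := id) hs)
  refine ⟨2 * kf L, 2 * 2 ^ (kf L) + 2 * J.card, ?_⟩
  intro z h1 h2 h3
  have hzN : ∀ i < 2 * kf L, tL (z i) ≤ N := by
    intro i hi
    have := h1 {i} (by simpa using hi) (fun _ => 1)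
    simp only [Finset.sum_singleton, one_smul, vec] at this
    refine this.trans (le_of_eq ?_)
    rw [tL, gL_single]; simp
  -- choice of the indices
  let Bs : (ℕ → ℕ) → ℕ → Set ℕ := fun f s =>
    {q | Mf s * (∑ t ∈ range s, absF (z (f t))) q < |z (f s) q|}
  have hchoice : ∀ s ≤ L, ∃ f : ℕ → ℕ, ∀ t < s, kf t ≤ f t ∧ f t < 2 * kf t ∧
      1 / (8 * N) ≤ tL (res (Bs f t) (z (f t))) := by
    intro s
    induction s with
    | zero => intro _; exact ⟨id, fun t ht => absurd ht (Nat.not_lt_zero _)⟩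
    | succ s ih =>
      intro hsL
      obtain ⟨f, hf⟩ := ih (by omega)
      have hks : 2 * kf s ≤ 2 * kf L := by
        have := hkmono (show s < L by omega); omega
      obtain ⟨i, hi, hi2⟩ := core_case2 hP hN z s (mf s) (Mf s) rfl (hMf1 s)
        (Finset.Ico (kf s) (2 * kf s)) (by rw [Nat.card_Ico, two_mul, Nat.add_sub_cancel])
        (fun A => by
          have := h2 (kf s) hks A
          simpa [hkf] using this)
        (fun i hi q hq => by
          rw [Finset.mem_Ico] at hi
          have := h3 i (by omega) q hq
          refine ⟨this.1, le_trans ?_ this.2⟩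
          have h5 : 2 ^ (mf s ^ 2) ≤ 2 ^ (kf L) :=
            Nat.pow_le_pow_right (by norm_num) (by change kf s ≤ kf L; omega)
          omega)
        (∑ t ∈ range s, absF (z (f t)))
        (fun q => by
          rw [Finsupp.finsetSum_apply]
          refine Finset.sum_nonneg fun t _ => ?_
          rw [absF_apply]; exact abs_nonneg _)
        (by
          refine (gL_sum_le _ _).trans ?_
          have : ∀ t ∈ range s, gL (fun _ _ => True) Set.univ (absF (z (f t))) ≤ (N : ℝ) := by
            intro t ht
            have ht' := Finset.mem_range.1 ht
            have h5 := hf t ht'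
            have h6 := hkmono (show t < L by omega)
            exact (tL_absF (z (f t))).le.trans (hzN _ (by omega))
          refine (Finset.sum_le_sum this).trans ?_
          simp)
      rw [Finset.mem_Ico] at hi
      refine ⟨Function.update f s i, ?_⟩
      have hupd : ∀ t < s, Function.update f s i t = f t := fun t ht =>
        Function.update_of_ne (by omega) _ _
      have hBs : ∀ t ≤ s, Bs (Function.update f s i) t =
          {q | Mf t * (∑ t ∈ range t, absF (z (f t))) q < |z (Function.update f s i t) q|} := by
        intro t ht
        have : ∑ r ∈ range t, absF (z (Function.update f s i r)) =
            ∑ r ∈ range t, absF (z (f r)) := by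
          refine Finset.sum_congr rfl fun r hr => ?_
          rw [hupd r (by have := Finset.mem_range.1 hr; omega)]
        simp only [Bs, this]
      intro t ht
      rw [hBs t (by omega)]
      rcases (Nat.lt_succ_iff.1 ht).eq_or_lt with rfl | h
      · rw [Function.update_self]
        exact ⟨hi.1, hi.2, hi2⟩
      · rw [hupd t h]
        exact hf t h
  obtain ⟨f0, hf0⟩ := hchoice L le_rfl
  -- make it total
  set f : ℕ → ℕ := fun s => if s < L then f0 s else kf s with hf
  have hfL : ∀ s < L, f s = f0 s := fun s hs => if_pos hs
  have hfk : ∀ s, kf s ≤ f s ∧ f s < 2 * kf s := by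
    intro s
    by_cases hs : s < L
    · rw [hfL s hs]; exact ⟨(hf0 s hs).1, (hf0 s hs).2.1⟩
    · have : f s = kf s := if_neg hs
      rw [this]; have := hk1 s; omega
  have hfmono : StrictMono f := strictMono_nat_of_lt_succ fun s => by
    have := (hfk s).2; have := (hfk (s + 1)).1; have := hk2 s; omega
  have hfM : ∀ s < L, f s < 2 * kf L := by
    intro s hs
    have := (hfk s).2; have := hkmono hs; omega
  set w : ℕ → ℕ →₀ ℝ := fun s => z (f s) with hw
  set B : ℕ → Set ℕ := fun s => {q | Mf s * ∑ t ∈ range s, |w t q| < |w s q|} with hB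
  have hwB : ∀ s < L, 1 / (8 * N) ≤ tL (res (B s) (w s)) := by
    intro s hs
    have h5 := (hf0 s hs).2.2
    rw [← hfL s hs] at h5
    have : Bs f0 s = B s := by
      simp only [Bs, hB, hw, hfL s hs, Finsupp.finsetSum_apply, absF_apply]
      have : ∀ q, ∑ t ∈ range s, |z (f0 t) q| = ∑ t ∈ range s, |z (f t) q| := by
        intro q
        refine Finset.sum_congr rfl fun t ht => ?_
        rw [hfL t (by have := Finset.mem_range.1 ht; omega)]
      simp only [this]
    rw [this] at h5
    exact h5
  have hwN : ∀ s < L, tL (w s) ≤ N := fun s hs => hzN _ (hfM s hs)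
  set W : ℕ → Set ℕ := fun s => {q | q ∈ B s ∧ ∀ t < L, s < t → q ∉ B t} with hW
  have hWd : ∀ s ∈ J, ∀ t ∈ J, s ≠ t → ∀ q, q ∈ W s → q ∉ W t := by
    intro s hs t ht hst q hq hq'
    rcases lt_or_gt_of_ne hst with h | h
    · exact hq.2 t (hJL t ht) h hq'.1
    · exact hq'.2 s (hJL s hs) h hq.1
  have hWn : ∀ s < L, 1 / (16 * N) ≤ tL (res (W s) (w s)) := by
    intro s hs
    have h5 : tL (res (B s) (w s)) ≤ ∑ l ∈ (range (L + 1)),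
        tL (if l = L then res (W s) (w s) else if s < l then res (B l) (w s) else 0) := by
      refine tL_le_sum_of_abs _ _ _ fun q => ?_
      by_cases hq : q ∈ B s
      · rw [res_mem _ hq]
        by_cases hqW : q ∈ W s
        · refine le_trans (le_of_eq ?_) (Finset.single_le_sum (fun i _ => abs_nonneg _)
            (Finset.mem_range.2 (Nat.lt_succ_self L)))
          rw [if_pos rfl, res_mem _ hqW]
        · have : ∃ t < L, s < t ∧ q ∈ B t := by
            by_contra hc
            push Not at hc
            exact hqW ⟨hq, hc⟩
          obtain ⟨t, htL, hst, hqt⟩ := this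
          refine le_trans (le_of_eq ?_) (Finset.single_le_sum (fun i _ => abs_nonneg _)
            (Finset.mem_range.2 (show t < L + 1 by omega)))
          rw [if_neg (by omega), if_pos hst, res_mem _ hqt]
      · rw [res_not_mem _ hq, abs_zero]
        exact Finset.sum_nonneg fun _ _ => abs_nonneg _
    rw [Finset.sum_range_succ, if_pos rfl] at h5
    have h6 : ∀ l ∈ range L, tL (if l = L then res (W s) (w s) else
        if s < l then res (B l) (w s) else 0) ≤ (1 / (8 * N)) / 2 ^ (l + 2) := by
      intro l hl
      have hl' := Finset.mem_range.1 hl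
      rw [if_neg (by omega)]
      split_ifs with hsl
      · have hMl : (0 : ℝ) < Mf l := by exact_mod_cast hMf1 l
        have h7 : tL (res (B l) (w s)) ≤ tL ((1 / (Mf l : ℝ)) • w l) := by
          refine gL_mono_abs fun q => ?_
          by_cases hq : q ∈ B l
          · rw [res_mem _ hq, Finsupp.smul_apply, smul_eq_mul, abs_mul,
              abs_of_pos (by positivity : (0 : ℝ) < 1 / Mf l), one_div, le_inv_mul_iff₀ hMl]
            have h8 : |w s q| ≤ ∑ t ∈ range l, |w t q| :=
              Finset.single_le_sum (f := fun t => |w t q|) (fun i _ => abs_nonneg _)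
                (Finset.mem_range.2 hsl)
            have h9 : (Mf l : ℝ) * ∑ t ∈ range l, |w t q| < |w l q| := hq
            exact (mul_le_mul_of_nonneg_left h8 hMl.le).trans h9.le
          · rw [res_not_mem _ hq, abs_zero]; exact abs_nonneg _
        refine h7.trans ?_
        rw [tL, gL_smul, abs_of_pos (by positivity : (0 : ℝ) < 1 / Mf l)]
        calc 1 / (Mf l : ℝ) * gL (fun _ _ => True) Set.univ (w l) ≤ 1 / (Mf l : ℝ) * N :=
              mul_le_mul_of_nonneg_left (hwN l hl') (by positivity)
          _ = (1 / (8 * N)) / 2 ^ (l + 2) := by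
              simp only [hMf]
              push_cast
              field_simp
              ring
      · rw [tL, gL_zero]; positivity
    have h7 := (Finset.sum_le_sum h6).trans (geom_half (1 / (8 * N)) (by positivity) L)
    have h8 := hwB s hs
    have h9 : (1 / (8 * N) : ℝ) = 2 * (1 / (16 * N)) := by field_simp; norm_num
    rw [h9] at h7 h8
    rw [h9] at *
    linarith
  -- conclusion
  set y : ℕ →₀ ℝ := ∑ s ∈ J, a s • res (W s) (w s) with hy
  have hyq : ∀ s ∈ J, ∀ q ∈ W s, y q = a s * w s q := by
    intro s hs q hq
    rw [hy, Finsupp.finsetSum_apply, Finset.sum_eq_single_of_mem s hs]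
    · rw [Finsupp.smul_apply, smul_eq_mul, res_mem _ hq]
    · intro t ht hts
      rw [Finsupp.smul_apply, res_not_mem _ (hWd s hs t ht hts.symm q hq), smul_zero]
  have hyq0 : ∀ q, (∀ s ∈ J, q ∉ W s) → y q = 0 := by
    intro q hq
    rw [hy, Finsupp.finsetSum_apply, Finset.sum_eq_zero]
    intro t ht
    rw [Finsupp.smul_apply, res_not_mem _ (hq t ht), smul_zero]
  have hlow := tL_concave hP J (fun s => a s • res (W s) (w s)) y ?_ ?_
  · have h5 : ∑ s ∈ J, a s * (1 / (16 * N)) ≤ ∑ s ∈ J, tL (a s • res (W s) (w s)) := by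
      refine Finset.sum_le_sum fun s hs => ?_
      rw [tL, gL_smul, abs_of_nonneg (ha0 s)]
      exact mul_le_mul_of_nonneg_left (hWn s (hJL s hs)) (ha0 s)
    rw [← Finset.sum_mul, ha1, one_mul] at h5
    -- upper bound
    set h : Finset ℕ → ℕ →₀ ℝ := fun A => ∑ s ∈ J, (sg A s * a s) • w s with hh
    have h6 : tL ((2 ^ J.card : ℝ) • y) ≤ ∑ A ∈ J.powerset, tL (h A) := by
      refine tL_le_sum_of_abs _ _ _ fun q => ?_
      by_cases hq : ∃ s ∈ J, q ∈ W s
      · obtain ⟨s, hs, hqs⟩ := hq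
        rw [Finsupp.smul_apply, hyq s hs q hqs, smul_eq_mul, abs_mul,
          abs_of_pos (by positivity : (0 : ℝ) < 2 ^ J.card)]
        refine (sg_abs_ge J (fun s => a s * w s q) hs).trans (le_of_eq ?_)
        refine Finset.sum_congr rfl fun A _ => ?_
        simp [hh, Finsupp.finsetSum_apply, mul_assoc]
      · push Not at hq
        rw [Finsupp.smul_apply, hyq0 q hq, smul_zero, abs_zero]
        exact Finset.sum_nonneg fun _ _ => abs_nonneg _
    have h7 : ∀ A ∈ J.powerset, tL (h A) ≤ N * (1 / (64 * N ^ 2)) := by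
      intro A _
      -- rewrite as a sum over the image
      set β : ℕ → ℝ := fun s => sg A s * a s with hβ
      set α : ℕ → ℝ := fun i => β (Function.invFun f i) with hα
      have hαf : ∀ s, α (f s) = β s := fun s => by
        simp only [hα, Function.leftInverse_invFun hfmono.injective s]
      have h8 := h1 (J.image f) (by
        intro i hi
        obtain ⟨s, hs, rfl⟩ := Finset.mem_image.1 hi
        exact Finset.mem_range.2 (hfM s (hJL s hs))) α
      have e1 : ∑ i ∈ J.image f, α i • z i = h A := by
        rw [Finset.sum_image (fun _ _ _ _ h => hfmono.injective h)]
        exact Finset.sum_congr rfl fun s _ => by rw [hαf]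
      have e2 : vec p' (J.image f) α = vec (fun s => p' (f s)) J β := by
        rw [vec, vec, Finset.sum_image (fun _ _ _ _ h => hfmono.injective h)]
        exact Finset.sum_congr rfl fun s _ => by rw [hαf]
      rw [e1, e2] at h8
      refine h8.trans (mul_le_mul_of_nonneg_left ?_ hN0.le)
      have hmk : StrictMono fun s => p' (2 * kf s) := fun s t h => hp' (by have := hkmono h; omega)
      refine (tL_shift (hp'.comp hfmono) hmk
        (fun s => hp'.monotone (hfk s).2.le) J β).trans (le_trans ?_ haε)
      refine tL_vec_mono hmk.injective le_rfl fun s _ => ?_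
      rw [hβ]
      simp only
      rw [abs_mul, abs_sg, one_mul]
    have h8 := h6.trans (Finset.sum_le_sum h7)
    rw [Finset.sum_const, Finset.card_powerset, nsmul_eq_mul, tL, gL_smul,
      abs_of_pos (by positivity : (0 : ℝ) < 2 ^ J.card)] at h8
    push_cast at h8
    have h9 := le_of_mul_le_mul_left h8 (by positivity)
    have h10 : (1 / (16 * N) : ℝ) = 4 * (N * (1 / (64 * N ^ 2))) := by field_simp; norm_num
    have h11 : (0 : ℝ) < N * (1 / (64 * N ^ 2)) := by positivity
    rw [h10] at h5
    have h12 : 2⁻¹ * (4 * (N * (1 / (64 * (N : ℝ) ^ 2)))) ≤ N * (1 / (64 * N ^ 2)) :=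
      (mul_le_mul_of_nonneg_left h5 (by norm_num)).trans (hlow.trans h9)
    linarith
  · intro s hs q hq
    have hz : z (f s) q ≠ 0 := by
      intro h0
      apply hq
      rw [Finsupp.smul_apply, res_apply]
      simp [hw, h0]
    have := h3 (f s) (hfM s (hJL s hs)) q hz
    exact ⟨this.1, by omega⟩
  · intro q
    by_cases hq : ∃ s ∈ J, q ∈ W s
    · obtain ⟨s, hs, hqs⟩ := hq
      rw [hyq s hs q hqs, Finset.sum_eq_single_of_mem s hs]
      · rw [Finsupp.smul_apply, smul_eq_mul, res_mem _ hqs]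
      · intro t ht hts
        rw [Finsupp.smul_apply, res_not_mem _ (hWd s hs t ht hts.symm q hqs), smul_zero, abs_zero]
    · push Not at hq
      refine le_trans (le_of_eq ?_) (abs_nonneg _)
      refine Finset.sum_eq_zero fun t ht => ?_
      rw [Finsupp.smul_apply, res_not_mem _ (hq t ht), smul_zero, abs_zero]

end PTS

namespace PTS
open Finset

theorem lin_rel (n : ℕ) (F : Finset ℕ) (hF : F.card ≤ n) (ξ : ℕ → ℕ →₀ ℝ) :
    ∃ c : ℕ → ℝ, (∀ t, |c t| ≤ 1) ∧ (∃ t, t < n + 1 ∧ |c t| = 1) ∧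
      ∀ q ∈ F, (∑ t ∈ range (n + 1), c t • ξ t) q = 0 := by
  classical
  let L : (Fin (n + 1) → ℝ) →ₗ[ℝ] (F → ℝ) :=
    { toFun := fun c q => ∑ t, c t * ξ t q
      map_add' := by
        intro x y; ext q
        simp only [Pi.add_apply, add_mul, Finset.sum_add_distrib]
      map_smul' := by
        intro r x; ext q
        simp only [Pi.smul_apply, smul_eq_mul, RingHom.id_apply, Finset.mul_sum, mul_assoc] }
  have hker : LinearMap.ker L ≠ ⊥ := by
    apply LinearMap.ker_ne_bot_of_finrank_lt
    simp only [Module.finrank_fintype_fun_eq_card, Fintype.card_fin, Fintype.card_coe]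
    omega
  obtain ⟨x, hx, hx0⟩ := (Submodule.ne_bot_iff _).1 hker
  obtain ⟨t0, -, hmax⟩ := Finset.exists_max_image (univ : Finset (Fin (n + 1))) (fun t => |x t|)
    ⟨0, mem_univ _⟩
  have hpos : 0 < |x t0| := by
    obtain ⟨t, ht⟩ := Function.ne_iff.1 hx0
    exact (abs_pos.2 ht).trans_le (hmax t (mem_univ _))
  refine ⟨fun t => if h : t < n + 1 then x ⟨t, h⟩ / |x t0| else 0, ?_, ⟨t0, t0.2, ?_⟩, ?_⟩
  · intro t
    dsimp only
    split_ifs with h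
    · rw [abs_div, abs_abs, div_le_one hpos]
      exact hmax _ (mem_univ _)
    · simp
  · simp only [t0.2, dite_true, Fin.eta, abs_div, abs_abs]
    exact div_self hpos.ne'
  · intro q hq
    rw [Finsupp.finsetSum_apply, Finset.sum_range]
    have := congrFun (LinearMap.mem_ker.1 hx) ⟨q, hq⟩
    have h2 : ∑ t, x t * ξ t q = 0 := this
    calc _ = ∑ t : Fin (n + 1), |x t0|⁻¹ * (x t * ξ t q) := by
          refine Finset.sum_congr rfl fun t _ => ?_
          simp only [t.2, dite_true, Fin.eta, Finsupp.smul_apply, smul_eq_mul]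
          ring
      _ = 0 := by rw [← Finset.mul_sum, h2, mul_zero]

theorem sum_range_mul_fiber {E : Type*} [AddCommMonoid E] (M n : ℕ) (f : ℕ → E) :
    ∑ l ∈ range (M * (n + 1)), f l = ∑ i ∈ range M, ∑ t ∈ range (n + 1), f (i * (n + 1) + t) := by
  induction M with
  | zero => simp
  | succ M ih =>
    rw [Finset.sum_range_succ, Nat.succ_mul, Finset.sum_range_add, ih]

theorem core_fixed (n : ℕ) (hn : 1 ≤ n) (p : ℕ → ℕ) (hp : StrictMono p)
    (hp2 : ∀ i j, i < j → p i * p i ≤ p j) :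
    ∃ D Q : ℕ, ∀ F : Finset ℕ, F.card ≤ n → ∀ ζ : ℕ → ℕ →₀ ℝ,
      (∀ j < D, ∀ q, ζ j q ≠ 0 → q ∈ Set.range p ∧ (q ∈ F ∨ Q ≤ q)) →
      (∀ a : ℕ → ℝ, tL (vec p (range D) a) ≤ n * tL (∑ j ∈ range D, a j • ζ j)) →
      (∀ a : ℕ → ℝ, tL (∑ j ∈ range D, a j • ζ j) ≤ n * tL (vec p (range D) a)) → False := by
  classical
  have hP : ∀ a ∈ Set.range p, ∀ b ∈ Set.range p, a < b → a * a ≤ b := by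
    rintro _ ⟨i, rfl⟩ _ ⟨j, rfl⟩ h
    exact hp2 i j (hp.lt_iff_lt.1 h)
  have hp'm : StrictMono fun i => p ((i + 1) * (n + 1)) := by
    intro i j hij
    apply hp
    have : i + 1 < j + 1 := by omega
    exact Nat.mul_lt_mul_of_pos_right this (by omega)
  obtain ⟨M, Q, hMQ⟩ := core_analytic hP (N := n * (n + 1)) (Nat.mul_pos hn (by omega))
    (fun i => p ((i + 1) * (n + 1))) hp'm
  refine ⟨M * (n + 1), Q, fun F hF ζ hsupp hlow hup => ?_⟩
  choose c hc1 hc2 hc0 using fun i => lin_rel n F hF (fun t => ζ (i * (n + 1) + t))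
  choose b hb hcb using hc2
  have hdiv : ∀ i t, t < n + 1 → (i * (n + 1) + t) / (n + 1) = i := by
    intro i t ht
    rw [Nat.add_comm, Nat.add_mul_div_right _ _ (by omega), Nat.div_eq_of_lt ht, zero_add]
  have hmod : ∀ i t, t < n + 1 → (i * (n + 1) + t) % (n + 1) = t := by
    intro i t ht
    rw [Nat.add_comm, Nat.add_mul_mod_self_right, Nat.mod_eq_of_lt ht]
  set z : ℕ → ℕ →₀ ℝ := fun i => ∑ t ∈ range (n + 1), c i t • ζ (i * (n + 1) + t) with hz
  let A : Finset ℕ → (ℕ → ℝ) → ℕ → ℝ := fun I α l =>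
    if l / (n + 1) ∈ I then α (l / (n + 1)) * c (l / (n + 1)) (l % (n + 1)) else 0
  have hcomb : ∀ I ⊆ range M, ∀ α : ℕ → ℝ,
      ∑ i ∈ I, α i • z i = ∑ l ∈ range (M * (n + 1)), A I α l • ζ l := by
    intro I hI α
    rw [sum_range_mul_fiber]
    rw [← Finset.sum_subset hI]
    · refine Finset.sum_congr rfl fun i hi => ?_
      rw [hz, Finset.smul_sum]
      refine Finset.sum_congr rfl fun t ht => ?_
      have ht := mem_range.1 ht
      simp only [A, hdiv i t ht, hmod i t ht, if_pos hi, smul_smul]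
    · intro i _ hi
      refine Finset.sum_eq_zero fun t ht => ?_
      have ht := mem_range.1 ht
      simp only [A, hdiv i t ht, if_neg hi, zero_smul]
  have hn0 : (0 : ℝ) < n := by exact_mod_cast hn
  refine hMQ z ?_ ?_ ?_
  · intro I hI α
    rw [hcomb I hI]
    refine (hup _).trans ?_
    have h1 : tL (vec p (range (M * (n + 1))) (A I α)) ≤
        ∑ t ∈ range (n + 1), tL (vec (fun i => p (i * (n + 1) + t)) I α) := by
      refine tL_le_sum_of_abs _ _ _ fun q => ?_
      by_cases h0 : vec p (range (M * (n + 1))) (A I α) q = 0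
      · rw [h0, abs_zero]; exact Finset.sum_nonneg fun _ _ => abs_nonneg _
      obtain ⟨l, hl, rfl⟩ := vec_ne h0
      rw [vec_apply hp.injective hl] at h0 ⊢
      have hlI : l / (n + 1) ∈ I := by
        by_contra hcon
        exact h0 (if_neg hcon)
      have hlt : l % (n + 1) < n + 1 := Nat.mod_lt _ (by omega)
      have hle : l / (n + 1) * (n + 1) + l % (n + 1) = l := Nat.div_add_mod' l (n + 1)
      have hinj : Function.Injective fun i => p (i * (n + 1) + l % (n + 1)) := by
        intro i j hij
        have := hp.injective hij
        have h' : i * (n + 1) = j * (n + 1) := by omega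
        exact Nat.eq_of_mul_eq_mul_right (by omega) h'
      refine le_trans ?_ (Finset.single_le_sum
        (f := fun t => |vec (fun i => p (i * (n + 1) + t)) I α (p l)|) (fun _ _ => abs_nonneg _)
        (mem_range.2 hlt))
      have hv := vec_apply (a := α) hinj hlI
      simp only [hle] at hv
      rw [hv]
      simp only [A, if_pos hlI, abs_mul]
      exact mul_le_of_le_one_right (abs_nonneg _) (hc1 _ _)
    have h2 : ∀ t ∈ range (n + 1), tL (vec (fun i => p (i * (n + 1) + t)) I α) ≤
        tL (vec (fun i => p ((i + 1) * (n + 1))) I α) := by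
      intro t ht
      have ht := mem_range.1 ht
      refine tL_shift ?_ hp'm ?_ _ _
      · intro i j hij
        apply hp
        have := Nat.mul_lt_mul_of_pos_right hij (show 0 < n + 1 by omega)
        omega
      · intro i
        apply hp.monotone
        rw [Nat.succ_mul]; omega
    have h3 := h1.trans (Finset.sum_le_sum h2)
    rw [Finset.sum_const, card_range, nsmul_eq_mul] at h3
    calc (n : ℝ) * tL (vec p (range (M * (n + 1))) (A I α)) ≤ n * _ :=
          mul_le_mul_of_nonneg_left h3 hn0.le
      _ = _ := by push_cast; ring
  · intro k hk B
    have hIk : Ico k (2 * k) ⊆ range M := by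
      intro i hi
      rw [mem_Ico] at hi
      rw [mem_range]; omega
    rw [hcomb _ hIk]
    set a := A (Ico k (2 * k)) (sg B) with ha
    have h1 := hlow a
    have h2 : (k : ℝ) / 2 ≤ tL (vec p (range (M * (n + 1))) a) := by
      have hbl : ∀ i, i ≤ i * (n + 1) + b i := fun i =>
        (Nat.le_mul_of_pos_right i (by omega)).trans (Nat.le_add_right _ _)
      have hmono : ∀ i j, i < j → i * (n + 1) + b i < j * (n + 1) + b j := by
        intro i j hij
        have h1 : (i + 1) * (n + 1) ≤ j * (n + 1) := Nat.mul_le_mul_right _ hij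
        have := hb i
        rw [Nat.succ_mul] at h1
        omega
      have h := le_tL_of_flex (Ico k (2 * k)) (fun i => {p (i * (n + 1) + b i)})
        (vec p (range (M * (n + 1))) a) ?_ ?_
      · refine le_trans ?_ h
        have : ∀ i ∈ Ico k (2 * k), tL (res (↑({p (i * (n + 1) + b i)} : Finset ℕ))
            (vec p (range (M * (n + 1))) a)) = 1 := by
          intro i hi
          have hiM := mem_range.1 (hIk hi)
          rw [Finset.coe_singleton, res_singleton, tL, gL_single, vec_apply hp.injective, ha]
          · simp only [A, hdiv i _ (hb i), hmod i _ (hb i), if_pos hi, abs_mul, hcb, abs_sg, mul_one]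
          · rw [mem_range]
            have h1 : (i + 1) * (n + 1) ≤ M * (n + 1) := Nat.mul_le_mul_right _ hiM
            have := hb i
            rw [Nat.succ_mul] at h1
            omega
        rw [Finset.sum_congr rfl this]
        simp only [sum_const, Nat.card_Ico, nsmul_eq_mul, mul_one]
        have : 2 * k - k = k := by omega
        rw [this]
        linarith
      · intro i hi q hq
        rw [mem_singleton] at hq
        rw [mem_Ico] at hi
        subst hq
        rw [Nat.card_Ico]
        have := hp.le_apply (x := i * (n + 1) + b i)
        have := hbl i
        omega
      · intro i _ j _ hij
        simp only [mem_singleton, forall_eq]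
        rcases lt_or_gt_of_ne hij with h | h
        · exact Or.inl (hp (hmono _ _ h))
        · exact Or.inr (hp (hmono _ _ h))
    have h3 : (k : ℝ) / 2 ≤ n * tL (∑ j ∈ range (M * (n + 1)), a j • ζ j) := h2.trans h1
    have hn1 : (0 : ℝ) < 2 * ((n * (n + 1) : ℕ) : ℝ) := by push_cast; positivity
    rw [div_le_iff₀ hn1]
    push_cast
    have h0 : 0 ≤ tL (∑ j ∈ range (M * (n + 1)), a j • ζ j) := gL_nonneg _
    nlinarith [mul_nonneg (mul_nonneg hn0.le hn0.le) h0, mul_nonneg hn0.le h0]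
  · intro i hi q hq
    obtain ⟨t, ht, h⟩ := block_ne hq
    have ht := mem_range.1 ht
    have hlt : i * (n + 1) + t < M * (n + 1) := by
      have h1 : (i + 1) * (n + 1) ≤ M * (n + 1) := Nat.mul_le_mul_right _ hi
      rw [Nat.succ_mul] at h1
      omega
    obtain ⟨h1, h2⟩ := hsupp _ hlt q h
    refine ⟨h1, h2.resolve_left fun hqF => hq ?_⟩
    exact hc0 i q hqF

/-- Core non-embedding statement. -/
theorem core (p : ℕ → ℕ) (hp : StrictMono p) (hp2 : ∀ i j, i < j → p i * p i ≤ p j) :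
    ∃ κ : ℕ → ℕ, StrictMono κ ∧ ∀ n : ℕ, 1 ≤ n → ∃ D : ℕ, ∀ ζ : ℕ → ℕ →₀ ℝ,
      (∀ j < D, ∀ q, ζ j q ≠ 0 → ∃ i, q = p (κ i)) →
      (∀ a : ℕ → ℝ, tL (vec p (range D) a) ≤ n * tL (∑ j ∈ range D, a j • ζ j)) →
      (∀ a : ℕ → ℝ, tL (∑ j ∈ range D, a j • ζ j) ≤ n * tL (vec p (range D) a)) → False := by
  classical
  choose D Q hDQ using fun n : ℕ => core_fixed (n + 1) (by omega) p hp hp2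
  let κ : ℕ → ℕ := fun i => i + ∑ m ∈ range (i + 1), Q m
  have hκ : StrictMono κ := by
    intro i j hij
    have : ∑ m ∈ range (i + 1), Q m ≤ ∑ m ∈ range (j + 1), Q m :=
      Finset.sum_le_sum_of_subset (by intro m; simp only [mem_range]; omega)
    simp only [κ]; omega
  refine ⟨κ, hκ, fun n hn => ⟨D (n - 1), fun ζ hsupp hlow hup => ?_⟩⟩
  have hn' : n - 1 + 1 = n := by omega
  refine hDQ (n - 1) ((range n).image fun i => p (κ i)) ?_ ζ ?_ ?_ ?_
  · rw [hn']
    exact Finset.card_image_le.trans (card_range n).le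
  · intro j hj q hq
    obtain ⟨i, rfl⟩ := hsupp j hj q hq
    refine ⟨⟨_, rfl⟩, ?_⟩
    by_cases hi : i < n
    · exact Or.inl (mem_image.2 ⟨i, mem_range.2 hi, rfl⟩)
    · right
      have h1 : Q (n - 1) ≤ κ i := by
        have : Q (n - 1) ≤ ∑ m ∈ range (i + 1), Q m :=
          Finset.single_le_sum (f := Q) (fun _ _ => Nat.zero_le _) (mem_range.2 (by omega))
        simp only [κ]; omega
      exact h1.trans hp.le_apply
  · rw [hn']; exact hlow
  · rw [hn']; exact hup

end PTS

namespace PTS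
open Finset

theorem tsirAdm_iff (k : ℕ) (E : Fin k → Finset ℕ) :
    TsirAdmissible k E ↔ gAdm (fun _ _ => True) Set.univ k E := by
  simp [TsirAdmissible, gAdm]

theorem tsirNorm_eq (m : ℕ) (x : ℕ →₀ ℝ) : tsirNorm m x = tN m x := by
  induction m generalizing x with
  | zero => rfl
  | succ m ih =>
    simp only [tsirNorm, tN, gN, sN, ih, filter_eq_res, tsirAdm_iff]

theorem tsirNormLim_eq (x : ℕ →₀ ℝ) : tsirNormLim x = tL x := by
  simp only [tsirNormLim, tsirNorm_eq]; rfl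

variable (θ : Set (List ℕ)) (σ : ℕ ≃ List ℕ)

/-- Incomparability of nodes in coordinates. -/
def Rt : ℕ → ℕ → Prop := fun a b => ¬ TreeComparable (σ a) (σ b)

/-- The tree in coordinates. -/
def Th : Set ℕ := {q | σ q ∈ θ}

theorem tsAdm_iff (k : ℕ) (E : Fin k → Finset (List ℕ)) :
    TsAdmissible θ σ k E ↔ gAdm (Rt σ) (Th θ σ) k (fun i => (E i).map σ.symm.toEmbedding) := by
  simp only [TsAdmissible, gAdm, CompIncomp, Rt, Th, Finset.map_nonempty, Finset.mem_map_equiv,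
    Equiv.symm_symm]
  refine and_congr (forall_congr' fun i => and_congr Iff.rfl ?_) (and_congr ?_ (and_congr ?_ ?_))
  · constructor
    · intro h q hq
      rw [Finset.mem_coe, Finset.mem_map_equiv] at hq
      exact h hq
    · intro h s hs
      have : σ.symm s ∈ (↑(Finset.map σ.symm.toEmbedding (E i)) : Set ℕ) := by
        rw [Finset.mem_coe, Finset.mem_map_equiv]; simpa using hs
      simpa using h this
  · refine forall_congr' fun i => forall_congr' fun j => forall_congr' fun _ => ?_
    constructor
    · intro h a ha b hb
      simpa using h _ ha _ hb
    · intro h s hs t ht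
      exact h _ (by simpa using hs) _ (by simpa using ht)
  · refine forall_congr' fun i => ?_
    constructor
    · intro h a ha
      simpa using h _ ha
    · intro h s hs
      exact h _ (by simpa using hs)
  · refine forall_congr' fun i => forall_congr' fun j => forall_congr' fun _ => ?_
    constructor
    · intro h a ha b hb
      exact h _ ha _ hb
    · intro h s hs t ht
      simpa using h (σ.symm s) (by simpa using hs) (σ.symm t) (by simpa using ht)

theorem supVal_eq (x : ℕ →₀ ℝ) : supVal (x.equivMapDomain σ) = sN x := by
  simp only [supVal, sN, Finsupp.equivMapDomain_apply]
  exact σ.symm.iSup_comp (g := fun n => |x n|)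

theorem filter_equivMap (x : ℕ →₀ ℝ) (E : Finset (List ℕ)) :
    (x.equivMapDomain σ).filter (· ∈ E) =
      (res (↑(E.map σ.symm.toEmbedding)) x).equivMapDomain σ := by
  ext s
  rw [Finsupp.filter_apply, Finsupp.equivMapDomain_apply, Finsupp.equivMapDomain_apply, res_apply]
  simp

theorem tsNorm_eq (m : ℕ) (x : ℕ →₀ ℝ) :
    tsNorm θ σ m (x.equivMapDomain σ) = gN (Rt σ) (Th θ σ) m x := by
  induction m generalizing x with
  | zero => exact supVal_eq σ x
  | succ m ih =>
    simp only [tsNorm, gN, supVal_eq, filter_equivMap, ih, tsAdm_iff]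
    congr 3
    ext r
    constructor
    · rintro ⟨k, E, hE, rfl⟩
      exact ⟨k, _, hE, rfl⟩
    · rintro ⟨k, E, hE, rfl⟩
      have : E = fun i => ((E i).map σ.toEmbedding).map σ.symm.toEmbedding := by
        ext i a; simp
      refine ⟨k, fun i => (E i).map σ.toEmbedding, ?_, ?_⟩
      · rwa [← this]
      · refine Finset.sum_congr rfl fun i _ => ?_
        rw [congrFun this i]

theorem tsNormLim_eq (x : ℕ →₀ ℝ) :
    tsNormLim θ σ (x.equivMapDomain σ) = gL (Rt σ) (Th θ σ) x := by
  simp only [tsNormLim, tsNorm_eq]; rfl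

end PTS

namespace PTS
open Finset

theorem exists_iota {X : Type*} [NormedAddCommGroup X] [NormedSpace ℝ X]
    (θ : Set (List ℕ)) (σ : ℕ ≃ List ℕ) (u : List ℕ → X)
    (hXnorm : ∀ z : List ℕ →₀ ℝ, ↑z.support ⊆ θ →
      ‖∑ s ∈ z.support, z s • u s‖ = tsNormLim θ σ z)
    (hXdense : DenseRange fun z : {z : List ℕ →₀ ℝ // ↑z.support ⊆ θ} =>
      ∑ s ∈ (z : List ℕ →₀ ℝ).support, (z : List ℕ →₀ ℝ) s • u s) :
    ∃ ι : (ℕ →₀ ℝ) →ₗ[ℝ] X, (∀ x, ‖ι x‖ = gL (Rt σ) (Th θ σ) (res (Th θ σ) x)) ∧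
      DenseRange ι := by
  classical
  let ι : (ℕ →₀ ℝ) →ₗ[ℝ] X :=
    Finsupp.linearCombination ℝ (fun q => if q ∈ Th θ σ then u (σ q) else 0)
  have h1 : ∀ x, ι x = ι (res (Th θ σ) x) := by
    intro x
    simp only [ι]
    rw [Finsupp.linearCombination_apply, Finsupp.linearCombination_apply, Finsupp.sum,
      Finsupp.sum, ← Finset.sum_subset (res_support_subset (Th θ σ) x)]
    · refine Finset.sum_congr rfl fun q hq => ?_
      have hq' : q ∈ Th θ σ := by
        by_contra hcon
        exact Finsupp.mem_support_iff.1 hq (res_not_mem x hcon)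
      rw [res_mem x hq']
    · intro q hq hq'
      rw [Finsupp.notMem_support_iff] at hq'
      by_cases hT : q ∈ Th θ σ
      · rw [res_mem x hT] at hq'
        exact absurd hq' (Finsupp.mem_support_iff.1 hq)
      · rw [if_neg hT, smul_zero]
  have h2 : ∀ x : ℕ →₀ ℝ, (∀ q, x q ≠ 0 → q ∈ Th θ σ) →
      ι x = ∑ s ∈ (x.equivMapDomain σ).support, (x.equivMapDomain σ) s • u s := by
    intro x hx
    simp only [ι]
    rw [Finsupp.linearCombination_apply]
    have : (∑ s ∈ (x.equivMapDomain σ).support, (x.equivMapDomain σ) s • u s) =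
      (x.equivMapDomain σ).sum fun s r => r • u s := rfl
    rw [this, Finsupp.sum_equivMapDomain]
    refine Finset.sum_congr rfl fun q hq => ?_
    have hq' := hx q (Finsupp.mem_support_iff.1 hq)
    dsimp only
    rw [if_pos hq']
  have h3 : ∀ x : ℕ →₀ ℝ, (∀ q, x q ≠ 0 → q ∈ Th θ σ) →
      ↑(x.equivMapDomain σ).support ⊆ θ := by
    intro x hx s hs
    have hs' := Finsupp.mem_support_iff.1 (Finset.mem_coe.1 hs)
    rw [Finsupp.equivMapDomain_apply] at hs'
    have := hx _ hs'
    simpa [Th] using this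
  refine ⟨ι, fun x => ?_, ?_⟩
  · have hx : ∀ q, res (Th θ σ) x q ≠ 0 → q ∈ Th θ σ := by
      intro q hq
      by_contra hcon
      exact hq (res_not_mem x hcon)
    rw [h1, h2 _ hx, hXnorm _ (h3 _ hx), tsNormLim_eq]
  · refine hXdense.mono ?_
    rintro _ ⟨⟨z, hz⟩, rfl⟩
    refine ⟨z.equivMapDomain σ.symm, ?_⟩
    have hx : ∀ q, z.equivMapDomain σ.symm q ≠ 0 → q ∈ Th θ σ := by
      intro q hq
      rw [Finsupp.equivMapDomain_apply] at hq
      exact hz (Finset.mem_coe.2 (Finsupp.mem_support_iff.2 hq))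
    rw [h2 _ hx]
    have : (z.equivMapDomain σ.symm).equivMapDomain σ = z := by
      ext s; simp [Finsupp.equivMapDomain_apply]
    rw [this]

section
variable {X : Type*} [NormedAddCommGroup X] [NormedSpace ℝ X] [CompleteSpace X]
  {R : ℕ → ℕ → Prop} {Θ : Set ℕ}

/-- Coordinate projections. -/
noncomputable def proj (ι : (ℕ →₀ ℝ) →ₗ[ℝ] X) (A : Set ℕ) : X →L[ℝ] X :=
  (ι ∘ₗ res A).extendOfNorm ι

theorem iota_res_le {ι : (ℕ →₀ ℝ) →ₗ[ℝ] X} (hι : ∀ x, ‖ι x‖ = gL R Θ (res Θ x)) (A : Set ℕ)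
    (x : ℕ →₀ ℝ) : ‖ι (res A x)‖ ≤ ‖ι x‖ := by
  rw [hι, hι, res_res, Set.inter_comm, ← res_res]
  exact gL_res_le _ _

theorem proj_iota {ι : (ℕ →₀ ℝ) →ₗ[ℝ] X} (hι : ∀ x, ‖ι x‖ = gL R Θ (res Θ x))
    (hd : DenseRange ι) (A : Set ℕ) (x : ℕ →₀ ℝ) : proj ι A (ι x) = ι (res A x) := by
  rw [proj, LinearMap.extendOfNorm_eq hd]
  · rfl
  · exact ⟨1, fun x => by rw [one_mul]; exact iota_res_le hι A x⟩

theorem proj_le {ι : (ℕ →₀ ℝ) →ₗ[ℝ] X} (hι : ∀ x, ‖ι x‖ = gL R Θ (res Θ x))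
    (hd : DenseRange ι) (A : Set ℕ) (x : X) : ‖proj ι A x‖ ≤ ‖x‖ := by
  refine hd.induction_on (p := fun x => ‖proj ι A x‖ ≤ ‖x‖) x
    (isClosed_le (by fun_prop) (by fun_prop)) fun x => ?_
  rw [proj_iota hι hd]
  exact iota_res_le hι A x

/-- The coordinates depend linearly on finitely many functionals. -/
theorem proj_proj {ι : (ℕ →₀ ℝ) →ₗ[ℝ] X} (hι : ∀ x, ‖ι x‖ = gL R Θ (res Θ x))
    (hd : DenseRange ι) (A B : Set ℕ) (x : X) : proj ι A (proj ι B x) = proj ι (A ∩ B) x := by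
  refine hd.induction_on (p := fun x => proj ι A (proj ι B x) = proj ι (A ∩ B) x) x
    (isClosed_eq (by fun_prop) (by fun_prop)) fun x => ?_
  simp only [proj_iota hι hd, res_res]

theorem proj_add {ι : (ℕ →₀ ℝ) →ₗ[ℝ] X} (hι : ∀ x, ‖ι x‖ = gL R Θ (res Θ x))
    (hd : DenseRange ι) {A B : Set ℕ} (hAB : ∀ q, q ∈ A → q ∉ B) (x : X) :
    proj ι (A ∪ B) x = proj ι A x + proj ι B x := by
  refine hd.induction_on (p := fun x => proj ι (A ∪ B) x = proj ι A x + proj ι B x) x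
    (isClosed_eq (by fun_prop) (by fun_prop)) fun x => ?_
  simp only [proj_iota hι hd]
  rw [← map_add]
  congr 1
  classical
  ext q
  simp only [Finsupp.add_apply, res_apply, Set.mem_union]
  by_cases hA : q ∈ A
  · simp [hA, hAB q hA]
  · simp [hA]

theorem proj_empty {ι : (ℕ →₀ ℝ) →ₗ[ℝ] X} (hι : ∀ x, ‖ι x‖ = gL R Θ (res Θ x))
    (hd : DenseRange ι) {A : Set ℕ} (hA : ∀ q ∈ A, q ∉ Θ) (x : X) : proj ι A x = 0 := by
  refine hd.induction_on (p := fun x => proj ι A x = 0) x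
    (isClosed_eq (by fun_prop) (by fun_prop)) fun x => ?_
  rw [proj_iota hι hd, ← norm_eq_zero, hι, res_res, res_eq_zero, gL_zero]
  rintro q - ⟨h1, h2⟩
  exact hA q h2 h1

theorem proj_univ {ι : (ℕ →₀ ℝ) →ₗ[ℝ] X} (hι : ∀ x, ‖ι x‖ = gL R Θ (res Θ x))
    (hd : DenseRange ι) (x : X) : proj ι Set.univ x = x := by
  refine hd.induction_on (p := fun x => proj ι Set.univ x = x) x
    (isClosed_eq (by fun_prop) (by fun_prop)) fun x => ?_
  rw [proj_iota hι hd, res_eq_self]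
  simp

/-- Projections on single coordinates have rank at most one. -/
theorem proj_singleton {ι : (ℕ →₀ ℝ) →ₗ[ℝ] X} (hι : ∀ x, ‖ι x‖ = gL R Θ (res Θ x))
    (hd : DenseRange ι) (q : ℕ) : ∃ φ : X →ₗ[ℝ] ℝ, ∀ x, φ x = 0 → proj ι {q} x = 0 := by
  classical
  have hmem : ∀ x, proj ι {q} x ∈ Submodule.span ℝ {ι (Finsupp.single q 1)} := by
    intro x
    refine hd.induction_on (p := fun x => proj ι {q} x ∈ Submodule.span ℝ {ι (Finsupp.single q 1)}) x
      ?_ fun x => ?_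
    · have : IsClosed ((Submodule.span ℝ {ι (Finsupp.single q 1)} : Submodule ℝ X) : Set X) :=
        Submodule.closed_of_finiteDimensional _
      exact this.preimage (by fun_prop)
    · rw [proj_iota hι hd, res_singleton]
      refine Submodule.mem_span_singleton.2 ⟨x q, ?_⟩
      rw [← map_smul]
      simp
  by_cases h0 : ι (Finsupp.single q 1) = 0
  · refine ⟨0, fun x _ => ?_⟩
    have := hmem x
    rw [h0] at this
    simpa using this
  · let e := LinearEquiv.toSpanNonzeroSingleton ℝ X _ h0
    refine ⟨e.symm.toLinearMap ∘ₗ (proj ι {q}).toLinearMap.codRestrict _ hmem, fun x hx => ?_⟩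
    have : (proj ι {q}).toLinearMap.codRestrict _ hmem x = 0 := by
      simpa using hx
    exact congrArg Subtype.val this

end
end PTS

namespace PTS
open Finset

section
variable {X : Type*} [NormedAddCommGroup X] [NormedSpace ℝ X]

theorem infdim_ker (Y : Submodule ℝ X) (hY : ¬ FiniteDimensional ℝ Y) (φ : X →ₗ[ℝ] ℝ) :
    ¬ FiniteDimensional ℝ ↥(Y ⊓ LinearMap.ker φ) := by
  intro h
  apply hY
  have h2 : (Y ⊓ LinearMap.ker φ).FG := Module.Finite.iff_fg.1 h
  have h1 : (Y.map φ).FG := Module.Finite.iff_fg.1 inferInstance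
  exact Module.Finite.iff_fg.2 (Submodule.fg_of_fg_map_of_fg_inf_ker φ h1 h2)

theorem infdim_kers (Y : Submodule ℝ X) (hY : ¬ FiniteDimensional ℝ Y)
    (S : Finset (X →ₗ[ℝ] ℝ)) : ∃ Y' ≤ Y, ¬ FiniteDimensional ℝ Y' ∧
      ∀ y ∈ Y', ∀ φ ∈ S, φ y = 0 := by
  classical
  induction S using Finset.induction_on with
  | empty => exact ⟨Y, le_rfl, hY, fun _ _ _ h => absurd h (Finset.notMem_empty _)⟩
  | insert φ S _ ih =>
    obtain ⟨Y', hle, hinf, h⟩ := ih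
    refine ⟨Y' ⊓ LinearMap.ker φ, inf_le_left.trans hle, infdim_ker Y' hinf φ, fun y hy ψ hψ => ?_⟩
    rcases Finset.mem_insert.1 hψ with rfl | hψ
    · exact LinearMap.mem_ker.1 hy.2
    · exact h y hy.1 ψ hψ

theorem exists_unit (Y : Submodule ℝ X) (hY : ¬ FiniteDimensional ℝ Y) : ∃ y ∈ Y, y ≠ 0 := by
  by_contra hcon
  push Not at hcon
  have : Y = ⊥ := by
    rw [eq_bot_iff]; intro y hy; simpa using hcon y hy
  apply hY
  rw [this]; infer_instance

/-- Biorthogonal-type coefficient bound. -/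
theorem coeff_bound (y : ℕ → X) (φ : ℕ → X →L[ℝ] ℝ) (hφ : ∀ k, ‖φ k‖ ≤ 1) (hy : ∀ k, ‖y k‖ = 1)
    (h1 : ∀ k, φ k (y k) = 1) (h0 : ∀ i j, i < j → φ i (y j) = 0) (n : ℕ) (a : ℕ → ℝ) (k : ℕ)
    (hk : k < n) : |a k| ≤ 2 ^ k * ‖∑ i ∈ range n, a i • y i‖ := by
  set x := ∑ i ∈ range n, a i • y i with hx
  induction k using Nat.strong_induction_on with
  | _ k ih =>
    have e1 : φ k x = a k + ∑ i ∈ range k, a i * φ k (y i) := by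
      rw [hx, map_sum]
      simp only [map_smul, smul_eq_mul]
      have hsub : range (k + 1) ⊆ range n := by
        intro i; simp only [mem_range]; omega
      rw [← Finset.sum_subset hsub, Finset.sum_range_succ, h1, mul_one, add_comm]
      intro i _ hi
      rw [h0 k i (by simp only [mem_range] at hi; omega), mul_zero]
    have e2 : |φ k x| ≤ ‖x‖ := by
      have := (φ k).le_opNorm x
      rw [Real.norm_eq_abs] at this
      exact this.trans (mul_le_of_le_one_left (norm_nonneg _) (hφ k))
    have e3 : |∑ i ∈ range k, a i * φ k (y i)| ≤ ∑ i ∈ range k, 2 ^ i * ‖x‖ := by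
      refine (Finset.abs_sum_le_sum_abs _ _).trans (Finset.sum_le_sum fun i hi => ?_)
      have hi := mem_range.1 hi
      rw [abs_mul]
      have : |φ k (y i)| ≤ 1 := by
        have h := (φ k).le_opNorm (y i)
        rw [Real.norm_eq_abs, hy, mul_one] at h
        exact h.trans (hφ k)
      exact (mul_le_of_le_one_right (abs_nonneg _) this).trans (ih i hi (by omega))
    rw [← Finset.sum_mul, geom_sum_eq (by norm_num)] at e3
    have e4 : a k = φ k x - ∑ i ∈ range k, a i * φ k (y i) := by rw [e1]; ring
    rw [e4]
    refine (abs_sub _ _).trans ?_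
    have : (2 : ℝ) - 1 = 1 := by norm_num
    rw [this, div_one] at e3
    linarith

theorem ss_lemma (A : X →L[ℝ] X) (Y : Submodule ℝ X) (hY : ¬ FiniteDimensional ℝ Y)
    (hA : ∀ Y' ≤ Y, ¬ FiniteDimensional ℝ Y' → ∀ c > 0, ∃ y ∈ Y', ‖A y‖ < c * ‖y‖)
    (ε : ℝ) (hε : 0 < ε) :
    ∃ Y' ≤ Y, ¬ FiniteDimensional ℝ Y' ∧ ∀ y ∈ Y', ‖A y‖ ≤ ε * ‖y‖ := by
  classical
  obtain ⟨f, hf, hfr⟩ := exists_seq_of_forall_finset_exists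
    (fun b : ℕ × X × (X →L[ℝ] ℝ) => b.2.1 ∈ Y ∧ ‖b.2.1‖ = 1 ∧ b.2.2 b.2.1 = 1 ∧ ‖b.2.2‖ ≤ 1 ∧
      ‖A b.2.1‖ ≤ ε * (1 / 4) ^ (b.1 + 1))
    (fun b b' => b.1 < b'.1 ∧ b.2.2 b'.2.1 = 0) (by
      intro s _
      obtain ⟨Y', hle, hinf, hker⟩ := infdim_kers Y hY
        (s.image fun b => (b.2.2 : X →ₗ[ℝ] ℝ))
      set k := s.sup (fun b => b.1) + 1 with hk
      obtain ⟨y, hy, hAy⟩ := hA Y' hle hinf (ε * (1 / 4) ^ (k + 1)) (by positivity)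
      have hy0 : y ≠ 0 := by
        rintro rfl
        simp at hAy
      have hn : 0 < ‖y‖ := norm_pos_iff.2 hy0
      have hunit : ‖(‖y‖⁻¹ • y)‖ = 1 := by
        rw [norm_smul, norm_inv, norm_norm, inv_mul_cancel₀ hn.ne']
      obtain ⟨g, hg1, hg2⟩ := exists_dual_vector ℝ (‖y‖⁻¹ • y) (by rw [← norm_ne_zero_iff, hunit]; norm_num)
      refine ⟨(k, ‖y‖⁻¹ • y, g), ⟨hle (Y'.smul_mem _ hy), hunit, ?_, hg1.le, ?_⟩, ?_⟩
      · rw [hg2, hunit]; simp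
      · dsimp only
        rw [map_smul, norm_smul, norm_inv, norm_norm, inv_mul_le_iff₀ hn]
        linarith
      · intro b hb
        refine ⟨?_, ?_⟩
        · have := Finset.le_sup (f := fun b : ℕ × X × (X →L[ℝ] ℝ) => b.1) hb
          simp only [hk]; omega
        · have := hker y hy _ (Finset.mem_image.2 ⟨b, hb, rfl⟩)
          dsimp only
          rw [map_smul]
          have h' : b.2.2 y = 0 := this
          rw [h', smul_zero])
  have hmono : StrictMono fun k => (f k).1 := fun i j h => (hfr i j h).1
  set y : ℕ → X := fun k => (f k).2.1
  set φ : ℕ → X →L[ℝ] ℝ := fun k => (f k).2.2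
  have hb : ∀ (n : ℕ) (a : ℕ → ℝ) (k : ℕ), k < n → |a k| ≤ 2 ^ k * ‖∑ i ∈ range n, a i • y i‖ := fun n a k hk =>
    coeff_bound y φ (fun k => (hf k).2.2.2.1) (fun k => (hf k).2.1) (fun k => (hf k).2.2.1)
      (fun i j h => (hfr i j h).2) n a k hk
  have hAy : ∀ k, ‖A (y k)‖ ≤ ε * (1 / 4) ^ (k + 1) := by
    intro k
    refine (hf k).2.2.2.2.trans (mul_le_mul_of_nonneg_left ?_ hε.le)
    apply pow_le_pow_of_le_one (by norm_num) (by norm_num)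
    have := hmono.le_apply (x := k)
    omega
  have hli : LinearIndependent ℝ y := by
    rw [linearIndependent_iff']
    intro s g hg i hi
    obtain ⟨n, hn⟩ := s.exists_nat_subset_range
    have h := hb n (fun j => if j ∈ s then g j else 0) i (mem_range.1 (hn hi))
    have h0 : ∑ j ∈ range n, (if j ∈ s then g j else 0) • y j = 0 := by
      rw [← hg, ← Finset.sum_subset hn]
      · exact Finset.sum_congr rfl fun j hj => by rw [if_pos hj]
      · intro j _ hj; rw [if_neg hj, zero_smul]
    rw [h0, norm_zero, mul_zero, if_pos hi] at h
    exact abs_eq_zero.1 (le_antisymm h (abs_nonneg _))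
  refine ⟨Submodule.span ℝ (Set.range y), ?_, ?_, ?_⟩
  · rw [Submodule.span_le]
    rintro _ ⟨k, rfl⟩
    exact (hf k).1
  · intro hfd
    have h := (linearIndependent_span hli)
    have : Finite ℕ := h.finite
    exact not_finite ℕ
  · intro x hx
    obtain ⟨c, rfl⟩ := (Finsupp.mem_span_range_iff_exists_finsupp).1 hx
    obtain ⟨n, hn⟩ := c.support.exists_nat_subset_range
    have e : (c.sum fun i a => a • y i) = ∑ i ∈ range n, c i • y i :=
      Finsupp.sum_of_support_subset _ hn _ (by simp)
    rw [e, map_sum]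
    refine (norm_sum_le _ _).trans ?_
    have : ∀ i ∈ range n, ‖A (c i • y i)‖ ≤
        (ε * ‖∑ i ∈ range n, c i • y i‖ / 4) * (1 / 2) ^ i := by
      intro i hi
      rw [map_smul, norm_smul, Real.norm_eq_abs]
      refine (mul_le_mul (hb n c i (mem_range.1 hi)) (hAy i) (norm_nonneg _) (by positivity)).trans ?_
      apply le_of_eq
      have : (1 / 4 : ℝ) ^ i = (1 / 2) ^ i * (1 / 2) ^ i := by rw [← mul_pow]; norm_num
      have h2 : (2 : ℝ) ^ i * (1 / 2) ^ i = 1 := by rw [← mul_pow]; norm_num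
      rw [pow_succ, this]
      linear_combination (ε * (1 / 2) ^ i * (1 / 4) * ‖∑ i ∈ range n, c i • y i‖) * h2
    refine (Finset.sum_le_sum this).trans ?_
    rw [← Finset.mul_sum]
    have hg : ∑ i ∈ range n, (1 / 2 : ℝ) ^ i ≤ 2 := by
      rw [geom_sum_eq (by norm_num)]
      have : (0 : ℝ) < (1 / 2) ^ n := by positivity
      rw [div_le_iff_of_neg (by norm_num)]
      linarith
    have h0 : 0 ≤ ε * ‖∑ i ∈ range n, c i • y i‖ := by positivity
    nlinarith

end

end PTS

namespace PTS
open Finset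

section
variable {X : Type*} [NormedAddCommGroup X] [NormedSpace ℝ X] [CompleteSpace X]
  {R : ℕ → ℕ → Prop} {Θ : Set ℕ}

/-- A set of coordinates which can be neglected on subspaces of `Y`. -/
def Negl (ι : (ℕ →₀ ℝ) →ₗ[ℝ] X) (Y : Submodule ℝ X) (A : Set ℕ) : Prop :=
  ∀ Y' ≤ Y, ¬ FiniteDimensional ℝ Y' → ∀ ε > 0,
    ∃ Y'' ≤ Y', ¬ FiniteDimensional ℝ Y'' ∧ ∀ y ∈ Y'', ‖proj ι A y‖ ≤ ε * ‖y‖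

theorem negl_singleton {ι : (ℕ →₀ ℝ) →ₗ[ℝ] X} (hι : ∀ x, ‖ι x‖ = gL R Θ (res Θ x))
    (hd : DenseRange ι) (Y : Submodule ℝ X) (q : ℕ) : Negl ι Y {q} := by
  intro Y' _ hinf ε hε
  obtain ⟨φ, hφ⟩ := proj_singleton hι hd q
  refine ⟨Y' ⊓ LinearMap.ker φ, inf_le_left, infdim_ker Y' hinf φ, fun y hy => ?_⟩
  rw [hφ y (LinearMap.mem_ker.1 hy.2), norm_zero]
  positivity

theorem negl_finset {ι : (ℕ →₀ ℝ) →ₗ[ℝ] X} {Y : Submodule ℝ X} (𝒜 : Finset (Set ℕ))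
    (h : ∀ A ∈ 𝒜, Negl ι Y A) : ∀ Y' ≤ Y, ¬ FiniteDimensional ℝ Y' → ∀ ε > 0,
    ∃ Y'' ≤ Y', ¬ FiniteDimensional ℝ Y'' ∧ ∀ A ∈ 𝒜, ∀ y ∈ Y'', ‖proj ι A y‖ ≤ ε * ‖y‖ := by
  classical
  induction 𝒜 using Finset.induction_on with
  | empty => exact fun Y' _ hinf ε _ => ⟨Y', le_rfl, hinf, fun A hA => absurd hA (Finset.notMem_empty _)⟩
  | insert A 𝒜 _ ih =>
    intro Y' hle hinf ε hε
    obtain ⟨Y1, hle1, hinf1, h1⟩ := ih (fun B hB => h B (Finset.mem_insert_of_mem hB)) Y' hle hinf ε hε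
    obtain ⟨Y2, hle2, hinf2, h2⟩ := h A (Finset.mem_insert_self _ _) Y1 (hle1.trans hle) hinf1 ε hε
    refine ⟨Y2, hle2.trans hle1, hinf2, fun B hB y hy => ?_⟩
    rcases Finset.mem_insert.1 hB with rfl | hB
    · exact h2 y hy
    · exact h1 B hB y (hle2 hy)

theorem proj_diff_le {ι : (ℕ →₀ ℝ) →ₗ[ℝ] X} (hι : ∀ x, ‖ι x‖ = gL R Θ (res Θ x))
    (hd : DenseRange ι) (S : Set ℕ) (𝒜 : Finset (Set ℕ)) (y : X) :
    ‖proj ι S y - proj ι {q | q ∈ S ∧ ∀ A ∈ 𝒜, q ∉ A} y‖ ≤ ∑ A ∈ 𝒜, ‖proj ι A y‖ := by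
  classical
  induction 𝒜 using Finset.induction_on with
  | empty => simp
  | insert A 𝒜 hA ih =>
    set B : Set ℕ := {q | q ∈ S ∧ ∀ A ∈ 𝒜, q ∉ A} with hB
    set B' : Set ℕ := {q | q ∈ S ∧ ∀ A' ∈ insert A 𝒜, q ∉ A'} with hB'
    have h1 : B = B' ∪ (B ∩ A) := by
      ext q
      simp only [hB, hB', Set.mem_union, Set.mem_inter_iff, Set.mem_ofPred_eq, Finset.forall_mem_insert]
      tauto
    have h2 : proj ι B y = proj ι B' y + proj ι (B ∩ A) y := by
      conv_lhs => rw [h1]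
      apply proj_add hι hd
      intro q hq hq'
      exact hq.2 A (Finset.mem_insert_self _ _) hq'.2
    have h3 : ‖proj ι (B ∩ A) y‖ ≤ ‖proj ι A y‖ := by
      rw [← proj_proj hι hd]
      exact proj_le hι hd _ _
    rw [Finset.sum_insert hA]
    calc ‖proj ι S y - proj ι B' y‖ = ‖proj ι (B ∩ A) y + (proj ι S y - proj ι B y)‖ := by
          rw [h2]; congr 1; abel
      _ ≤ _ := (norm_add_le _ _).trans (add_le_add h3 ih)

theorem selection {ι : (ℕ →₀ ℝ) →ₗ[ℝ] X} (hι : ∀ x, ‖ι x‖ = gL R Θ (res Θ x))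
    (hd : DenseRange ι) (Y : Submodule ℝ X) (hY : ¬ FiniteDimensional ℝ Y) (S A0 : Set ℕ)
    (hA0 : Negl ι Y A0)
    (hneg : ∀ q ∈ S, q ∉ A0 → ∃ A, Negl ι Y A ∧ ∀ q' ∈ S, q' ∉ A0 → q' ∉ A → R q q' ∧ R q' q)
    (W : X → Finset (X →ₗ[ℝ] ℝ)) (δ : ℕ → ℝ) (hδ : ∀ k, 0 < δ k) (hδa : Antitone δ) :
    ∃ (y : ℕ → X) (z : ℕ → ℕ →₀ ℝ) (p r : ℕ → ℕ),
      (∀ k, y k ∈ Y ∧ ‖y k‖ = 1 ∧ ‖proj ι S (y k) - ι (z k)‖ ≤ δ k ∧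
        ∀ q, z k q ≠ 0 → q ∈ Θ ∧ p k ≤ q ∧ q ≤ r k) ∧
      (∀ i j, i < j → p i < p j ∧ 3 * r i ≤ p j ∧ r i < p j ∧ p i * p i ≤ p j ∧
        (∀ φ ∈ W (y i), φ (y j) = 0) ∧
        ∀ a b, z i a ≠ 0 → z j b ≠ 0 → R a b ∧ R b a) := by
  classical
  choose! AA hAA1 hAA2 using hneg
  obtain ⟨f, hf, hfr⟩ := exists_seq_of_forall_finset_exists
    (fun b : ℕ × X × (ℕ →₀ ℝ) × ℕ × ℕ => b.2.1 ∈ Y ∧ ‖b.2.1‖ = 1 ∧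
      ‖proj ι S b.2.1 - ι b.2.2.1‖ ≤ δ b.1 ∧
      ∀ q, b.2.2.1 q ≠ 0 → (q ∈ S ∧ q ∉ A0) ∧ q ∈ Θ ∧ b.2.2.2.1 ≤ q ∧ q ≤ b.2.2.2.2)
    (fun b b' => b.1 < b'.1 ∧ b.2.2.2.1 < b'.2.2.2.1 ∧ 3 * b.2.2.2.2 ≤ b'.2.2.2.1 ∧
      b.2.2.2.2 < b'.2.2.2.1 ∧ b.2.2.2.1 * b.2.2.2.1 ≤ b'.2.2.2.1 ∧
      (∀ φ ∈ W b.2.1, φ b'.2.1 = 0) ∧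
      ∀ q q', b.2.2.1 q ≠ 0 → b'.2.2.1 q' ≠ 0 → R q q' ∧ R q' q) (by
    intro s hs
    set k := s.sup (fun b => b.1) + 1 with hk
    set p := s.sup (fun b => b.2.2.2.1 + 3 * b.2.2.2.2 + b.2.2.2.1 * b.2.2.2.1) + 1 with hp
    set 𝒜 : Finset (Set ℕ) := insert A0 (((range p).image fun q => ({q} : Set ℕ)) ∪
      (s.biUnion fun b => b.2.2.1.support).image AA) with h𝒜
    have hN : ∀ A ∈ 𝒜, Negl ι Y A := by
      intro A hA
      rw [h𝒜, Finset.mem_insert, Finset.mem_union, Finset.mem_image, Finset.mem_image] at hA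
      rcases hA with rfl | ⟨q, _, rfl⟩ | ⟨q, hq, rfl⟩
      · exact hA0
      · exact negl_singleton hι hd Y q
      · obtain ⟨b, hb, hq⟩ := Finset.mem_biUnion.1 hq
        have h := ((hs b hb).2.2.2 q (Finsupp.mem_support_iff.1 hq)).1
        exact hAA1 q h.1 h.2
    obtain ⟨Y1, hle1, hinf1, hker⟩ := infdim_kers Y hY (s.biUnion fun b => W b.2.1)
    set ε := δ k / (2 * (𝒜.card + 1)) with hε
    have hε0 : 0 < ε := by have := hδ k; positivity
    obtain ⟨Y2, hle2, hinf2, hsm⟩ := negl_finset 𝒜 hN Y1 hle1 hinf1 ε hε0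
    obtain ⟨y0, hy0, hne⟩ := exists_unit Y2 hinf2
    have hn : 0 < ‖y0‖ := norm_pos_iff.2 hne
    set y := ‖y0‖⁻¹ • y0 with hy
    have hunit : ‖y‖ = 1 := by
      rw [hy, norm_smul, norm_inv, norm_norm, inv_mul_cancel₀ hn.ne']
    have hyY : y ∈ Y2 := Y2.smul_mem _ hy0
    obtain ⟨x, hx⟩ := hd.exists_dist_lt y (show 0 < δ k / 2 by have := hδ k; positivity)
    rw [dist_eq_norm] at hx
    set B : Set ℕ := {q | q ∈ S ∧ ∀ A ∈ 𝒜, q ∉ A} with hB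
    set z := res Θ (res B x) with hz
    have hιz : ι z = ι (res B x) := by
      rw [← sub_eq_zero, ← map_sub, ← norm_eq_zero, hι, map_sub, hz, res_res, Set.inter_self, sub_self,
        gL_zero]
    have hzq : ∀ q, z q ≠ 0 → q ∈ Θ ∧ q ∈ B := by
      intro q hq
      have h1 : q ∈ Θ := by
        by_contra hcon; exact hq (res_not_mem _ hcon)
      refine ⟨h1, ?_⟩
      by_contra hcon
      rw [hz, res_mem _ h1] at hq
      exact hq (res_not_mem _ hcon)
    refine ⟨(k, y, z, p, z.support.sup id), ⟨hle1 (hle2 hyY), hunit, ?_, ?_⟩, ?_⟩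
    · dsimp only
      have h1 := proj_diff_le hι hd S 𝒜 y
      have h2 : ∑ A ∈ 𝒜, ‖proj ι A y‖ ≤ δ k / 2 := by
        calc ∑ A ∈ 𝒜, ‖proj ι A y‖ ≤ ∑ A ∈ 𝒜, ε := Finset.sum_le_sum fun A hA => by
              have := hsm A hA y hyY
              rwa [hunit, mul_one] at this
          _ = 𝒜.card * ε := by rw [Finset.sum_const, nsmul_eq_mul]
          _ ≤ δ k / 2 := by
              rw [hε, ← mul_div_assoc, div_le_div_iff₀ (by positivity) (by norm_num)]
              have := hδ k
              nlinarith
      have h3 : ‖proj ι B y - ι z‖ ≤ δ k / 2 := by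
        rw [hιz, ← proj_iota hι hd, ← map_sub]
        exact (proj_le hι hd _ _).trans hx.le
      calc ‖proj ι S y - ι z‖ ≤ ‖proj ι S y - proj ι B y‖ + ‖proj ι B y - ι z‖ :=
            norm_sub_le_norm_sub_add_norm_sub _ _ _
        _ ≤ δ k := by linarith [h1.trans h2]
    · intro q hq
      obtain ⟨h1, h2⟩ := hzq q hq
      refine ⟨⟨h2.1, h2.2 A0 (Finset.mem_insert_self _ _)⟩, h1, ?_, ?_⟩
      · dsimp only
        by_contra hcon
        push Not at hcon
        refine h2.2 {q} (Finset.mem_insert_of_mem (Finset.mem_union_left _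
          (Finset.mem_image.2 ⟨q, mem_range.2 hcon, rfl⟩))) rfl
      · exact Finset.le_sup (f := id) (Finsupp.mem_support_iff.2 hq)
    · intro b hb
      have h1 := Finset.le_sup (f := fun b : ℕ × X × (ℕ →₀ ℝ) × ℕ × ℕ => b.1) hb
      have h2 := Finset.le_sup (f := fun b : ℕ × X × (ℕ →₀ ℝ) × ℕ × ℕ =>
        b.2.2.2.1 + 3 * b.2.2.2.2 + b.2.2.2.1 * b.2.2.2.1) hb
      dsimp only at h1 h2 ⊢
      refine ⟨by omega, by omega, by omega, by omega, by omega, ?_, ?_⟩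
      · intro φ hφ
        exact hker y (hle2 hyY) φ (Finset.mem_biUnion.2 ⟨b, hb, hφ⟩)
      · intro q q' hq hq'
        obtain ⟨h3, h4⟩ := hzq q' hq'
        have h := ((hs b hb).2.2.2 q hq).1
        refine hAA2 q h.1 h.2 q' h4.1 (h4.2 A0 (Finset.mem_insert_self _ _)) (h4.2 _ ?_)
        exact Finset.mem_insert_of_mem (Finset.mem_union_right _
          (Finset.mem_image.2 ⟨q, Finset.mem_biUnion.2 ⟨b, hb, Finsupp.mem_support_iff.2 hq⟩, rfl⟩)))
  have hmono : StrictMono fun k => (f k).1 := fun i j h => (hfr i j h).1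
  refine ⟨fun k => (f k).2.1, fun k => (f k).2.2.1, fun k => (f k).2.2.2.1, fun k => (f k).2.2.2.2,
    fun k => ⟨(hf k).1, (hf k).2.1, (hf k).2.2.1.trans (hδa hmono.le_apply), fun q hq =>
      ((hf k).2.2.2 q hq).2⟩, fun i j hij => (hfr i j hij).2⟩

end
end PTS

namespace PTS
open Finset

section
variable {X : Type*} [NormedAddCommGroup X] [NormedSpace ℝ X] [CompleteSpace X]
  {R : ℕ → ℕ → Prop} {Θ : Set ℕ}

theorem sum_half_pow_le (δ : ℝ) (hδ : 0 ≤ δ) (J : Finset ℕ) :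
    ∑ k ∈ J, δ * (1 / 2) ^ (k + 1) ≤ δ := by
  obtain ⟨n, hn⟩ := J.exists_nat_subset_range
  refine (Finset.sum_le_sum_of_subset_of_nonneg hn fun _ _ _ => by positivity).trans ?_
  have : ∀ k, δ * (1 / 2 : ℝ) ^ (k + 1) = (δ / 2) * (1 / 2) ^ k := by intro k; ring
  simp only [this]
  rw [← Finset.mul_sum, geom_sum_eq (by norm_num)]
  have h : (0 : ℝ) < (1 / 2) ^ n := by positivity
  have h2 : ((1 / 2 : ℝ) ^ n - 1) / (1 / 2 - 1) ≤ 2 := by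
    rw [div_le_iff_of_neg (by norm_num)]
    linarith
  nlinarith

theorem estimate {ι : (ℕ →₀ ℝ) →ₗ[ℝ] X} (hι : ∀ x, ‖ι x‖ = gL R Θ (res Θ x))
    (hd : DenseRange ι) (Y : Submodule ℝ X) (hY : ¬ FiniteDimensional ℝ Y) (S A0 : Set ℕ)
    (hA0 : Negl ι Y A0)
    (hneg : ∀ q ∈ S, q ∉ A0 → ∃ A, Negl ι Y A ∧ ∀ q' ∈ S, q' ∉ A0 → q' ∉ A → R q q' ∧ R q' q)
    {c : ℝ} (hc : 0 < c) (hlow : ∀ y ∈ Y, c * ‖y‖ ≤ ‖proj ι S y‖)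
    (W : X → Finset (X →ₗ[ℝ] ℝ)) :
    ∃ (y : ℕ → X) (p : ℕ → ℕ) (C : ℝ), 0 < C ∧ (∀ k, y k ∈ Y ∧ ‖y k‖ = 1) ∧ StrictMono p ∧
      (∀ i j, i < j → p i * p i ≤ p j) ∧ (∀ i j, i < j → ∀ φ ∈ W (y i), φ (y j) = 0) ∧
      ∀ (J : Finset ℕ) (a : ℕ → ℝ), tL (vec p J a) ≤ C * ‖∑ j ∈ J, a j • y j‖ ∧
        ‖∑ j ∈ J, a j • y j‖ ≤ C * tL (vec p J a) := by
  have hδa : Antitone fun k : ℕ => c / 4 * (1 / 2 : ℝ) ^ (k + 1) := by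
    intro i j hij
    refine mul_le_mul_of_nonneg_left ?_ (by positivity)
    exact pow_le_pow_of_le_one (by norm_num) (by norm_num) (by omega)
  obtain ⟨y, z, p, r, h1, h2⟩ := selection hι hd Y hY S A0 hA0 hneg W
    (fun k => c / 4 * (1 / 2) ^ (k + 1)) (fun k => by positivity) hδa
  have hp : StrictMono p := fun i j h => (h2 i j h).1
  have hδ1 : ∀ k : ℕ, c / 4 * (1 / 2 : ℝ) ^ (k + 1) ≤ c / 4 := fun k =>
    mul_le_of_le_one_right (by positivity) (pow_le_one₀ (by norm_num) (by norm_num))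
  have hιz : ∀ J (a : ℕ → ℝ), ‖∑ j ∈ J, a j • ι (z j)‖ = gL R Θ (∑ j ∈ J, a j • z j) := by
    intro J a
    have : ∑ j ∈ J, a j • ι (z j) = ι (∑ j ∈ J, a j • z j) := by simp only [map_sum, map_smul]
    rw [this, hι, res_eq_self]
    intro q hq
    obtain ⟨j, _, hj⟩ := block_ne hq
    exact ((h1 j).2.2.2 q hj).1
  have hιz1 : ∀ j, ‖ι (z j)‖ = gL R Θ (z j) := by
    intro j
    have := hιz {j} (fun _ => 1)
    simpa using this
  have hord : ∀ i j, i < j → ∀ a b, z i a ≠ 0 → z j b ≠ 0 → a < b := by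
    intro i j hij a b ha hb
    exact ((h1 i).2.2.2 a ha).2.2.trans_lt ((h2 i j hij).2.2.1.trans_le ((h1 j).2.2.2 b hb).2.1)
  have hc1 : c ≤ 1 := by
    have h := hlow (y 0) (h1 0).1
    have h' := proj_le hι hd S (y 0)
    rw [(h1 0).2.1] at h h'
    linarith
  have hz1 : ∀ j, c / 2 ≤ gL R Θ (z j) := by
    intro j
    rw [← hιz1]
    have e1 := hlow (y j) (h1 j).1
    rw [(h1 j).2.1, mul_one] at e1
    have e2 := (h1 j).2.2.1.trans (hδ1 j)
    have e3 : ‖proj ι S (y j)‖ ≤ ‖proj ι S (y j) - ι (z j)‖ + ‖ι (z j)‖ := by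
      have := norm_add_le (proj ι S (y j) - ι (z j)) (ι (z j))
      rwa [sub_add_cancel] at this
    linarith
  have hz2 : ∀ j, gL R Θ (z j) ≤ 2 := by
    intro j
    rw [← hιz1]
    have e1 := proj_le hι hd S (y j)
    rw [(h1 j).2.1] at e1
    have e2 := (h1 j).2.2.1.trans (hδ1 j)
    have e3 : ‖ι (z j)‖ ≤ ‖proj ι S (y j) - ι (z j)‖ + ‖proj ι S (y j)‖ := by
      have := norm_sub_le (proj ι S (y j)) (proj ι S (y j) - ι (z j))
      rw [sub_sub_cancel] at this
      linarith
    linarith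
  have hpert : ∀ (J : Finset ℕ) (a : ℕ → ℝ),
      ‖proj ι S (∑ j ∈ J, a j • y j) - ∑ j ∈ J, a j • ι (z j)‖ ≤ c / 4 * tL (vec p J a) := by
    intro J a
    rw [map_sum, ← Finset.sum_sub_distrib]
    refine (norm_sum_le _ _).trans ?_
    have : ∀ j ∈ J, ‖proj ι S (a j • y j) - a j • ι (z j)‖ ≤
        tL (vec p J a) * (c / 4 * (1 / 2) ^ (j + 1)) := by
      intro j hj
      rw [map_smul, ← smul_sub, norm_smul, Real.norm_eq_abs]
      exact mul_le_mul (abs_le_tL_vec hp.injective hj) (h1 j).2.2.1 (norm_nonneg _) (gL_nonneg _)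
    refine (Finset.sum_le_sum this).trans ?_
    rw [← Finset.mul_sum, mul_comm]
    exact mul_le_mul_of_nonneg_right (sum_half_pow_le _ (by positivity) J) (gL_nonneg _)
  refine ⟨y, p, 9 / c, by positivity, fun k => ⟨(h1 k).1, (h1 k).2.1⟩, hp,
    fun i j h => (h2 i j h).2.2.2.1, fun i j h => (h2 i j h).2.2.2.2.1, fun J a => ?_⟩
  have hT : 0 ≤ tL (vec p J a) := gL_nonneg _
  have hmem : ∑ j ∈ J, a j • y j ∈ Y := Y.sum_mem fun j _ => Y.smul_mem _ (h1 j).1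
  have hp1 := hpert J a
  have hR : ∀ i j, i ≠ j → ∀ a b, z i a ≠ 0 → z j b ≠ 0 → R a b := by
    intro i j hij a b ha hb
    rcases lt_or_gt_of_ne hij with h | h
    · exact ((h2 i j h).2.2.2.2.2 a b ha hb).1
    · exact ((h2 j i h).2.2.2.2.2 b a hb ha).2
  have hl := lower_est_lim (R := R) (Θ := Θ) z p hp (half_pos hc) hz1
    (fun j q hq => ((h1 j).2.2.2 q hq).1) hord hR (fun j q hq => ((h1 j).2.2.2 q hq).2.1) J a
  have hu := upper_est_lim (R := R) (Θ := Θ) p r hp (fun i j h => (h2 i j h).2.1) a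
    (fun j => (1 / 2 : ℝ) • z j) (fun j => by
      rw [gL_smul, abs_of_pos (by norm_num)]
      linarith [hz2 j])
    (fun j q hq => by
      have : z j q ≠ 0 := by
        intro h; apply hq; simp [h]
      exact ((h1 j).2.2.2 q this).2)
    (fun i j hij a b ha hb => by
      refine hord i j hij a b ?_ ?_
      · intro h; apply ha; simp [h]
      · intro h; apply hb; simp [h]) J
  have hu' : gL R Θ (∑ j ∈ J, a j • (1 / 2 : ℝ) • z j) = 1 / 2 * gL R Θ (∑ j ∈ J, a j • z j) := by
    have : ∑ j ∈ J, a j • (1 / 2 : ℝ) • z j = (1 / 2 : ℝ) • ∑ j ∈ J, a j • z j := by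
      rw [Finset.smul_sum]
      exact Finset.sum_congr rfl fun j _ => smul_comm _ _ _
    rw [this, gL_smul, abs_of_pos (by norm_num)]
  rw [hu'] at hu
  rw [← hιz] at hl hu
  set x := ∑ j ∈ J, a j • y j
  set v := ∑ j ∈ J, a j • ι (z j)
  have e1 : ‖v‖ ≤ ‖proj ι S x - v‖ + ‖proj ι S x‖ := by
    have := norm_sub_le (proj ι S x) (proj ι S x - v)
    rw [sub_sub_cancel] at this
    linarith
  have e2 : ‖proj ι S x‖ ≤ ‖proj ι S x - v‖ + ‖v‖ := by
    have := norm_add_le (proj ι S x - v) v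
    rwa [sub_add_cancel] at this
  have e3 := proj_le hι hd S x
  have e4 := hlow x hmem
  constructor
  · rw [div_mul_eq_mul_div, le_div_iff₀ hc]
    nlinarith [norm_nonneg x]
  · rw [div_mul_eq_mul_div, le_div_iff₀ hc]
    nlinarith

end

/-- Coordinates of the subtree above `s`. -/
def Sub (σ : ℕ ≃ List ℕ) (s : List ℕ) : Set ℕ := {q | s <+: σ q}

section
variable {X : Type*} [NormedAddCommGroup X] [NormedSpace ℝ X] [CompleteSpace X]

/-- The projection onto the subtree above `s` is an isomorphism on `Y`. -/
def Good (ι : (ℕ →₀ ℝ) →ₗ[ℝ] X) (σ : ℕ ≃ List ℕ) (s : List ℕ) (Y : Submodule ℝ X) : Prop :=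
  ¬ FiniteDimensional ℝ Y ∧ ∃ c : ℝ, 0 < c ∧ ∀ y ∈ Y, c * ‖y‖ ≤ ‖proj ι (Sub σ s) y‖

theorem good_mem {θ : Set (List ℕ)} (hθ : IsTree θ) (σ : ℕ ≃ List ℕ) {ι : (ℕ →₀ ℝ) →ₗ[ℝ] X}
    (hι : ∀ x, ‖ι x‖ = gL (Rt σ) (Th θ σ) (res (Th θ σ) x)) (hd : DenseRange ι)
    {s : List ℕ} {Y : Submodule ℝ X} (h : Good ι σ s Y) : s ∈ θ := by
  by_contra hs
  obtain ⟨hinf, c, hc, hb⟩ := h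
  obtain ⟨y, hy, hne⟩ := exists_unit Y hinf
  have h0 : proj ι (Sub σ s) y = 0 := proj_empty hι hd (fun q hq hq' => hs (hθ _ hq' _ hq)) y
  have := hb y hy
  rw [h0, norm_zero] at this
  have := norm_pos_iff.2 hne
  nlinarith

theorem stabilize {θ : Set (List ℕ)} (hθ : IsTree θ) (hWF : ¬ HasBranch θ) (σ : ℕ ≃ List ℕ)
    {ι : (ℕ →₀ ℝ) →ₗ[ℝ] X}
    (hι : ∀ x, ‖ι x‖ = gL (Rt σ) (Th θ σ) (res (Th θ σ) x)) (hd : DenseRange ι)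
    (Y : Submodule ℝ X) (hY : ¬ FiniteDimensional ℝ Y) :
    ∃ s, ∃ Y' ≤ Y, Good ι σ s Y' ∧ ∀ n : ℕ, ∀ Y'' ≤ Y', ¬ Good ι σ (s ++ [n]) Y'' := by
  classical
  by_contra hcon
  push Not at hcon
  have hstep : ∀ b : {b : List ℕ × Submodule ℝ X // b.2 ≤ Y ∧ Good ι σ b.1 b.2},
      ∃ b' : {b : List ℕ × Submodule ℝ X // b.2 ≤ Y ∧ Good ι σ b.1 b.2},
        ∃ n : ℕ, b'.1.1 = b.1.1 ++ [n] := by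
    rintro ⟨⟨s, Y'⟩, hle, hg⟩
    obtain ⟨n, Y'', hle', hg'⟩ := hcon s Y' hle hg
    exact ⟨⟨(s ++ [n], Y''), hle'.trans hle, hg'⟩, n, rfl⟩
  choose nx β hβ using hstep
  have h0 : Good ι σ [] Y := by
    refine ⟨hY, 1, one_pos, fun y _ => ?_⟩
    have : Sub σ [] = Set.univ := by ext q; simp [Sub]
    rw [this, proj_univ hι hd, one_mul]
  let b0 : {b : List ℕ × Submodule ℝ X // b.2 ≤ Y ∧ Good ι σ b.1 b.2} := ⟨([], Y), le_rfl, h0⟩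
  let st : ℕ → {b : List ℕ × Submodule ℝ X // b.2 ≤ Y ∧ Good ι σ b.1 b.2} := fun n => nx^[n] b0
  apply hWF
  refine ⟨fun n => β (st n), fun n => ?_⟩
  have : (List.range n).map (fun n => β (st n)) = (st n).1.1 := by
    induction n with
    | zero => rfl
    | succ n ih =>
      have e : st (n + 1) = nx (st n) := Function.iterate_succ_apply' nx n b0
      rw [List.range_succ, List.map_append, ih, e, hβ]
      rfl
  rw [this]
  exact good_mem hθ σ hι hd (st n).2.2

theorem main_seq {θ : Set (List ℕ)} (hθ : IsTree θ) (hWF : ¬ HasBranch θ) (σ : ℕ ≃ List ℕ)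
    {ι : (ℕ →₀ ℝ) →ₗ[ℝ] X}
    (hι : ∀ x, ‖ι x‖ = gL (Rt σ) (Th θ σ) (res (Th θ σ) x)) (hd : DenseRange ι)
    (Y : Submodule ℝ X) (hY : ¬ FiniteDimensional ℝ Y) (W : X → Finset (X →ₗ[ℝ] ℝ)) :
    ∃ (y : ℕ → X) (p : ℕ → ℕ) (C : ℝ), 0 < C ∧ (∀ k, y k ∈ Y ∧ ‖y k‖ = 1) ∧ StrictMono p ∧
      (∀ i j, i < j → p i * p i ≤ p j) ∧ (∀ i j, i < j → ∀ φ ∈ W (y i), φ (y j) = 0) ∧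
      ∀ (J : Finset ℕ) (a : ℕ → ℝ), tL (vec p J a) ≤ C * ‖∑ j ∈ J, a j • y j‖ ∧
        ‖∑ j ∈ J, a j • y j‖ ≤ C * tL (vec p J a) := by
  obtain ⟨s, Y', hle, ⟨hinf, c, hc, hlow⟩, hno⟩ := stabilize hθ hWF σ hι hd Y hY
  have hnegl : ∀ n, Negl ι Y' (Sub σ (s ++ [n])) := by
    intro n Y1 hle1 hinf1 ε hε
    refine ss_lemma _ Y1 hinf1 (fun Y2 hle2 hinf2 c' hc' => ?_) ε hε
    by_contra hcon
    push Not at hcon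
    exact hno n Y2 (hle2.trans hle1) ⟨hinf2, c', hc', hcon⟩
  have key : ∀ q ∈ Sub σ s, q ∉ ({σ.symm s} : Set ℕ) → ∃ n l, σ q = s ++ n :: l := by
    rintro q ⟨l, hl⟩ hq
    cases l with
    | nil =>
      exfalso; apply hq
      rw [List.append_nil] at hl
      rw [Set.mem_singleton_iff, hl]; simp
    | cons n l => exact ⟨n, l, hl.symm⟩
  obtain ⟨y, p, C, hC, h1, h2⟩ := estimate hι hd Y' hinf (Sub σ s) {σ.symm s}
    (negl_singleton hι hd Y' _) (by
      intro q hq hq0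
      obtain ⟨n, l, hl⟩ := key q hq hq0
      refine ⟨_, hnegl n, fun q' hq' hq0' hqn => ?_⟩
      obtain ⟨n', l', hl'⟩ := key q' hq' hq0'
      have hne : n ≠ n' := by
        rintro rfl
        apply hqn
        rw [Sub, Set.mem_ofPred_eq, hl']
        exact ⟨l', by simp⟩
      have hnc : ¬ TreeComparable (σ q) (σ q') := by
        rw [hl, hl']
        rintro (h | h)
        · rw [List.prefix_append_right_inj, List.cons_prefix_cons] at h
          exact hne h.1
        · rw [List.prefix_append_right_inj, List.cons_prefix_cons] at h
          exact hne h.1.symm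
      exact ⟨hnc, fun h => hnc (Or.symm h)⟩) hc hlow W
  exact ⟨y, p, C, hC, fun k => ⟨hle (h1 k).1, (h1 k).2⟩, h2⟩

end
end PTS

namespace PTS
open Finset

theorem finsupp_vec (p : ℕ → ℕ) (b : ℕ →₀ ℝ) : b.mapDomain p = vec p b.support b := rfl

section
variable {Z : Type*} [NormedAddCommGroup Z] [NormedSpace ℝ Z]

theorem tL_comb_le {y : ℕ → Z} {p : ℕ → ℕ} {C : ℝ}
    (h : ∀ (J : Finset ℕ) (a : ℕ → ℝ), tL (vec p J a) ≤ C * ‖∑ j ∈ J, a j • y j‖ ∧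
        ‖∑ j ∈ J, a j • y j‖ ≤ C * tL (vec p J a)) (b : ℕ →₀ ℝ) :
    tL (b.mapDomain p) ≤ C * ‖Finsupp.linearCombination ℝ y b‖ ∧
      ‖Finsupp.linearCombination ℝ y b‖ ≤ C * tL (b.mapDomain p) := h b.support b

theorem indep_of_est {y : ℕ → Z} {p : ℕ → ℕ} (hp : StrictMono p) {C : ℝ}
    (h : ∀ (J : Finset ℕ) (a : ℕ → ℝ), tL (vec p J a) ≤ C * ‖∑ j ∈ J, a j • y j‖ ∧
        ‖∑ j ∈ J, a j • y j‖ ≤ C * tL (vec p J a)) : LinearIndependent ℝ y := by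
  rw [linearIndependent_iff']
  intro s g hg i hi
  have h1 := (h s g).1
  rw [hg, norm_zero, mul_zero] at h1
  exact abs_eq_zero.1 (le_antisymm ((abs_le_tL_vec hp.injective hi).trans h1) (abs_nonneg _))

theorem infdim_of_indep {y : ℕ → Z} (hy : LinearIndependent ℝ y) (F : Submodule ℝ Z)
    (hF : ∀ k, y k ∈ F) : ¬ FiniteDimensional ℝ F := by
  intro hfd
  have h : LinearIndependent ℝ (fun k => (⟨y k, hF k⟩ : F)) :=
    LinearIndependent.of_comp F.subtype hy
  have : Finite ℕ := h.finite
  exact not_finite ℕ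

theorem not_minimal {y : ℕ → Z} {p : ℕ → ℕ} (hp : StrictMono p)
    (hp2 : ∀ i j, i < j → p i * p i ≤ p j) {C : ℝ} (hC : 0 < C)
    (h : ∀ (J : Finset ℕ) (a : ℕ → ℝ), tL (vec p J a) ≤ C * ‖∑ j ∈ J, a j • y j‖ ∧
        ‖∑ j ∈ J, a j • y j‖ ≤ C * tL (vec p J a)) : ¬ IsMinimalSpace Z := by
  classical
  rintro ⟨-, hmin⟩
  obtain ⟨κ, hκ, hcore⟩ := core p hp hp2
  have hli := indep_of_est hp h
  set F : Submodule ℝ Z := (Submodule.span ℝ (y '' Set.range κ)).topologicalClosure with hF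
  obtain ⟨S, c, hc, hS⟩ := hmin F (Submodule.isClosed_topologicalClosure _)
    (infdim_of_indep (hli.comp κ hκ.injective) F fun k =>
      Submodule.le_topologicalClosure _ (Submodule.subset_span ⟨κ k, ⟨k, rfl⟩, rfl⟩))
  set η := c / (2 * C) with hη
  have hη0 : 0 < η := by positivity
  set M := ‖S‖ with hM
  have hM0 : 0 ≤ M := by rw [hM]; exact norm_nonneg S
  obtain ⟨n, hn⟩ := exists_nat_ge (2 * C ^ 2 / c + C * (M * C + η) + 1)
  have hpos1 : 0 ≤ 2 * C ^ 2 / c := by positivity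
  have hpos2 : 0 ≤ C * (M * C + η) := by positivity
  have hn1 : 1 ≤ n := by
    have : (1 : ℝ) ≤ n := by linarith
    exact_mod_cast this
  obtain ⟨D, hD⟩ := hcore n hn1
  have happ : ∀ j : ℕ, ∃ b : ℕ →₀ ℝ, b ∈ Finsupp.supported ℝ ℝ (Set.range κ) ∧
      ‖(S (y j) : Z) - Finsupp.linearCombination ℝ y b‖ ≤ η / (D + 1) := by
    intro j
    have hmem : (S (y j) : Z) ∈ closure ((Submodule.span ℝ (y '' Set.range κ) : Submodule ℝ Z) : Set Z) := by
      rw [← Submodule.topologicalClosure_coe]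
      exact (S (y j)).2
    obtain ⟨x, hx, hxd⟩ := Metric.mem_closure_iff.1 hmem (η / (D + 1)) (by positivity)
    obtain ⟨b, hb, rfl⟩ := (Finsupp.mem_span_image_iff_linearCombination ℝ).1 hx
    refine ⟨b, hb, ?_⟩
    rw [← dist_eq_norm]
    exact hxd.le
  choose b hb hbn using happ
  have hcomb : ∀ a : ℕ → ℝ, ∑ j ∈ range D, a j • (b j).mapDomain p =
      (∑ j ∈ range D, a j • b j).mapDomain p := by
    intro a
    have := map_sum (Finsupp.lmapDomain ℝ ℝ p) (fun j => a j • b j) (range D)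
    simp only [map_smul, Finsupp.lmapDomain_apply] at this
    exact this.symm
  have hest : ∀ a : ℕ → ℝ,
      ‖(S (∑ j ∈ range D, a j • y j) : Z) -
        Finsupp.linearCombination ℝ y (∑ j ∈ range D, a j • b j)‖ ≤ η * tL (vec p (range D) a) := by
    intro a
    have e : (S (∑ j ∈ range D, a j • y j) : Z) -
        Finsupp.linearCombination ℝ y (∑ j ∈ range D, a j • b j) =
        ∑ j ∈ range D, a j • ((S (y j) : Z) - Finsupp.linearCombination ℝ y (b j)) := by
      simp only [map_sum, map_smul, Submodule.coe_sum, Submodule.coe_smul, smul_sub,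
        Finset.sum_sub_distrib]
    rw [e]
    refine (norm_sum_le _ _).trans ?_
    have hT : 0 ≤ tL (vec p (range D) a) := gL_nonneg _
    calc _ ≤ ∑ j ∈ range D, tL (vec p (range D) a) * (η / (D + 1)) := by
          refine Finset.sum_le_sum fun j hj => ?_
          rw [norm_smul, Real.norm_eq_abs]
          exact mul_le_mul (abs_le_tL_vec hp.injective hj) (hbn j) (norm_nonneg _) hT
      _ = (D / (D + 1)) * (η * tL (vec p (range D) a)) := by
          rw [Finset.sum_const, card_range, nsmul_eq_mul]; ring
      _ ≤ _ := by
          refine mul_le_of_le_one_left (by positivity) ?_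
          rw [div_le_one (by positivity)]; linarith
  refine hD (fun j => (b j).mapDomain p) ?_ ?_ ?_
  · intro j _ q hq
    rw [finsupp_vec] at hq
    obtain ⟨k, hk, rfl⟩ := vec_ne hq
    obtain ⟨i, rfl⟩ := (Finsupp.mem_supported ℝ _).1 (hb j) (Finset.mem_coe.2 hk)
    exact ⟨i, rfl⟩
  · intro a
    rw [hcomb]
    have h1 := (tL_comb_le h (∑ j ∈ range D, a j • b j)).2
    have h2 := hest a
    have h3 := (h (range D) a).1
    have h4 := hS (∑ j ∈ range D, a j • y j)
    have hT : 0 ≤ tL (vec p (range D) a) := gL_nonneg _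
    have hU : 0 ≤ tL ((∑ j ∈ range D, a j • b j).mapDomain p) := gL_nonneg _
    set T := tL (vec p (range D) a)
    set U := tL ((∑ j ∈ range D, a j • b j).mapDomain p)
    set x := ∑ j ∈ range D, a j • y j
    set v := Finsupp.linearCombination ℝ y (∑ j ∈ range D, a j • b j)
    have h5 : ‖(S x : Z)‖ ≤ ‖(S x : Z) - v‖ + ‖v‖ := by
      have := norm_add_le ((S x : Z) - v) v
      rwa [sub_add_cancel] at this
    have h6 : c * ‖x‖ ≤ ‖(S x : Z)‖ := h4
    have h7 : T / C ≤ ‖x‖ := by rw [div_le_iff₀ hC]; linarith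
    have h8 : c * (T / C) ≤ η * T + C * U := by nlinarith
    have h9 : c * (T / C) - η * T = η * T := by rw [hη]; field_simp; ring
    have h10 : η * T ≤ C * U := by linarith
    have h11 : T ≤ (2 * C ^ 2 / c) * U := by
      rw [hη, div_mul_eq_mul_div, div_le_iff₀ (by positivity)] at h10
      rw [div_mul_eq_mul_div, le_div_iff₀ hc]
      nlinarith
    refine h11.trans (mul_le_mul_of_nonneg_right ?_ hU)
    linarith
  · intro a
    rw [hcomb]
    have h1 := (tL_comb_le h (∑ j ∈ range D, a j • b j)).1
    have h2 := hest a
    have h3 := (h (range D) a).2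
    have h4 := S.le_opNorm (∑ j ∈ range D, a j • y j)
    have hT : 0 ≤ tL (vec p (range D) a) := gL_nonneg _
    set T := tL (vec p (range D) a)
    set U := tL ((∑ j ∈ range D, a j • b j).mapDomain p)
    set x := ∑ j ∈ range D, a j • y j
    set v := Finsupp.linearCombination ℝ y (∑ j ∈ range D, a j • b j)
    have h5 : ‖v‖ ≤ ‖(S x : Z) - v‖ + ‖(S x : Z)‖ := by
      have := norm_sub_le (S x : Z) ((S x : Z) - v)
      rw [sub_sub_cancel] at this
      linarith
    have h6 : ‖(S x : Z)‖ ≤ M * ‖x‖ := h4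
    have h7 : M * ‖x‖ ≤ M * (C * T) := mul_le_mul_of_nonneg_left h3 hM0
    have h8 : ‖v‖ ≤ (M * C + η) * T := by linarith
    calc U ≤ C * ‖v‖ := h1
      _ ≤ C * ((M * C + η) * T) := mul_le_mul_of_nonneg_left h8 hC.le
      _ = C * (M * C + η) * T := by ring
      _ ≤ n * T := mul_le_mul_of_nonneg_right (by linarith) hT

theorem dense_codRestrict {E : Type*} [AddCommGroup E] [Module ℝ E] (e : E →ₗ[ℝ] Z) :
    DenseRange (e.codRestrict (LinearMap.range e).topologicalClosure
      (fun x => Submodule.le_topologicalClosure _ (LinearMap.mem_range_self e x))) := by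
  intro x
  rw [closure_subtype]
  have hx : (x : Z) ∈ closure ((LinearMap.range e : Submodule ℝ Z) : Set Z) := by
    rw [← Submodule.topologicalClosure_coe]; exact x.2
  refine closure_mono ?_ hx
  rintro _ ⟨a, rfl⟩
  exact ⟨_, ⟨a, rfl⟩, rfl⟩

end

theorem iso_part {X Tsp : Type*} [NormedAddCommGroup X] [NormedSpace ℝ X] [CompleteSpace X]
    [NormedAddCommGroup Tsp] [NormedSpace ℝ Tsp] [CompleteSpace Tsp]
    (v : ℕ → Tsp) (hTnorm : ∀ a : ℕ →₀ ℝ, ‖∑ n ∈ a.support, a n • v n‖ = tsirNormLim a)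
    {y : ℕ → X} {p : ℕ → ℕ} {C : ℝ}
    (h : ∀ (J : Finset ℕ) (a : ℕ → ℝ), tL (vec p J a) ≤ C * ‖∑ j ∈ J, a j • y j‖ ∧
        ‖∑ j ∈ J, a j • y j‖ ≤ C * tL (vec p J a)) :
    ∃ G : Submodule ℝ Tsp, Nonempty
      ((LinearMap.range (Finsupp.linearCombination ℝ y)).topologicalClosure ≃L[ℝ] G) := by
  set e1 := Finsupp.linearCombination ℝ y with he1
  set e2 : (ℕ →₀ ℝ) →ₗ[ℝ] Tsp := Finsupp.linearCombination ℝ v ∘ₗ Finsupp.lmapDomain ℝ ℝ p with he2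
  have hn2 : ∀ b, ‖e2 b‖ = tL (b.mapDomain p) := by
    intro b
    rw [← tsirNormLim_eq, ← hTnorm]
    rfl
  have : CompleteSpace (LinearMap.range e1).topologicalClosure :=
    (Submodule.isClosed_topologicalClosure _).completeSpace_coe
  have : CompleteSpace (LinearMap.range e2).topologicalClosure :=
    (Submodule.isClosed_topologicalClosure _).completeSpace_coe
  refine ⟨(LinearMap.range e2).topologicalClosure, ⟨LinearEquiv.extend (LinearEquiv.refl ℝ (ℕ →₀ ℝ))
    _ _ (dense_codRestrict e1) ⟨C, fun b => ?_⟩ (dense_codRestrict e2) ⟨C, fun b => ?_⟩⟩⟩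
  · change ‖e2 b‖ ≤ C * ‖e1 b‖
    rw [hn2]
    exact (tL_comb_le h b).1
  · change ‖e1 b‖ ≤ C * ‖e2 b‖
    rw [hn2]
    exact (tL_comb_le h b).2

theorem biSup_le' {n : ℕ} {a : ℕ → ℝ} {B : ℝ} (hB : 0 ≤ B) (h : ∀ k < n, |a k| ≤ B) :
    (⨆ k ∈ Finset.range n, |a k|) ≤ B :=
  Real.iSup_le (fun k => Real.iSup_le (fun hk => h k (mem_range.1 hk)) hB) hB

theorem le_biSup' {n : ℕ} {a : ℕ → ℝ} {k : ℕ} (hk : k < n) :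
    |a k| ≤ ⨆ k ∈ Finset.range n, |a k| := by
  have hb : BddAbove (Set.range fun k => ⨆ (_ : k ∈ Finset.range n), |a k|) := by
    refine ⟨∑ i ∈ range n, |a i|, ?_⟩
    rintro _ ⟨i, rfl⟩
    refine Real.iSup_le (fun hi => ?_) (Finset.sum_nonneg fun _ _ => abs_nonneg _)
    exact Finset.single_le_sum (f := fun i => |a i|) (fun _ _ => abs_nonneg _) hi
  refine le_trans ?_ (le_ciSup hb k)
  have : Nonempty (k ∈ Finset.range n) := ⟨mem_range.2 hk⟩
  rw [ciSup_const]

theorem no_c0 {X : Type*} [NormedAddCommGroup X] [NormedSpace ℝ X] [CompleteSpace X]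
    {θ : Set (List ℕ)} (hθ : IsTree θ) (hWF : ¬ HasBranch θ) (σ : ℕ ≃ List ℕ)
    {ι : (ℕ →₀ ℝ) →ₗ[ℝ] X}
    (hι : ∀ x, ‖ι x‖ = gL (Rt σ) (Th θ σ) (res (Th θ σ) x)) (hd : DenseRange ι) :
    ¬ ContainsC0 X := by
  classical
  rintro ⟨w, c, C, hc, hw⟩
  have hcomb : ∀ b : ℕ →₀ ℝ, ∃ n, b.support ⊆ range n ∧
      Finsupp.linearCombination ℝ w b = ∑ k ∈ range n, b k • w k := by
    intro b
    obtain ⟨n, hn⟩ := b.support.exists_nat_subset_range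
    exact ⟨n, hn, Finsupp.sum_of_support_subset _ hn _ (by simp)⟩
  have hlow : ∀ (b : ℕ →₀ ℝ) k, c * |b k| ≤ ‖Finsupp.linearCombination ℝ w b‖ := by
    intro b k
    by_cases hk : b k = 0
    · rw [hk, abs_zero, mul_zero]; exact norm_nonneg _
    obtain ⟨n, hn, e⟩ := hcomb b
    rw [e]
    refine le_trans ?_ (hw n b).1
    exact mul_le_mul_of_nonneg_left
      (le_biSup' (mem_range.1 (hn (Finsupp.mem_support_iff.2 hk)))) hc.le
  have hup : ∀ (b : ℕ →₀ ℝ) (B : ℝ), 0 ≤ B → (∀ k, |b k| ≤ B) →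
      ‖Finsupp.linearCombination ℝ w b‖ ≤ |C| * B := by
    intro b B hB hb
    obtain ⟨n, hn, e⟩ := hcomb b
    rw [e]
    refine (hw n b).2.trans ?_
    have h0 : 0 ≤ ⨆ k ∈ Finset.range n, |b k| :=
      Real.iSup_nonneg fun _ => Real.iSup_nonneg fun _ => abs_nonneg _
    exact (mul_le_mul_of_nonneg_right (le_abs_self C) h0).trans
      (mul_le_mul_of_nonneg_left (biSup_le' hB fun k _ => hb k) (abs_nonneg _))
  have hker : LinearMap.ker (Finsupp.linearCombination ℝ w) = ⊥ := by
    rw [LinearMap.ker_eq_bot']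
    intro b hb
    ext k
    have := hlow b k
    rw [hb, norm_zero] at this
    have h1 : |b k| ≤ 0 := by
      by_contra hcon
      push Not at hcon
      nlinarith
    exact abs_eq_zero.1 (le_antisymm h1 (abs_nonneg _))
  have hli : LinearIndependent ℝ w := by
    rw [linearIndependent_iff']
    intro s g hg i hi
    have h0 : Finsupp.linearCombination ℝ w (vec id s g) = 0 := by
      rw [vec, map_sum, ← hg]
      refine Finset.sum_congr rfl fun j _ => ?_
      rw [Finsupp.linearCombination_single]; rfl
    have : vec id s g = 0 := by
      have : vec id s g ∈ LinearMap.ker (Finsupp.linearCombination ℝ w) := LinearMap.mem_ker.2 h0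
      rwa [hker, Submodule.mem_bot] at this
    have h2 := vec_apply (p := id) Function.injective_id (a := g) hi
    rw [this] at h2
    exact h2.symm
  obtain ⟨g, hg⟩ := LinearMap.exists_leftInverse_of_injective _ hker
  have hgY : ∀ y ∈ Submodule.span ℝ (Set.range w), Finsupp.linearCombination ℝ w (g y) = y := by
    intro y hy
    rw [← Finsupp.range_linearCombination] at hy
    obtain ⟨b, rfl⟩ := hy
    have := LinearMap.congr_fun hg b
    rw [LinearMap.comp_apply, LinearMap.id_apply] at this
    rw [this]
  obtain ⟨y, p, K, hK, hy, hp, -, hW, hest⟩ := main_seq hθ hWF σ hι hd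
    (Submodule.span ℝ (Set.range w))
    (infdim_of_indep hli _ fun k => Submodule.subset_span ⟨k, rfl⟩)
    (fun x => (g x).support.image fun i => Finsupp.lapply i ∘ₗ g)
  have hdisj : ∀ i j, i < j → ∀ a, g (y i) a ≠ 0 → g (y j) a = 0 := by
    intro i j hij a ha
    exact hW i j hij _ (Finset.mem_image.2 ⟨a, Finsupp.mem_support_iff.2 ha, rfl⟩)
  have hcoef : ∀ i a, |g (y i) a| ≤ 1 / c := by
    intro i a
    have := hlow (g (y i)) a
    rw [hgY _ (hy i).1, (hy i).2] at this
    rw [le_div_iff₀ hc]; linarith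
  have hsum : ∀ J : Finset ℕ, ‖∑ j ∈ J, (1 : ℝ) • y j‖ ≤ |C| * (1 / c) := by
    intro J
    have hmem : ∑ j ∈ J, (1 : ℝ) • y j ∈ Submodule.span ℝ (Set.range w) :=
      Submodule.sum_mem _ fun j _ => Submodule.smul_mem _ _ (hy j).1
    rw [← hgY _ hmem]
    refine hup _ _ (by positivity) fun a => ?_
    simp only [map_sum, one_smul, Finsupp.finsetSum_apply]
    by_cases hex : ∃ k ∈ J, g (y k) a ≠ 0
    · obtain ⟨k, hk, hne⟩ := hex
      rw [Finset.sum_eq_single_of_mem k hk]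
      · exact hcoef k a
      · intro j _ hjk
        rcases lt_or_gt_of_ne hjk with h | h
        · by_contra hcon
          exact hne (hdisj j k h a hcon)
        · exact hdisj k j h a hne
    · push Not at hex
      rw [Finset.sum_eq_zero hex, abs_zero]; positivity
  obtain ⟨L, hL⟩ := exists_nat_gt (2 * (K * (|C| * (1 / c))))
  have h1 : (L : ℝ) / 2 ≤ tL (vec p (Ico L (2 * L)) fun _ => 1) := by
    have h := le_tL_of_flex (Ico L (2 * L)) (fun i => {p i})
      (vec p (Ico L (2 * L)) fun _ => 1) ?_ ?_
    · refine le_trans ?_ h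
      have : ∀ i ∈ Ico L (2 * L), tL (res (↑({p i} : Finset ℕ))
          (vec p (Ico L (2 * L)) fun _ => 1)) = 1 := by
        intro i hi
        rw [Finset.coe_singleton, res_singleton, tL, gL_single, vec_apply hp.injective hi, abs_one]
      rw [Finset.sum_congr rfl this]
      simp only [sum_const, Nat.card_Ico, nsmul_eq_mul, mul_one]
      have : 2 * L - L = L := by omega
      rw [this]
      linarith
    · intro i hi q hq
      rw [mem_singleton] at hq
      rw [mem_Ico] at hi
      subst hq
      rw [Nat.card_Ico]
      have := hp.le_apply (x := i)
      omega
    · intro i _ j _ hij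
      simp only [mem_singleton, forall_eq]
      rcases lt_or_gt_of_ne hij with h | h
      · exact Or.inl (hp h)
      · exact Or.inr (hp h)
  have h2 := (hest (Ico L (2 * L)) fun _ => 1).1
  have h3 := mul_le_mul_of_nonneg_left (hsum (Ico L (2 * L))) hK.le
  linarith

end PTS

theorem parameterized_tsirelson_saturated
    {X Tsp : Type*} [NormedAddCommGroup X] [NormedSpace ℝ X] [CompleteSpace X]
    [NormedAddCommGroup Tsp] [NormedSpace ℝ Tsp] [CompleteSpace Tsp]
    (θ : Set (List ℕ)) (hθ : IsTree θ) (hWF : ¬ HasBranch θ)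
    (σ : ℕ ≃ List ℕ) (hσ : CompatibleEnum σ)
    (u : List ℕ → X)
    (hXnorm : ∀ z : List ℕ →₀ ℝ, ↑z.support ⊆ θ →
      ‖∑ s ∈ z.support, z s • u s‖ = tsNormLim θ σ z)
    (hXdense : DenseRange fun z : {z : List ℕ →₀ ℝ // ↑z.support ⊆ θ} =>
      ∑ s ∈ (z : List ℕ →₀ ℝ).support, (z : List ℕ →₀ ℝ) s • u s)
    (v : ℕ → Tsp)
    (hTnorm : ∀ a : ℕ →₀ ℝ, ‖∑ n ∈ a.support, a n • v n‖ = tsirNormLim a)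
    (hTdense : DenseRange fun a : ℕ →₀ ℝ => ∑ n ∈ a.support, a n • v n) :
    (∀ Y : Submodule ℝ X, IsClosed (Y : Set X) → ¬ FiniteDimensional ℝ Y →
      ∃ F : Submodule ℝ X, F ≤ Y ∧ IsClosed (F : Set X) ∧ ¬ FiniteDimensional ℝ F ∧
        ∃ G : Submodule ℝ Tsp, Nonempty (F ≃L[ℝ] G)) ∧
    (∀ Z : Submodule ℝ X, IsClosed (Z : Set X) → ¬ FiniteDimensional ℝ Z →
      ¬ IsMinimalSpace Z) ∧
    ¬ ContainsC0 X := by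
  obtain ⟨ι, hι, hd⟩ := PTS.exists_iota θ σ u hXnorm hXdense
  refine ⟨fun Y hcl hinf => ?_, fun Z _ hinf => ?_, PTS.no_c0 hθ hWF σ hι hd⟩
  · obtain ⟨y, p, C, hC, hy, hp, -, -, hest⟩ := PTS.main_seq hθ hWF σ hι hd Y hinf (fun _ => ∅)
    refine ⟨(LinearMap.range (Finsupp.linearCombination ℝ y)).topologicalClosure, ?_,
      Submodule.isClosed_topologicalClosure _, ?_, PTS.iso_part v hTnorm hest⟩
    · refine Submodule.topologicalClosure_minimal _ ?_ hcl
      rw [Finsupp.range_linearCombination, Submodule.span_le]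
      rintro _ ⟨k, rfl⟩
      exact (hy k).1
    · refine PTS.infdim_of_indep (PTS.indep_of_est hp hest) _ fun k => ?_
      refine Submodule.le_topologicalClosure _ ?_
      rw [Finsupp.range_linearCombination]
      exact Submodule.subset_span ⟨k, rfl⟩
  · obtain ⟨y, p, C, hC, hy, hp, hp2, -, hest⟩ := PTS.main_seq hθ hWF σ hι hd Z hinf (fun _ => ∅)
    refine PTS.not_minimal (y := fun k => (⟨y k, (hy k).1⟩ : Z)) hp hp2 hC fun J a => ?_
    have : ‖∑ j ∈ J, a j • (⟨y j, (hy j).1⟩ : Z)‖ = ‖∑ j ∈ J, a j • y j‖ := by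
      change ‖((∑ j ∈ J, a j • (⟨y j, (hy j).1⟩ : Z) : Z) : X)‖ = _
      rw [Submodule.coe_sum]
      rfl
    rw [this]
    exact hest J a
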